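/- Let T^2 = S^1_{1/√π} × S^1_{1/√π} be the flat square torus of area 4π, and let S^2 be the unit round 2-sphere (so V^2(S^2) = 4π = V^2(T^2)). Then for every v > 0, I_{S^2×R^2}(v) ≤ I_{T^2×R^2}(v), where S^2 × R^2 and T^2 × R^2 carry the product metrics with R^2 Euclidean. -/

import Mathlib

open MeasureTheory Real ENNReal NNReal

noncomputable section

/-- The flat circle of radius `r` (circumference `2πr`), i.e. `ℝ / (2πr)ℤ`
with the quotient (arc-length) metric. -/
abbrev Circ (r : ℝ) : Type := AddCircle (2 * Real.pi * r)

/-- `d`-dimensional Hausdorff (Riemannian) measure of a subset of a metric space. -/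
noncomputable def haus (X : Type*) [EMetricSpace X] (d : ℕ) (s : Set X) : ℝ≥0∞ :=
  letI : MeasurableSpace X := borel X
  haveI : BorelSpace X := ⟨rfl⟩
  (MeasureTheory.Measure.hausdorffMeasure (d : ℝ) : Measure X) s

/-- A closed region is the closure of an open set. -/
def IsClosedRegion {X : Type*} [TopologicalSpace X] (U : Set X) : Prop :=
  ∃ V : Set X, IsOpen V ∧ U = closure V

/-- The isoperimetric profile of an `m`-dimensional space `X`:
the infimum of the `(m-1)`-dimensional boundary measures of closed regions
of `m`-dimensional measure `v`. -/
noncomputable def isoProfile (X : Type*) [EMetricSpace X] (m : ℕ) (v : ℝ≥0∞) : ℝ≥0∞ :=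
  ⨅ (U : Set X) (_ : IsClosedRegion U ∧ haus X m U = v), haus X (m - 1) (frontier U)

/-- An isoperimetric region in the `m`-dimensional space `X`. -/
def IsIsoRegion (X : Type*) [EMetricSpace X] (m : ℕ) (Ω : Set X) : Prop :=
  IsClosedRegion Ω ∧ haus X (m - 1) (frontier Ω) = isoProfile X m (haus X m Ω)

/-- Euclidean `n`-space. -/
abbrev EucSp (n : ℕ) : Type := EuclideanSpace ℝ (Fin n)

/-- The Riemannian product `S¹_r × ℝ^m` (with the `ℓ²` product metric). -/
abbrev S1R (r : ℝ) (m : ℕ) : Type := WithLp 2 (Circ r × EucSp m)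

/-- The Riemannian product `S¹_{r1} × S¹_{r2} × ℝ^n = T² × ℝ^n`. -/
abbrev T2R (r1 r2 : ℝ) (n : ℕ) : Type := WithLp 2 (Circ r1 × S1R r2 n)

/-- first circle coordinate of a point of `T² × ℝ^n` -/
def t2fst {r1 r2 : ℝ} {n : ℕ} (p : T2R r1 r2 n) : Circ r1 :=
  (WithLp.equiv 2 (Circ r1 × S1R r2 n) p).1

/-- second circle coordinate of a point of `T² × ℝ^n` -/
def t2snd {r1 r2 : ℝ} {n : ℕ} (p : T2R r1 r2 n) : Circ r2 :=
  (WithLp.equiv 2 (Circ r2 × EucSp n) ((WithLp.equiv 2 (Circ r1 × S1R r2 n) p).2)).1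

/-- Euclidean coordinate of a point of `T² × ℝ^n` -/
def t2euc {r1 r2 : ℝ} {n : ℕ} (p : T2R r1 r2 n) : EucSp n :=
  (WithLp.equiv 2 (Circ r2 × EucSp n) ((WithLp.equiv 2 (Circ r1 × S1R r2 n) p).2)).2

/-- `ω_n`, the `n`-dimensional volume of the unit round sphere `Sⁿ ⊂ ℝ^{n+1}`. -/
noncomputable def omegaS (n : ℕ) : ℝ :=
  (haus (EucSp (n+1)) n (Metric.sphere (0 : EucSp (n+1)) 1)).toReal

/-- `β_n(r) = n^{(n-1)(n+1)} (2πr ω_{n-1})^{n+1} (1+n)^{-n²} ω_n^{-n}`. -/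
noncomputable def betaC (n : ℕ) (r : ℝ) : ℝ :=
  (n : ℝ) ^ ((n-1)*(n+1)) * (2 * Real.pi * r * omegaS (n-1)) ^ (n+1) *
    ((1 + (n : ℝ)) ^ (n^2))⁻¹ * ((omegaS n) ^ n)⁻¹

/-- The isoperimetric profile of `ℝ^m`: `I_{ℝ^m}(v) = m^{(m-1)/m} ω_{m-1}^{1/m} v^{(m-1)/m}`. -/
noncomputable def eucProfile (m : ℕ) (v : ℝ) : ℝ :=
  (m : ℝ) ^ (((m : ℝ) - 1)/m) * omegaS (m-1) ^ ((1 : ℝ)/m) * v ^ (((m : ℝ) - 1)/m)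

/-- The region `S¹_{r1} × S¹_{r2} × B^n_R` in `T² × ℝ^n`. -/
def tball (r1 r2 : ℝ) (n : ℕ) (R : ℝ) : Set (T2R r1 r2 n) :=
  {p | ‖t2euc p‖ ≤ R}

/-- `f_n(v) = V^{n+1}(∂(S¹_{r1} × S¹_{r2} × B^n_R))`, where `R > 0` is such that
`V^{n+2}(S¹_{r1} × S¹_{r2} × B^n_R) = v`. -/
noncomputable def fA (r1 r2 : ℝ) (n : ℕ) (v : ℝ≥0∞) : ℝ≥0∞ :=
  ⨅ (R : ℝ) (_ : 0 < R ∧ haus (T2R r1 r2 n) (n+2) (tball r1 r2 n R) = v),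
    haus (T2R r1 r2 n) (n+1) (frontier (tball r1 r2 n R))

/-- The slice function `F₁(t) = V^{n+1}(Ω ∩ ({t} × S¹_{r2} × ℝ^n))`. -/
noncomputable def sliceF1 {r1 r2 : ℝ} {n : ℕ} (Ω : Set (T2R r1 r2 n)) (t : Circ r1) : ℝ≥0∞ :=
  haus (T2R r1 r2 n) (n+1) (Ω ∩ {p | t2fst p = t})

/-- The slice function `F₂(s) = V^{n+1}(Ω ∩ (S¹_{r1} × {s} × ℝ^n))`. -/
noncomputable def sliceF2 {r1 r2 : ℝ} {n : ℕ} (Ω : Set (T2R r1 r2 n)) (s : Circ r2) : ℝ≥0∞ :=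
  haus (T2R r1 r2 n) (n+1) (Ω ∩ {p | t2snd p = s})

/-- `θ_m`, the minimum (infimum) of the slice function `F₁`. -/
noncomputable def thetaMin {r1 r2 : ℝ} {n : ℕ} (Ω : Set (T2R r1 r2 n)) : ℝ≥0∞ :=
  ⨅ t : Circ r1, sliceF1 Ω t

/-- `θ_M`, the maximum (supremum) of the slice function `F₁`. -/
noncomputable def thetaMax {r1 r2 : ℝ} {n : ℕ} (Ω : Set (T2R r1 r2 n)) : ℝ≥0∞ :=
  ⨆ t : Circ r1, sliceF1 Ω t

/-- `σ_m`, the minimum (infimum) of the slice function `F₂`. -/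
noncomputable def sigmaMin {r1 r2 : ℝ} {n : ℕ} (Ω : Set (T2R r1 r2 n)) : ℝ≥0∞ :=
  ⨅ s : Circ r2, sliceF2 Ω s

/-- `σ_M`, the maximum (supremum) of the slice function `F₂`. -/
noncomputable def sigmaMax {r1 r2 : ℝ} {n : ℕ} (Ω : Set (T2R r1 r2 n)) : ℝ≥0∞ :=
  ⨆ s : Circ r2, sliceF2 Ω s

/-- The region `S¹_r × B^m_R` in `S¹_r × ℝ^m`. -/
def s1ball (r : ℝ) (m : ℕ) (R : ℝ) : Set (S1R r m) :=
  {p | ‖(WithLp.equiv 2 (Circ r × EucSp m) p).2‖ ≤ R}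

/-- The unit round 2-sphere `S² ⊂ ℝ³` (its Hausdorff measures coincide with the
Riemannian ones). -/
abbrev Sph2 : Type := ↥(Metric.sphere (0 : EucSp 3) 1)

section

open Pointwise Set in
/-- One-dimensional Brunn–Minkowski inequality. -/
theorem volume_add_le_volume_add {E F : Set ℝ} (hE : IsCompact E) (hF : IsCompact F)
    (hE0 : E.Nonempty) (hF0 : F.Nonempty) : volume E + volume F ≤ volume (E + F) := by
  have h1 := hE.isGreatest_sSup hE0
  have h2 := hF.isLeast_sInf hF0
  set e := sSup E
  set f := sInf F
  have hm1 : MeasurableSet ((fun x => x + f) '' E) :=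
    (hE.image (by fun_prop)).isClosed.measurableSet
  have key : AEDisjoint volume ((fun x => x + f) '' E) ((fun x => e + x) '' F) := by
    refine measure_mono_null (t := {e + f}) ?_ (by simp)
    rintro x ⟨⟨y, hy, rfl⟩, ⟨z, hz, hyz⟩⟩
    have a1 := h1.2 hy
    have a2 := h2.2 hz
    simp only [mem_singleton_iff]
    simp only at hyz
    linarith
  have h3 : volume (((fun x => x + f) '' E) ∪ ((fun x => e + x) '' F)) = volume E + volume F := by
    rw [measure_union₀' hm1.nullMeasurableSet key]
    simp
  rw [← h3]
  apply measure_mono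
  rintro x (⟨y, hy, rfl⟩ | ⟨y, hy, rfl⟩)
  · exact add_mem_add hy h2.1
  · exact add_mem_add h1.1 hy

/-- The measure of the slices of a compact set is upper semicontinuous. -/
theorem isClosed_setOf_le_measure_slice {X Y : Type*} [TopologicalSpace X] [TopologicalSpace Y]
    [T2Space X] [MeasurableSpace Y] [T2Space Y] [OpensMeasurableSpace Y] (μ : Measure Y)
    [μ.OuterRegular] {K : Set (X × Y)} (hK : IsCompact K) (t : ℝ≥0∞) :
    IsClosed {x | t ≤ μ (Prod.mk x ⁻¹' K)} := by
  rw [← isOpen_compl_iff, isOpen_iff_mem_nhds]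
  intro x hx
  simp only [Set.mem_compl_iff, Set.mem_ofPred_eq, not_le] at hx
  obtain ⟨O, hO1, hO2, hO3⟩ := Set.exists_isOpen_lt_of_lt _ _ hx
  have hC : IsCompact (K ∩ (Prod.snd ⁻¹' Oᶜ)) :=
    hK.inter_right (hO2.isClosed_compl.preimage continuous_snd)
  have hC2 : IsClosed (Prod.fst '' (K ∩ (Prod.snd ⁻¹' Oᶜ))) := (hC.image continuous_fst).isClosed
  have hx2 : x ∉ Prod.fst '' (K ∩ (Prod.snd ⁻¹' Oᶜ)) := by
    rintro ⟨⟨x', y⟩, ⟨h1, h2⟩, rfl⟩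
    exact h2 (hO1 h1)
  filter_upwards [hC2.isOpen_compl.mem_nhds hx2] with x' hx'
  simp only [Set.mem_compl_iff, Set.mem_ofPred_eq, not_le]
  refine lt_of_le_of_lt (measure_mono ?_) hO3
  intro y hy
  by_contra hyO
  exact hx' ⟨(x', y), ⟨hy, hyO⟩, rfl⟩

open Pointwise Set in
theorem slice_add_subset {A B : Set (ℝ × ℝ)} (x y : ℝ) :
    Prod.mk x ⁻¹' A + Prod.mk y ⁻¹' B ⊆ Prod.mk (x + y) ⁻¹' (A + B) := by
  rintro _ ⟨a, ha, b, hb, rfl⟩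
  exact ⟨(x, a), ha, (y, b), hb, rfl⟩

theorem isCompact_slice {A : Set (ℝ × ℝ)} (hA : IsCompact A) (x : ℝ) :
    IsCompact (Prod.mk x ⁻¹' A) := by
  refine (hA.image continuous_snd).of_isClosed_subset (hA.isClosed.preimage (by fun_prop)) ?_
  intro y hy
  exact ⟨(x, y), hy, rfl⟩

/-- The maximal length of a vertical slice. -/
def sliceSup (A : Set (ℝ × ℝ)) : ℝ := ⨆ x, volume.real (Prod.mk x ⁻¹' A)

theorem bddAbove_slice {A : Set (ℝ × ℝ)} (hA : IsCompact A) :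
    BddAbove (Set.range fun x => volume.real (Prod.mk x ⁻¹' A)) := by
  refine ⟨volume.real (Prod.snd '' A), ?_⟩
  rintro _ ⟨x, rfl⟩
  refine measureReal_mono ?_ (hA.image continuous_snd).measure_ne_top
  intro y hy
  exact ⟨(x, y), hy, rfl⟩

theorem isClosed_le_slice {A : Set (ℝ × ℝ)} (hA : IsCompact A) {t : ℝ} (ht : 0 < t) :
    IsCompact {x | t ≤ volume.real (Prod.mk x ⁻¹' A)} := by
  have h1 : {x | t ≤ volume.real (Prod.mk x ⁻¹' A)}
      = {x | ENNReal.ofReal t ≤ volume (Prod.mk x ⁻¹' A)} := by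
    ext x
    simp only [Set.mem_ofPred_eq]
    rw [measureReal_def, ENNReal.ofReal_le_iff_le_toReal (isCompact_slice hA x).measure_ne_top]
  refine (hA.image continuous_fst).of_isClosed_subset ?_ ?_
  · rw [h1]
    exact isClosed_setOf_le_measure_slice volume hA _
  · intro x hx
    have : (Prod.mk x ⁻¹' A).Nonempty := by
      by_contra h
      rw [Set.not_nonempty_iff_eq_empty] at h
      simp only [Set.mem_ofPred_eq, h, measureReal_empty] at hx
      linarith
    obtain ⟨y, hy⟩ := this
    exact ⟨(x, y), hy, rfl⟩

theorem volume_eq_lintegral_slice {A : Set (ℝ × ℝ)} (hA : IsCompact A) {M : ℝ} (hM : 0 < M) :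
    volume A / ENNReal.ofReal M
      = ∫⁻ s in Set.Ioi 0, volume {x | s * M ≤ volume.real (Prod.mk x ⁻¹' A)} := by
  have h2 : Measurable fun x => volume.real (Prod.mk x ⁻¹' A) :=
    (measurable_measure_prodMk_left hA.isClosed.measurableSet).ennreal_toReal
  have h1 : volume A = ∫⁻ x, volume (Prod.mk x ⁻¹' A) := by
    rw [Measure.volume_eq_prod, Measure.prod_apply hA.isClosed.measurableSet]
  rw [h1, ENNReal.div_eq_inv_mul, ← lintegral_const_mul' _ _ (by simpa using hM)]
  have h3 := lintegral_eq_lintegral_meas_le (volume : Measure ℝ)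
    (f := fun x => volume.real (Prod.mk x ⁻¹' A) / M)
    (Filter.Eventually.of_forall fun x => by simp only [Pi.zero_apply]; positivity)
    (h2.div_const M).aemeasurable
  simp only [le_div_iff₀ hM] at h3
  rw [← h3]
  refine lintegral_congr fun x => ?_
  rw [ENNReal.ofReal_div_of_pos hM, measureReal_def,
    ENNReal.ofReal_toReal (isCompact_slice hA x).measure_ne_top, ENNReal.div_eq_inv_mul]

theorem sliceSup_pos {A : Set (ℝ × ℝ)} (hA : IsCompact A) (h : volume A ≠ 0) : 0 < sliceSup A := by
  by_contra hn
  apply h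
  rw [Measure.volume_eq_prod, Measure.prod_apply hA.isClosed.measurableSet]
  rw [lintegral_eq_zero_iff (measurable_measure_prodMk_left hA.isClosed.measurableSet)]
  refine Filter.Eventually.of_forall fun x => ?_
  have h1 := le_ciSup (bddAbove_slice hA) x
  have h2 : volume.real (Prod.mk x ⁻¹' A) = 0 :=
    le_antisymm (h1.trans (not_lt.1 hn)) measureReal_nonneg
  rwa [measureReal_eq_zero_iff (isCompact_slice hA x).measure_ne_top] at h2

open Pointwise Set in
theorem lintegral_slice_add_le {A B : Set (ℝ × ℝ)} (hA : IsCompact A) (hB : IsCompact B)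
    (hA0 : volume A ≠ 0) (hB0 : volume B ≠ 0) :
    volume A / ENNReal.ofReal (sliceSup A) + volume B / ENNReal.ofReal (sliceSup B)
      ≤ volume (A + B) / ENNReal.ofReal (sliceSup A + sliceSup B) := by
  have hM := sliceSup_pos hA hA0
  have hN := sliceSup_pos hB hB0
  have vanish : ∀ {A : Set (ℝ × ℝ)}, IsCompact A → 0 < sliceSup A → ∀ s ∈ Ioi (0:ℝ),
      s ∉ Ioc (0:ℝ) 1 → volume {x | s * sliceSup A ≤ volume.real (Prod.mk x ⁻¹' A)} = 0 := by
    intro A hA hM s hs hs1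
    have : {x | s * sliceSup A ≤ volume.real (Prod.mk x ⁻¹' A)} = ∅ := by
      ext x
      simp only [mem_ofPred_eq, mem_empty_iff_false, iff_false, not_le]
      have h1 := le_ciSup (bddAbove_slice hA) x
      have h2 : 1 < s := by
        by_contra h
        exact hs1 ⟨hs, not_lt.1 h⟩
      calc _ ≤ sliceSup A := h1
        _ < s * sliceSup A := by nlinarith
    rw [this, measure_empty]
  have red : ∀ {A : Set (ℝ × ℝ)}, IsCompact A → 0 < sliceSup A →
      volume A / ENNReal.ofReal (sliceSup A)
      = ∫⁻ s in Ioo 0 1, volume {x | s * sliceSup A ≤ volume.real (Prod.mk x ⁻¹' A)} := by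
    intro A hA hM
    rw [volume_eq_lintegral_slice hA hM, restrict_Ioo_eq_restrict_Ioc]
    rw [← lintegral_indicator measurableSet_Ioi, ← lintegral_indicator measurableSet_Ioc]
    refine lintegral_congr fun s => ?_
    by_cases hs : s ∈ Ioc (0:ℝ) 1
    · rw [indicator_of_mem hs, indicator_of_mem (by exact hs.1)]
    · rw [indicator_of_notMem hs]
      by_cases hs0 : s ∈ Ioi (0:ℝ)
      · rw [indicator_of_mem hs0, vanish hA hM s hs0 hs]
      · rw [indicator_of_notMem hs0]
  have hne : ∀ {A : Set (ℝ × ℝ)}, IsCompact A → 0 < sliceSup A → ∀ s ∈ Ioo (0:ℝ) 1,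
      {x | s * sliceSup A ≤ volume.real (Prod.mk x ⁻¹' A)}.Nonempty := by
    intro A hA hM s hs
    obtain ⟨x, hx⟩ := exists_lt_of_lt_ciSup (show s * sliceSup A < sliceSup A by nlinarith [hs.2])
    exact ⟨x, hx.le⟩
  rw [red hA hM, red hB hN, volume_eq_lintegral_slice (hA.add hB) (add_pos hM hN)]
  have anti : Antitone fun s : ℝ =>
      volume {x | s * sliceSup A ≤ volume.real (Prod.mk x ⁻¹' A)} := by
    intro s t hst
    refine measure_mono fun x hx => ?_
    simp only [mem_ofPred_eq] at hx ⊢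
    exact le_trans (by gcongr) hx
  rw [← lintegral_add_left anti.measurable]
  refine (setLIntegral_mono' measurableSet_Ioo fun s hs => ?_).trans
    (lintegral_mono_set Ioo_subset_Ioi_self)
  have h1 := isClosed_le_slice hA (mul_pos hs.1 hM)
  have h2 := isClosed_le_slice hB (mul_pos hs.1 hN)
  refine (volume_add_le_volume_add h1 h2 (hne hA hM s hs) (hne hB hN s hs)).trans
    (measure_mono ?_)
  rintro _ ⟨x, hx, y, hy, rfl⟩
  simp only [mem_ofPred_eq] at hx hy ⊢
  have ne : ∀ {A : Set (ℝ × ℝ)} {x t : ℝ}, 0 < t → t ≤ volume.real (Prod.mk x ⁻¹' A) →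
      (Prod.mk x ⁻¹' A).Nonempty := by
    intro A x t ht h
    by_contra hn
    rw [not_nonempty_iff_eq_empty] at hn
    rw [hn, measureReal_empty] at h
    linarith
  have h3 := volume_add_le_volume_add (isCompact_slice hA x) (isCompact_slice hB y)
    (ne (mul_pos hs.1 hM) hx) (ne (mul_pos hs.1 hN) hy)
  have h4 := h3.trans (measure_mono (slice_add_subset x y))
  rw [← ENNReal.toReal_le_toReal (by
    simp [(isCompact_slice hA x).measure_ne_top, (isCompact_slice hB y).measure_ne_top])
    (isCompact_slice (hA.add hB) _).measure_ne_top, ENNReal.toReal_add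
    (isCompact_slice hA x).measure_ne_top (isCompact_slice hB y).measure_ne_top] at h4
  simp only [measureReal_def] at *
  linarith

open Pointwise Set in
/-- Brunn–Minkowski inequality in the plane. -/
theorem brunn_minkowski_plane {A B : Set (ℝ × ℝ)} (hA : IsCompact A) (hB : IsCompact B)
    (hA0 : A.Nonempty) (hB0 : B.Nonempty) :
    (√(volume.real A) + √(volume.real B)) ^ 2 ≤ volume.real (A + B) := by
  have fA := hA.measure_ne_top (μ := volume)
  have fB := hB.measure_ne_top (μ := volume)
  have fC := (hA.add hB).measure_ne_top (μ := volume)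
  by_cases h1 : volume A = 0
  · obtain ⟨a, ha⟩ := hA0
    rw [measureReal_def volume A, h1]
    simp only [ENNReal.toReal_zero, Real.sqrt_zero, zero_add]
    have e : volume.real B = volume.real ((fun b => a + b) '' B) := by simp [measureReal_def]
    rw [Real.sq_sqrt measureReal_nonneg, e]
    exact measureReal_mono (by
      rintro _ ⟨b, hb, rfl⟩
      exact add_mem_add ha hb) fC
  by_cases h2 : volume B = 0
  · obtain ⟨b, hb⟩ := hB0
    rw [measureReal_def volume B, h2]
    simp only [ENNReal.toReal_zero, Real.sqrt_zero, add_zero]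
    have e : volume.real A = volume.real ((fun a => a + b) '' A) := by simp [measureReal_def]
    rw [Real.sq_sqrt measureReal_nonneg, e]
    exact measureReal_mono (by
      rintro _ ⟨a, ha, rfl⟩
      exact add_mem_add ha hb) fC
  have hM := sliceSup_pos hA h1
  have hN := sliceSup_pos hB h2
  have h3 := lintegral_slice_add_le hA hB h1 h2
  have e1 := ENNReal.ofReal_pos.2 hM
  have e2 := ENNReal.ofReal_pos.2 hN
  have e3 := ENNReal.ofReal_pos.2 (add_pos hM hN)
  rw [← ENNReal.toReal_le_toReal (by
      simp only [ne_eq, ENNReal.add_eq_top, not_or]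
      exact ⟨ENNReal.div_ne_top fA e1.ne', ENNReal.div_ne_top fB e2.ne'⟩)
      (ENNReal.div_ne_top fC e3.ne'),
    ENNReal.toReal_add (ENNReal.div_ne_top fA e1.ne') (ENNReal.div_ne_top fB e2.ne')] at h3
  simp only [ENNReal.toReal_div, ENNReal.toReal_ofReal hM.le, ENNReal.toReal_ofReal hN.le,
    ENNReal.toReal_ofReal (add_pos hM hN).le, ← measureReal_def] at h3
  generalize sliceSup A = M at *
  generalize sliceSup B = N at *
  rw [le_div_iff₀ (add_pos hM hN)] at h3
  refine le_trans ?_ h3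
  have hP : 0 ≤ volume.real A := measureReal_nonneg
  have hQ : 0 ≤ volume.real B := measureReal_nonneg
  generalize volume.real A = P at *
  generalize volume.real B = Q at *
  have : (P / M + Q / N) * (M + N) - (√P + √Q) ^ 2 = (√P * N - √Q * M) ^ 2 / (M * N) := by
    nth_rewrite 1 [← Real.sq_sqrt hP]
    nth_rewrite 1 [← Real.sq_sqrt hQ]
    field_simp
    ring
  have h5 : 0 ≤ (√P * N - √Q * M) ^ 2 / (M * N) := by positivity
  linarith

end

section

open Set in
theorem measure_eq_tsum_inter_Ico {X : Type*} [MeasurableSpace X] (μ : Measure X) {f : X → ℝ}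
    (hf : Measurable f) {L : ℝ} (hL : 0 < L) (S : Set X) (b : ℝ) :
    μ S = ∑' n : ℤ, μ (f ⁻¹' Ico (b + n • L) (b + (n + 1) • L) ∩ S) := by
  have h1 : μ.restrict S (⋃ n : ℤ, f ⁻¹' Ico (b + n • L) (b + (n + 1) • L)) = μ S := by
    rw [← preimage_iUnion, iUnion_Ico_add_zsmul hL]
    simp
  rw [← h1, measure_iUnion]
  · refine tsum_congr fun n => ?_
    rw [Measure.restrict_apply (hf measurableSet_Ico)]
  · intro i j hij
    exact (pairwise_disjoint_Ico_add_zsmul b L hij).preimage f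
  · exact fun n => hf measurableSet_Ico

theorem add_zsmul_mem_iff {X : Type*} [AddCommGroup X] {e : X} {A : Set X}
    (hA : ∀ x, x + e ∈ A ↔ x ∈ A) (n : ℤ) (x : X) : x + n • e ∈ A ↔ x ∈ A := by
  induction n using Int.induction_on generalizing x with
  | zero => simp
  | succ n ih => rw [add_zsmul, one_zsmul, ← add_assoc, hA, ih]
  | pred n ih =>
    rw [← hA, ← ih x]
    rw [show x + (-(n:ℤ) - 1) • e + e = x + (-(n:ℤ)) • e by rw [sub_zsmul, one_zsmul]; abel]

open Set in
/-- The measure of a periodic set in a period strip does not depend on the strip. -/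
theorem measure_inter_period {X : Type*} [AddCommGroup X] [MeasurableSpace X] (μ : Measure X)
    (e : X) {f : X → ℝ} (hf : Measurable f) {L : ℝ} (hL : 0 < L) (hfe : ∀ x, f (x + e) = f x + L)
    (hμ : ∀ (n : ℤ) s, μ ((fun x => x + n • e) ⁻¹' s) = μ s) {A : Set X}
    (hA : ∀ x, x + e ∈ A ↔ x ∈ A) (a b : ℝ) :
    μ (A ∩ f ⁻¹' Ico a (a + L)) = μ (A ∩ f ⁻¹' Ico b (b + L)) := by
  have hfn : ∀ (n : ℤ) x, f (x + n • e) = f x + n • L := by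
    intro n
    induction n using Int.induction_on with
    | zero => simp
    | succ n ih => intro x; rw [add_zsmul, one_zsmul, ← add_assoc, hfe, ih, add_zsmul]; simp [add_assoc]
    | pred n ih =>
      intro x
      have := hfe (x + (-(n:ℤ) - 1) • e)
      rw [show x + (-(n:ℤ) - 1) • e + e = x + (-(n:ℤ)) • e by rw [sub_zsmul, one_zsmul]; abel, ih] at this
      simp only [zsmul_eq_mul] at this ⊢
      push_cast at this ⊢
      linarith
  have hAn := add_zsmul_mem_iff hA
  rw [measure_eq_tsum_inter_Ico μ hf hL (A ∩ f ⁻¹' Ico a (a + L)) b,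
    measure_eq_tsum_inter_Ico μ hf hL (A ∩ f ⁻¹' Ico b (b + L)) a, ← (Equiv.neg ℤ).tsum_eq]
  refine tsum_congr fun n => ?_
  rw [← hμ (-n)]
  congr 1
  ext x
  simp only [Equiv.neg_apply, mem_inter_iff, mem_preimage, mem_Ico, hAn, hfn]
  simp only [zsmul_eq_mul, Int.cast_add, Int.cast_neg, Int.cast_one]
  constructor
  · rintro ⟨⟨h1, h2⟩, h3, h4, h5⟩
    exact ⟨⟨by linarith, by linarith⟩, h3, by linarith, by linarith⟩
  · rintro ⟨⟨h1, h2⟩, h3, h4, h5⟩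
    exact ⟨⟨by linarith, by linarith⟩, h3, by linarith, by linarith⟩

/-- The closed disc of radius `r` in `ℝ × ℝ`. -/
def disc (r : ℝ) : Set (ℝ × ℝ) := {p | p.1 ^ 2 + p.2 ^ 2 ≤ r ^ 2}

theorem mem_disc_iff_norm {r : ℝ} (hr : 0 ≤ r) (p : ℝ × ℝ) :
    p ∈ disc r ↔ ‖(⟨p.1, p.2⟩ : ℂ)‖ ≤ r := by
  rw [disc, Set.mem_ofPred_eq, ← sq_le_sq₀ (norm_nonneg _) hr, Complex.sq_norm, Complex.normSq_mk]
  ring_nf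

theorem disc_eq_preimage {r : ℝ} (hr : 0 ≤ r) :
    disc r = Complex.measurableEquivRealProd.symm ⁻¹' Metric.closedBall 0 r := by
  ext p
  rw [mem_disc_iff_norm hr]
  simp [Complex.measurableEquivRealProd_symm_apply]

theorem volume_disc {r : ℝ} (hr : 0 ≤ r) : volume.real (disc r) = π * r ^ 2 := by
  rw [disc_eq_preimage hr, measureReal_def,
    Complex.volume_preserving_equiv_real_prod.symm.measure_preimage
      Metric.isClosed_closedBall.measurableSet.nullMeasurableSet, Complex.volume_closedBall]
  simp [hr]
  ring

theorem isCompact_disc (r : ℝ) : IsCompact (disc r) := by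
  refine (isCompact_Icc.prod isCompact_Icc).of_isClosed_subset (s := Set.Icc (-|r|) |r| ×ˢ Set.Icc (-|r|) |r|) ?_ ?_
  · exact isClosed_le (by fun_prop) (by fun_prop)
  · rintro ⟨x, y⟩ h
    simp only [disc, Set.mem_ofPred_eq] at h
    refine ⟨abs_le.1 (sq_le_sq.1 (by nlinarith)), abs_le.1 (sq_le_sq.1 (by nlinarith))⟩

theorem zero_mem_disc (r : ℝ) : (0 : ℝ × ℝ) ∈ disc r := by
  simp [disc]; positivity

theorem disc_mono {r s : ℝ} (hr : 0 ≤ r) (h : r ≤ s) : disc r ⊆ disc s := by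
  intro p hp
  simp only [disc, Set.mem_ofPred_eq] at *
  nlinarith

open Pointwise in
theorem disc_add_subset {r s : ℝ} (hr : 0 ≤ r) (hs : 0 ≤ s) : disc r + disc s ⊆ disc (r + s) := by
  rintro _ ⟨a, ha, b, hb, rfl⟩
  rw [mem_disc_iff_norm hr] at ha
  rw [mem_disc_iff_norm hs] at hb
  rw [mem_disc_iff_norm (add_nonneg hr hs)]
  have := norm_add_le (⟨a.1, a.2⟩ : ℂ) ⟨b.1, b.2⟩
  have e : (⟨(a + b).1, (a + b).2⟩ : ℂ) = ⟨a.1, a.2⟩ + ⟨b.1, b.2⟩ := by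
    apply Complex.ext <;> simp
  rw [e]
  linarith

open Pointwise in
theorem le_volume_add_disc {A : Set (ℝ × ℝ)} (hA : IsCompact A) (hA0 : A.Nonempty) {r : ℝ}
    (hr : 0 ≤ r) : (√(volume.real A) + √π * r) ^ 2 ≤ volume.real (A + disc r) := by
  have := brunn_minkowski_plane hA (isCompact_disc r) hA0 ⟨0, zero_mem_disc r⟩
  rwa [volume_disc hr, Real.sqrt_mul Real.pi_pos.le, Real.sqrt_sq hr] at this

end

section

/-- A closed nonempty subset of the plane, periodic with period `L` in both coordinates. -/
structure PerClosed (L : ℝ) (E : Set (ℝ × ℝ)) : Prop where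
  closed : IsClosed E
  fst : ∀ p : ℝ × ℝ, p + (L, 0) ∈ E ↔ p ∈ E
  snd : ∀ p : ℝ × ℝ, p + (0, L) ∈ E ↔ p ∈ E

/-- The period cell with lower left corner `(a, b)`. -/
def cell (L a b : ℝ) : Set (ℝ × ℝ) := Set.Ico a (a + L) ×ˢ Set.Ico b (b + L)

/-- The measure of a periodic set in one period cell. -/
def perVol (L : ℝ) (E : Set (ℝ × ℝ)) : ℝ := volume.real (E ∩ cell L 0 0)

theorem measurableSet_cell (L a b : ℝ) : MeasurableSet (cell L a b) :=
  measurableSet_Ico.prod measurableSet_Ico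

theorem volume_cell {L : ℝ} (hL : 0 < L) (a b : ℝ) : volume (cell L a b) = ENNReal.ofReal (L ^ 2) := by
  rw [cell, Measure.volume_eq_prod, Measure.prod_prod]
  simp [← ENNReal.ofReal_mul hL.le, sq]

theorem measure_inter_cell_ne_top {L : ℝ} (hL : 0 < L) (E : Set (ℝ × ℝ)) (a b : ℝ) :
    volume (E ∩ cell L a b) ≠ ⊤ := by
  refine ne_top_of_le_ne_top ?_ (measure_mono Set.inter_subset_right)
  simp [volume_cell hL]

open Set in
theorem perVol_eq {L : ℝ} (hL : 0 < L) {E : Set (ℝ × ℝ)} (h1 : ∀ p : ℝ × ℝ, p + (L, 0) ∈ E ↔ p ∈ E)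
    (h2 : ∀ p : ℝ × ℝ, p + (0, L) ∈ E ↔ p ∈ E) (a b : ℝ) :
    perVol L E = volume.real (E ∩ cell L a b) := by
  have e : ∀ a b : ℝ, cell L a b = Prod.fst ⁻¹' Ico a (a + L) ∩ Prod.snd ⁻¹' Ico b (b + L) := by
    intro a b
    ext p; simp [cell]
  rw [perVol, measureReal_def, measureReal_def, e, e]
  congr 1
  rw [inter_comm (Prod.fst ⁻¹' _), ← inter_assoc, measure_inter_period volume (L, (0:ℝ))
    measurable_fst hL (by simp) (fun n s => by simp) (by
      intro p; simpa using fun _ _ => h1 p) 0 a]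
  rw [inter_assoc, inter_comm (Prod.snd ⁻¹' _), ← inter_assoc, measure_inter_period volume
    ((0:ℝ), L) measurable_snd hL (by simp) (fun n s => by simp) (by
      intro p; simpa using fun _ _ => h2 p) 0 b,
    inter_assoc]

open Pointwise Set

namespace PerClosed

variable {L : ℝ} {E : Set (ℝ × ℝ)}

theorem add_disc (h : PerClosed L E) (r : ℝ) : PerClosed L (E + disc r) where
  closed := h.closed.add_right_of_isCompact (isCompact_disc r)
  fst := by
    intro p
    constructor
    · rintro ⟨a, ha, b, hb, hab⟩
      refine ⟨a - (L, 0), ?_, b, hb, ?_⟩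
      · rw [← h.fst]; simpa using ha
      · simp only at hab ⊢
        rw [sub_add_eq_add_sub, hab]; simp
    · rintro ⟨a, ha, b, hb, rfl⟩
      refine ⟨a + (L, 0), (h.fst a).2 ha, b, hb, ?_⟩
      simp only
      abel
  snd := by
    intro p
    constructor
    · rintro ⟨a, ha, b, hb, hab⟩
      refine ⟨a - (0, L), ?_, b, hb, ?_⟩
      · rw [← h.snd]; simpa using ha
      · simp only at hab ⊢
        rw [sub_add_eq_add_sub, hab]; simp
    · rintro ⟨a, ha, b, hb, rfl⟩
      refine ⟨a + (0, L), (h.snd a).2 ha, b, hb, ?_⟩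
      simp only
      abel

theorem vol_eq (hL : 0 < L) (h : PerClosed L E) (a b : ℝ) :
    perVol L E = volume.real (E ∩ cell L a b) := perVol_eq hL h.fst h.snd a b

theorem exists_mem_cell (hL : 0 < L) (h : PerClosed L E) (hne : E.Nonempty) (a b : ℝ) :
    (E ∩ cell L a b).Nonempty := by
  obtain ⟨p, hp⟩ := hne
  obtain ⟨n, hn, -⟩ := existsUnique_add_zsmul_mem_Ico hL p.1 a
  obtain ⟨m, hm, -⟩ := existsUnique_add_zsmul_mem_Ico hL p.2 b
  refine ⟨p + n • (L, 0) + m • (0, L), ?_, ?_⟩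
  · rwa [add_zsmul_mem_iff h.snd, add_zsmul_mem_iff h.fst]
  · exact ⟨by simpa using hn, by simpa using hm⟩

theorem preimage_swap (h : PerClosed L E) : PerClosed L (Prod.swap ⁻¹' E) where
  closed := h.closed.preimage continuous_swap
  fst := fun p => by simpa using h.snd p.swap
  snd := fun p => by simpa using h.fst p.swap

end PerClosed

theorem perVol_mono {L : ℝ} (hL : 0 < L) {E F : Set (ℝ × ℝ)} (h : E ⊆ F) :
    perVol L E ≤ perVol L F :=
  measureReal_mono (inter_subset_inter_left _ h) (measure_inter_cell_ne_top hL _ _ _)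

theorem perVol_swap (L : ℝ) (E : Set (ℝ × ℝ)) : perVol L (Prod.swap ⁻¹' E) = perVol L E := by
  have h := (Measure.measurePreserving_swap (μ := (volume : Measure ℝ)) (ν := (volume : Measure ℝ)))
  have e : Prod.swap ⁻¹' E ∩ cell L 0 0 = MeasurableEquiv.prodComm ⁻¹' (E ∩ cell L 0 0) := by
    ext p
    simp [cell, MeasurableEquiv.prodComm, and_comm]
  rw [perVol, perVol, e, measureReal_def, measureReal_def]
  congr 1
  exact (show MeasurePreserving (MeasurableEquiv.prodComm : ℝ × ℝ ≃ᵐ ℝ × ℝ) volume volume from h).measure_preimage_equiv _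

theorem swap_add_disc (E : Set (ℝ × ℝ)) (r : ℝ) :
    Prod.swap ⁻¹' E + disc r = Prod.swap ⁻¹' (E + disc r) := by
  ext p
  constructor
  · rintro ⟨a, ha, b, hb, rfl⟩
    refine ⟨a.swap, ha, b.swap, ?_, by simp⟩
    simp only [disc, mem_ofPred_eq, Prod.fst_swap, Prod.snd_swap] at *
    linarith
  · rintro ⟨a, ha, b, hb, hab⟩
    refine ⟨a.swap, by simpa using ha, b.swap, ?_, ?_⟩
    · simp only [disc, mem_ofPred_eq, Prod.fst_swap, Prod.snd_swap] at *
      linarith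
    · apply Prod.swap_injective
      simpa using hab

/-- If `E` misses a vertical and a horizontal line, the planar inequality applies in a cell. -/
theorem perVol_add_disc_of_miss {L : ℝ} (hL : 0 < L) {E : Set (ℝ × ℝ)} (h : PerClosed L E)
    (hne : E.Nonempty) {a b : ℝ} (ha : ∀ y, (a, y) ∉ E) (hb : ∀ x, (x, b) ∉ E) :
    ∃ η > 0, ∀ t ∈ Icc 0 η, (√(perVol L E) + √π * t) ^ 2 ≤ perVol L (E + disc t) := by
  have hK : IsCompact (E ∩ Icc a (a + L) ×ˢ Icc b (b + L)) :=
    (isCompact_Icc.prod isCompact_Icc).inter_left h.closed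
  have ha' : ∀ y, (a + L, y) ∉ E := fun y hy => ha y ((h.fst _).1 (by simpa using hy))
  have hb' : ∀ x, (x, b + L) ∉ E := fun x hx => hb x ((h.snd _).1 (by simpa using hx))
  have hsub : E ∩ Icc a (a + L) ×ˢ Icc b (b + L) ⊆ Ioo a (a + L) ×ˢ Ioo b (b + L) := by
    rintro ⟨x, y⟩ ⟨hE, ⟨h1, h2⟩, h3, h4⟩
    refine ⟨⟨lt_of_le_of_ne h1 ?_, lt_of_le_of_ne h2 ?_⟩, ⟨lt_of_le_of_ne h3 ?_, lt_of_le_of_ne h4 ?_⟩⟩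
    · rintro rfl; exact ha _ hE
    · rintro rfl; exact ha' _ hE
    · rintro rfl; exact hb _ hE
    · rintro rfl; exact hb' _ hE
  have hcell : E ∩ cell L a b ⊆ E ∩ Icc a (a + L) ×ˢ Icc b (b + L) :=
    inter_subset_inter_right _ (prod_mono Ico_subset_Icc_self Ico_subset_Icc_self)
  have hcell2 : E ∩ Icc a (a + L) ×ˢ Icc b (b + L) = E ∩ cell L a b := by
    refine subset_antisymm (fun p hp => ⟨hp.1, ?_⟩) hcell
    exact prod_mono Ioo_subset_Ico_self Ioo_subset_Ico_self (hsub hp)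
  obtain ⟨δ, hδ, hδ2⟩ := hK.exists_cthickening_subset_open (isOpen_Ioo.prod isOpen_Ioo) hsub
  refine ⟨δ, hδ, fun t ht => ?_⟩
  have h5 := le_volume_add_disc hK ((h.exists_mem_cell hL hne a b).mono hcell) ht.1
  rw [hcell2, ← h.vol_eq hL] at h5
  refine h5.trans ?_
  rw [(h.add_disc t).vol_eq hL a b]
  refine measureReal_mono ?_ (measure_inter_cell_ne_top hL _ _ _)
  rintro _ ⟨p, hp, d, hd, rfl⟩
  refine ⟨⟨p, hp.1, d, hd, rfl⟩, ?_⟩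
  refine prod_mono Ioo_subset_Ico_self Ioo_subset_Ico_self
    (hδ2 (Metric.mem_cthickening_of_dist_le _ p _ _ (by rwa [hcell2]) ?_))
  have h6 : |d.1| ≤ t := abs_le_of_sq_le_sq (by
    simp only [disc, mem_ofPred_eq] at hd; nlinarith) ht.1
  have h7 : |d.2| ≤ t := abs_le_of_sq_le_sq (by
    simp only [disc, mem_ofPred_eq] at hd; nlinarith) ht.1
  simp only [dist_self_add_left, Prod.norm_def, Real.norm_eq_abs]
  exact (max_le h6 h7).trans ht.2

theorem exists_mul_eq_of_between {x u m : ℝ} (h : (x ≤ m ∧ m ≤ x + u) ∨ (x + u ≤ m ∧ m ≤ x)) :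
    ∃ τ ∈ Icc (0 : ℝ) 1, x + τ * u = m := by
  by_cases hu : u = 0
  · exact ⟨0, by simp, by subst hu; rcases h with h | h <;> linarith [h.1, h.2]⟩
  refine ⟨(m - x) / u, ?_, by field_simp; ring⟩
  rcases lt_or_gt_of_ne hu with hu | hu
  · rw [mem_Icc, div_nonneg_iff, div_le_one_of_neg hu]
    rcases h with h | h
    · linarith [h.1, h.2]
    · exact ⟨Or.inr ⟨by linarith, hu.le⟩, by linarith⟩
  · rw [mem_Icc, div_nonneg_iff, div_le_one hu]
    rcases h with h | h
    · exact ⟨Or.inl ⟨by linarith, hu.le⟩, by linarith⟩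
    · linarith [h.1, h.2]

/-- If `E` contains a vertical and a horizontal line, apply the planar inequality to the
complement. -/
theorem perVol_add_disc_of_contains {L : ℝ} (hL : 0 < L) {E : Set (ℝ × ℝ)} (h : PerClosed L E)
    {a b : ℝ} (ha : ∀ y, (a, y) ∈ E) (hb : ∀ x, (x, b) ∈ E) {t : ℝ} (ht : 0 ≤ t) :
    L ^ 2 ≤ perVol L (E + disc t) ∨
    (√(L ^ 2 - perVol L (E + disc t)) + √π * t) ^ 2 ≤ L ^ 2 - perVol L E := by
  have ha' : ∀ y, (a + L, y) ∈ E := fun y => by simpa using (h.fst (a, y)).2 (ha y)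
  have hb' : ∀ x, (x, b + L) ∈ E := fun x => by simpa using (h.snd (x, b)).2 (hb x)
  have hcompl : ∀ {F : Set (ℝ × ℝ)}, PerClosed L F →
      volume.real (cell L a b \ F) = L ^ 2 - perVol L F := by
    intro F hF
    have h1 := measureReal_sdiff_add_inter (μ := volume) (s := cell L a b) hF.closed.measurableSet
      (by simp [volume_cell hL])
    rw [hF.vol_eq hL a b, inter_comm]
    have h2 : volume.real (cell L a b) = L ^ 2 := by
      rw [measureReal_def, volume_cell hL, ENNReal.toReal_ofReal (by positivity)]
    linarith
  rw [← hcompl h, ← hcompl (h.add_disc t)]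
  by_cases hW : volume.real (cell L a b \ (E + disc t)) ≤ 0
  · left
    rw [hcompl (h.add_disc t)] at hW
    linarith
  right
  push Not at hW
  set W := cell L a b \ (E + disc t)
  have hWm : MeasurableSet W := (measurableSet_cell L a b).diff (h.add_disc t).closed.measurableSet
  have key : ∀ x : ℝ, 0 ≤ x → x < volume.real W → (√x + √π * t) ^ 2 ≤ volume.real (cell L a b \ E) := by
    intro x hx0 hx
    obtain ⟨C, hCW, hC, hxC⟩ := hWm.exists_lt_isCompact (μ := volume) (r := ENNReal.ofReal x)
      ((ENNReal.ofReal_lt_iff_lt_toReal hx0 (by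
        refine ne_top_of_le_ne_top ?_ (measure_mono sdiff_subset)
        simp [volume_cell hL])).2 hx)
    have hCne : C.Nonempty := by
      by_contra hn
      rw [not_nonempty_iff_eq_empty] at hn
      simp [hn] at hxC
    have hxC2 : x ≤ volume.real C :=
      ((ENNReal.ofReal_lt_iff_lt_toReal hx0 hC.measure_ne_top).1 hxC).le
    have h1 := le_volume_add_disc hC hCne ht
    calc (√x + √π * t) ^ 2 ≤ (√(volume.real C) + √π * t) ^ 2 := by gcongr
      _ ≤ _ := h1
      _ ≤ _ := by
        refine measureReal_mono ?_ (by
          refine ne_top_of_le_ne_top ?_ (measure_mono sdiff_subset)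
          simp [volume_cell hL])
        rintro _ ⟨c, hc, d, hd, rfl⟩
        have hcE := (hCW hc).2
        obtain ⟨⟨c1, c2⟩, c3, c4⟩ := (hCW hc).1
        have hscale : ∀ τ ∈ Icc (0:ℝ) 1, c + τ • d ∉ E := by
          intro τ hτ hmem
          apply hcE
          refine ⟨_, hmem, -(τ • d), ?_, by simp⟩
          simp only [disc, mem_ofPred_eq] at hd ⊢
          simp only [Prod.fst_neg, Prod.smul_fst, Prod.snd_neg, Prod.smul_snd, smul_eq_mul]
          have : τ ^ 2 ≤ 1 := by nlinarith [hτ.1, hτ.2]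
          nlinarith [sq_nonneg d.1, sq_nonneg d.2]
        have noV : ∀ m, (∀ y, (m, y) ∈ E) →
            ¬ ((c.1 ≤ m ∧ m ≤ c.1 + d.1) ∨ (c.1 + d.1 ≤ m ∧ m ≤ c.1)) := by
          intro m hm hcon
          obtain ⟨τ, hτ, e⟩ := exists_mul_eq_of_between hcon
          refine hscale τ hτ ?_
          have e2 : c + τ • d = (m, c.2 + τ * d.2) := by ext <;> simp [e]
          rw [e2]; exact hm _
        have noH : ∀ m, (∀ x, (x, m) ∈ E) →
            ¬ ((c.2 ≤ m ∧ m ≤ c.2 + d.2) ∨ (c.2 + d.2 ≤ m ∧ m ≤ c.2)) := by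
          intro m hm hcon
          obtain ⟨τ, hτ, e⟩ := exists_mul_eq_of_between hcon
          refine hscale τ hτ ?_
          have e2 : c + τ • d = (c.1 + τ * d.1, m) := by ext <;> simp [e]
          rw [e2]; exact hm _
        refine ⟨⟨⟨?_, ?_⟩, ?_, ?_⟩, ?_⟩
        · by_contra hn
          exact noV a ha (Or.inr ⟨by simpa using (not_le.1 hn).le, c1⟩)
        · by_contra hn
          exact noV (a + L) ha' (Or.inl ⟨c2.le, by simpa using hn⟩)
        · by_contra hn
          exact noH b hb (Or.inr ⟨by simpa using (not_le.1 hn).le, c3⟩)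
        · by_contra hn
          exact noH (b + L) hb' (Or.inl ⟨c4.le, by simpa using hn⟩)
        · simpa using hscale 1 (by simp)
  have hcont : Continuous fun x : ℝ => (√x + √π * t) ^ 2 := by fun_prop
  refine le_of_tendsto (x := nhdsWithin (volume.real W) (Iio (volume.real W)))
    ((hcont.tendsto (volume.real W)).mono_left nhdsWithin_le_nhds) ?_
  filter_upwards [Ico_mem_nhdsLT hW] with x hx
  exact key x hx.1 hx.2

theorem perVol_eq_lintegral {L : ℝ} {E : Set (ℝ × ℝ)} (hE : IsClosed E) :
    volume (E ∩ cell L 0 0) = ∫⁻ y in Ico 0 (0 + L), volume ({x | (x, y) ∈ E} ∩ Ico 0 (0 + L)) := by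
  rw [Measure.volume_eq_prod, Measure.prod_apply_symm (hE.measurableSet.inter (measurableSet_cell _ _ _)),
    ← lintegral_indicator measurableSet_Ico]
  refine lintegral_congr fun y => ?_
  by_cases hy : y ∈ Ico 0 (0 + L)
  · rw [indicator_of_mem hy]
    congr 1
    ext x
    simp only [cell, mem_preimage, mem_inter_iff, mem_prod, hy, mem_ofPred_eq, and_true]
  · rw [indicator_of_notMem hy]
    convert measure_empty (μ := volume)
    ext x
    simp only [cell, mem_preimage, mem_inter_iff, mem_prod, hy, and_false, mem_empty_iff_false]

/-- If `E` meets all horizontal lines and contains none, there is a linear gain. -/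
theorem perVol_add_disc_of_meets {L : ℝ} (hL : 0 < L) {E : Set (ℝ × ℝ)} (h : PerClosed L E)
    (h1 : ∀ y, ∃ x, (x, y) ∈ E) (h2 : ∀ y, ∃ x, (x, y) ∉ E) :
    ∃ η > 0, ∀ t ∈ Icc 0 η, perVol L E + 2 * t * L ≤ perVol L (E + disc t) := by
  have hne : E.Nonempty := by obtain ⟨x, hx⟩ := h1 0; exact ⟨_, hx⟩
  have hunif : ∃ δ > 0, ∀ y ∈ Icc 0 L, ∃ x, δ ≤ Metric.infDist (x, y) E := by
    refine isCompact_Icc.induction_on (p := fun s => ∃ δ > 0, ∀ y ∈ s, ∃ x, δ ≤ Metric.infDist (x, y) E)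
      ⟨1, one_pos, by simp⟩ ?_ ?_ ?_
    · rintro s t hst ⟨δ, hδ, hh⟩
      exact ⟨δ, hδ, fun y hy => hh y (hst hy)⟩
    · rintro s t ⟨δ, hδ, hh⟩ ⟨δ', hδ', hh'⟩
      refine ⟨min δ δ', lt_min hδ hδ', ?_⟩
      rintro y (hy | hy)
      · obtain ⟨x, hx⟩ := hh y hy; exact ⟨x, (min_le_left _ _).trans hx⟩
      · obtain ⟨x, hx⟩ := hh' y hy; exact ⟨x, (min_le_right _ _).trans hx⟩
    · intro y _
      obtain ⟨x, hx⟩ := h2 y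
      have hpos := (h.closed.notMem_iff_infDist_pos hne).1 hx
      have hc : Continuous fun y => Metric.infDist (x, y) E :=
        (Metric.continuous_infDist_pt E).comp (by fun_prop)
      have hev := (hc.tendsto y).eventually (lt_mem_nhds (half_lt_self hpos))
      exact ⟨_, mem_nhdsWithin_of_mem_nhds hev, _, half_pos hpos, fun z hz => ⟨x, hz.le⟩⟩
  obtain ⟨δ, hδ, hh⟩ := hunif
  refine ⟨δ / 2, half_pos hδ, fun t ht => ?_⟩
  have key : ∀ y ∈ Ico 0 (0 + L), volume ({x | (x, y) ∈ E} ∩ Ico 0 (0 + L)) + ENNReal.ofReal (2 * t)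
      ≤ volume ({x | (x, y) ∈ E + disc t} ∩ Ico 0 (0 + L)) := by
    intro y hy
    obtain ⟨c, hc⟩ := hh y ⟨hy.1, by linarith [hy.2]⟩
    have hfar : ∀ x, (x, y) ∈ E → δ ≤ |c - x| := by
      intro x hx
      have := Metric.infDist_le_dist_of_mem (x := (c, y)) hx
      rw [Prod.dist_eq, dist_self, Real.dist_eq, max_eq_left (abs_nonneg _)] at this
      linarith
    have per : ∀ {F : Set (ℝ × ℝ)}, PerClosed L F → ∀ x, x + L ∈ {x | (x, y) ∈ F} ↔ x ∈ {x | (x, y) ∈ F} := by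
      intro F hF x
      have := hF.fst (x, y)
      simpa using this
    have shift : ∀ {F : Set (ℝ × ℝ)}, PerClosed L F → volume ({x | (x, y) ∈ F} ∩ Ico 0 (0 + L))
        = volume ({x | (x, y) ∈ F} ∩ Ico c (c + L)) := by
      intro F hF
      exact measure_inter_period volume L measurable_id hL (fun x => rfl) (fun n s => by simp)
        (per hF) 0 c
    rw [shift h, shift (h.add_disc t)]
    have hcl : IsClosed {x | (x, y) ∈ E} := h.closed.preimage (f := fun x : ℝ => (x, y)) (by fun_prop)
    have hS : IsCompact ({x | (x, y) ∈ E} ∩ Icc c (c + L)) := isCompact_Icc.inter_left hcl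
    have hin : ∀ x ∈ {x | (x, y) ∈ E} ∩ Icc c (c + L), c + δ ≤ x ∧ x ≤ c + L - δ := by
      rintro x ⟨hx, hx1, hx2⟩
      have f1 := hfar x hx
      have f2 := hfar (x - L) (by
        have := (h.fst (x - L, y)).1 (by simpa using hx)
        exact this)
      rw [abs_of_nonpos (by linarith)] at f1
      rw [abs_of_nonneg (by linarith)] at f2
      exact ⟨by linarith, by linarith⟩
    have hSne : ({x | (x, y) ∈ E} ∩ Icc c (c + L)).Nonempty := by
      obtain ⟨x, hx⟩ := h1 y
      obtain ⟨n, hn, -⟩ := existsUnique_add_zsmul_mem_Ico hL x c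
      exact ⟨x + n • L, (add_zsmul_mem_iff (per h) n x).2 hx, Ico_subset_Icc_self hn⟩
    have hbm := volume_add_le_volume_add hS (isCompact_Icc (a := -t) (b := t)) hSne
      ⟨0, by simpa using ht.1⟩
    rw [Real.volume_Icc, show t - -t = 2 * t by ring] at hbm
    refine (add_le_add_left (measure_mono (inter_subset_inter_right _ Ico_subset_Icc_self)) _).trans
      (hbm.trans (measure_mono ?_))
    rintro _ ⟨x, hx, d, hd, rfl⟩
    have := hin x hx
    refine ⟨⟨(x, y), hx.1, (d, 0), ?_, by simp⟩, ?_, ?_⟩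
    · simp only [disc, mem_ofPred_eq]
      nlinarith [hd.1, hd.2]
    · simp only; linarith [hd.1, ht.2]
    · simp only; linarith [hd.2, ht.2]
  have h_int : volume (E ∩ cell L 0 0) + ENNReal.ofReal (2 * t * L) ≤ volume ((E + disc t) ∩ cell L 0 0) := by
    rw [perVol_eq_lintegral h.closed, perVol_eq_lintegral (h.add_disc t).closed]
    have e : ENNReal.ofReal (2 * t * L) = ∫⁻ y in Ico 0 (0 + L), ENNReal.ofReal (2 * t) := by
      rw [setLIntegral_const, Real.volume_Ico, zero_add, sub_zero,
        ← ENNReal.ofReal_mul (by linarith [ht.1])]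
    rw [e, ← lintegral_add_right _ measurable_const]
    exact setLIntegral_mono' measurableSet_Ico key
  have hf := measure_inter_cell_ne_top hL E 0 0
  have hf2 := measure_inter_cell_ne_top hL (E + disc t) 0 0
  rw [← ENNReal.toReal_le_toReal (by simp [hf]) hf2, ENNReal.toReal_add hf (by simp),
    ENNReal.toReal_ofReal (mul_nonneg (by linarith [ht.1]) hL.le)] at h_int
  exact h_int

theorem sin_half_le {θ t : ℝ} (hθ : θ ≤ π) (ht : 0 ≤ t) :
    sin (min (θ + t) π / 2) ≤ sin (θ / 2) + t / 2 := by
  have h1 : |sin (min (θ + t) π / 2) - sin (θ / 2)| ≤ |min (θ + t) π / 2 - θ / 2| :=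
    Real.abs_sin_sub_sin_le _ _
  have h2 : |min (θ + t) π / 2 - θ / 2| ≤ t / 2 := by
    rw [abs_of_nonneg (by linarith [le_min (show θ ≤ θ + t by linarith) hθ])]
    linarith [min_le_left (θ + t) π]
  linarith [le_abs_self (sin (min (θ + t) π / 2) - sin (θ / 2))]

theorem exists_perVol_add_disc {L : ℝ} (hL : 0 < L) (hLpi : L ^ 2 = 4 * π) {E : Set (ℝ × ℝ)}
    (h : PerClosed L E) (hne : E.Nonempty) {θ : ℝ} (hθ0 : 0 ≤ θ) (hθ : θ ≤ π)
    (hE : 2 * π * (1 - cos θ) ≤ perVol L E) :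
    ∃ η > 0, ∀ t ∈ Icc 0 η, 2 * π * (1 - cos (min (θ + t) π)) ≤ perVol L (E + disc t) := by
  have hpi := Real.pi_pos
  have hcos : ∀ x : ℝ, 2 * π * (1 - cos x) = (2 * √π * sin (x / 2)) ^ 2 := by
    intro x
    rw [mul_pow, mul_pow, Real.sq_sqrt hpi.le, Real.sin_sq_eq_half_sub]
    ring_nf
  have hcos' : ∀ x : ℝ, L ^ 2 - 2 * π * (1 - cos x) = (2 * √π * cos (x / 2)) ^ 2 := by
    intro x
    rw [mul_pow, mul_pow, Real.sq_sqrt hpi.le, Real.cos_sq, hLpi]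
    ring_nf
  have hm : ∀ t, 0 ≤ t → 0 ≤ min (θ + t) π ∧ min (θ + t) π ≤ π ∧ θ ≤ min (θ + t) π ∧ min (θ + t) π ≤ θ + t :=
    fun t ht => ⟨le_min (by linarith) hpi.le, min_le_right _ _, le_min (by linarith) hθ, min_le_left _ _⟩
  have meets : ∀ {E : Set (ℝ × ℝ)}, PerClosed L E → 2 * π * (1 - cos θ) ≤ perVol L E →
      (∀ y, ∃ x, (x, y) ∈ E) → (∀ y, ∃ x, (x, y) ∉ E) →
      ∃ η > 0, ∀ t ∈ Icc 0 η, 2 * π * (1 - cos (min (θ + t) π)) ≤ perVol L (E + disc t) := by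
    intro E h hE h1 h2
    obtain ⟨η, hη, hh⟩ := perVol_add_disc_of_meets hL h h1 h2
    refine ⟨η, hη, fun t ht => le_trans ?_ (hh t ht)⟩
    obtain ⟨m1, m2, m3, m4⟩ := hm t ht.1
    have h3 : cos θ - cos (min (θ + t) π) ≤ t := by
      refine (le_abs_self _).trans ((Real.abs_cos_sub_cos_le _ _).trans ?_)
      rw [abs_sub_comm, abs_of_nonneg (by linarith)]
      linarith
    have h4 : π ≤ L := by nlinarith [Real.pi_le_four]
    have h5 : 2 * π * (cos θ - cos (min (θ + t) π)) ≤ 2 * π * t := by gcongr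
    nlinarith [ht.1, mul_le_mul_of_nonneg_left h4 ht.1]
  have contains : ∀ a b, (∀ y, (a, y) ∈ E) → (∀ x, (x, b) ∈ E) →
      ∃ η > 0, ∀ t ∈ Icc 0 η, 2 * π * (1 - cos (min (θ + t) π)) ≤ perVol L (E + disc t) := by
    intro a b ha hb
    refine ⟨1, one_pos, fun t ht => ?_⟩
    obtain ⟨m1, m2, m3, m4⟩ := hm t ht.1
    have hc0 : 0 ≤ cos (min (θ + t) π / 2) := cos_nonneg_of_mem_Icc ⟨by linarith, by linarith⟩
    have hsub := hcos' (min (θ + t) π)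
    rcases perVol_add_disc_of_contains hL h ha hb ht.1 with h1 | h1
    · have := sq_nonneg (2 * √π * cos (min (θ + t) π / 2))
      linarith
    · have h2 : (√(L ^ 2 - perVol L (E + disc t)) + √π * t) ^ 2 ≤ (2 * √π * cos (θ / 2)) ^ 2 := by
        rw [← hcos']; linarith
      have hc1 : 0 ≤ cos (θ / 2) := cos_nonneg_of_mem_Icc ⟨by linarith, by linarith⟩
      have h3 := (abs_le_of_sq_le_sq' h2 (by positivity)).2
      have h4 : cos (θ / 2) - cos (min (θ + t) π / 2) ≤ t / 2 := by
        refine (le_abs_self _).trans ((Real.abs_cos_sub_cos_le _ _).trans ?_)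
        rw [abs_sub_comm, abs_of_nonneg (by linarith)]
        linarith
      have h5 : √(L ^ 2 - perVol L (E + disc t)) ≤ 2 * √π * cos (min (θ + t) π / 2) := by
        nlinarith [Real.sqrt_pos.2 hpi]
      by_contra hcon
      push Not at hcon
      have h6 : 0 ≤ L ^ 2 - perVol L (E + disc t) := by
        have := sq_nonneg (2 * √π * cos (min (θ + t) π / 2))
        linarith
      have h7 : L ^ 2 - perVol L (E + disc t) ≤ (2 * √π * cos (min (θ + t) π / 2)) ^ 2 := by
        rw [← Real.sq_sqrt h6]
        gcongr
      linarith
  have miss : ∀ a b, (∀ y, (a, y) ∉ E) → (∀ x, (x, b) ∉ E) →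
      ∃ η > 0, ∀ t ∈ Icc 0 η, 2 * π * (1 - cos (min (θ + t) π)) ≤ perVol L (E + disc t) := by
    intro a b ha hb
    obtain ⟨η, hη, hh⟩ := perVol_add_disc_of_miss hL h hne ha hb
    refine ⟨η, hη, fun t ht => le_trans ?_ (hh t ht)⟩
    obtain ⟨m1, m2, m3, m4⟩ := hm t ht.1
    rw [hcos]
    have hs0 : 0 ≤ sin (min (θ + t) π / 2) := sin_nonneg_of_nonneg_of_le_pi (by linarith) (by linarith)
    have hs1 : 0 ≤ sin (θ / 2) := sin_nonneg_of_nonneg_of_le_pi (by linarith) (by linarith)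
    have h2 : 2 * √π * sin (θ / 2) ≤ √(perVol L E) := by
      apply Real.le_sqrt_of_sq_le
      rw [← hcos]; exact hE
    have h3 := sin_half_le hθ ht.1
    have h4 : 2 * √π * sin (min (θ + t) π / 2) ≤ 2 * √π * (sin (θ / 2) + t / 2) := by gcongr
    have : 2 * √π * sin (min (θ + t) π / 2) ≤ √(perVol L E) + √π * t := by nlinarith
    gcongr
  by_cases mV : ∀ x, ∃ y, (x, y) ∈ E
  · by_cases mH : ∀ y, ∃ x, (x, y) ∈ E
    · by_cases cH : ∀ y, ∃ x, (x, y) ∉ E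
      · exact meets h hE mH cH
      by_cases cV : ∀ x, ∃ y, (x, y) ∉ E
      · obtain ⟨η, hη, hh⟩ := meets h.preimage_swap (by rwa [perVol_swap]) mV cV
        refine ⟨η, hη, fun t ht => ?_⟩
        have := hh t ht
        rwa [swap_add_disc, perVol_swap] at this
      push Not at cH cV
      obtain ⟨b, hb⟩ := cH
      obtain ⟨a, ha⟩ := cV
      exact contains a b ha hb
    · push Not at mH
      obtain ⟨b, hb⟩ := mH
      obtain ⟨η, hη, hh⟩ := meets h.preimage_swap (by rwa [perVol_swap]) mV (fun x => ⟨b, hb x⟩)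
      refine ⟨η, hη, fun t ht => ?_⟩
      have := hh t ht
      rwa [swap_add_disc, perVol_swap] at this
  · push Not at mV
    obtain ⟨a, ha⟩ := mV
    by_cases mH : ∀ y, ∃ x, (x, y) ∈ E
    · exact meets h hE mH fun y => ⟨a, ha y⟩
    · push Not at mH
      obtain ⟨b, hb⟩ := mH
      exact miss a b ha hb

/-- The isoperimetric inequality in the flat torus of area `4π` compared with the unit sphere. -/
theorem perVol_add_disc {L : ℝ} (hL : 0 < L) (hLpi : L ^ 2 = 4 * π) {E : Set (ℝ × ℝ)}
    (h : PerClosed L E) (hne : E.Nonempty) {θ : ℝ} (hθ0 : 0 ≤ θ) (hθ : θ ≤ π)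
    (hE : 2 * π * (1 - cos θ) ≤ perVol L E) {r : ℝ} (hr : 0 ≤ r) :
    2 * π * (1 - cos (min (θ + r) π)) ≤ perVol L (E + disc r) := by
  set T : ℝ → ℝ := fun s => 2 * π * (1 - cos (min (θ + s) π)) with hT
  have hTc : Continuous T := by fun_prop
  set F : ℝ → ℝ := fun s => perVol L (E + disc s)
  have hFm : ∀ s t, 0 ≤ s → s ≤ t → F s ≤ F t := fun s t hs hst =>
    perVol_mono hL (add_subset_add_left (disc_mono hs hst))
  set S := {s | 0 ≤ s ∧ s ≤ r ∧ T s ≤ F s}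
  have h0 : (0:ℝ) ∈ S := by
    refine ⟨le_rfl, hr, ?_⟩
    have : T 0 ≤ perVol L E := by simpa [hT, hθ] using hE
    refine this.trans (perVol_mono hL fun p hp => ?_)
    exact ⟨p, hp, 0, zero_mem_disc 0, add_zero p⟩
  have hbdd : BddAbove S := ⟨r, fun s hs => hs.2.1⟩
  set σ := sSup S
  have hσ0 : 0 ≤ σ := le_csSup hbdd h0
  have hσr : σ ≤ r := csSup_le ⟨0, h0⟩ fun s hs => hs.2.1
  have hσ : T σ ≤ F σ := by
    obtain ⟨u, hu1, hu2⟩ := exists_seq_tendsto_sSup ⟨0, h0⟩ hbdd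
    refine le_of_tendsto ((hTc.tendsto σ).comp hu2.1) (Filter.Eventually.of_forall fun n => ?_)
    exact (hu2.2 n).2.2.trans (hFm _ _ (hu2.2 n).1 (le_csSup hbdd (hu2.2 n)))
  by_cases hlt : σ < r
  · exfalso
    obtain ⟨η, hη, hη2⟩ := exists_perVol_add_disc hL hLpi (h.add_disc σ)
      (hne.add ⟨0, zero_mem_disc σ⟩) (θ := min (θ + σ) π) (by positivity) (min_le_right _ _) hσ
    set t := min η (r - σ)
    have ht : 0 < t := lt_min hη (by linarith)
    have ht2 := hη2 t ⟨ht.le, min_le_left _ _⟩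
    have hmem : σ + t ∈ S := by
      refine ⟨by linarith, by have := min_le_right η (r - σ); linarith, ?_⟩
      have e : min (min (θ + σ) π + t) π = min (θ + (σ + t)) π := by
        rw [← min_add_add_right, min_assoc, min_eq_right (show π ≤ π + t by linarith), add_assoc]
      rw [e] at ht2
      refine ht2.trans (perVol_mono hL ?_)
      rw [add_assoc]
      exact add_subset_add_left (disc_add_subset hσ0 ht.le)
    have := le_csSup hbdd hmem
    linarith
  · have : σ = r := le_antisymm hσr (not_lt.1 hlt)
    rw [this] at hσ
    exact hσ

end

section

open Set

/-- A closed subset of `ℝ² × ℝ²`, bounded in the first factor, doubly periodic in the second. -/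
structure PerBody (L : ℝ) (K : Set ((ℝ × ℝ) × (ℝ × ℝ))) : Prop where
  closed : IsClosed K
  fst : ∀ x p : ℝ × ℝ, (x, p + (L, 0)) ∈ K ↔ (x, p) ∈ K
  snd : ∀ x p : ℝ × ℝ, (x, p + (0, L)) ∈ K ↔ (x, p) ∈ K
  bdd : ∃ R : ℝ, 0 ≤ R ∧ ∀ q ∈ K, q.1 ∈ disc R

/-- The Euclidean `ε`-neighbourhood in `ℝ² × ℝ²`. -/
def bodyNhd (ε : ℝ) (K : Set ((ℝ × ℝ) × (ℝ × ℝ))) : Set ((ℝ × ℝ) × (ℝ × ℝ)) :=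
  {q | ∃ q' ∈ K, (q.1.1 - q'.1.1) ^ 2 + (q.1.2 - q'.1.2) ^ 2 +
    ((q.2.1 - q'.2.1) ^ 2 + (q.2.2 - q'.2.2) ^ 2) ≤ ε ^ 2}

/-- The points over which the slice has at least the area of a spherical cap of radius `θ`. -/
def capBase (L : ℝ) (K : Set ((ℝ × ℝ) × (ℝ × ℝ))) (θ : ℝ) : Set (ℝ × ℝ) :=
  {x | 2 * π * (1 - cos θ) ≤ perVol L (Prod.mk x ⁻¹' K)}

/-- The volume of a periodic body in one period cell. -/
def bodyVol (L : ℝ) (K : Set ((ℝ × ℝ) × (ℝ × ℝ))) : ℝ≥0∞ :=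
  volume (K ∩ Prod.snd ⁻¹' cell L 0 0)

namespace PerBody

variable {L : ℝ} {K : Set ((ℝ × ℝ) × (ℝ × ℝ))}

theorem slice (h : PerBody L K) (x : ℝ × ℝ) : PerClosed L (Prod.mk x ⁻¹' K) where
  closed := h.closed.preimage (by fun_prop)
  fst := h.fst x
  snd := h.snd x

theorem bodyNhd (h : PerBody L K) {ε : ℝ} (hε : 0 ≤ ε) : PerBody L (bodyNhd ε K) where
  closed := by
    have hB : IsCompact ({q | q.1.1 ^ 2 + q.1.2 ^ 2 + (q.2.1 ^ 2 + q.2.2 ^ 2) ≤ ε ^ 2} :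
        Set ((ℝ × ℝ) × (ℝ × ℝ))) := by
      refine ((isCompact_disc ε).prod (isCompact_disc ε)).of_isClosed_subset
        (isClosed_le (by fun_prop) (by fun_prop)) ?_
      rintro q hq
      simp only [mem_ofPred_eq] at hq
      refine ⟨?_, ?_⟩ <;> simp only [disc, mem_ofPred_eq] <;> nlinarith
    convert h.closed.add_right_of_isCompact hB using 1
    ext q
    simp only [_root_.bodyNhd, mem_ofPred_eq, mem_add]
    constructor
    · rintro ⟨q', hq', hle⟩
      exact ⟨q', hq', q - q', by simpa using hle, by simp⟩
    · rintro ⟨q', hq', d, hd, rfl⟩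
      exact ⟨q', hq', by simpa using hd⟩
  fst := by
    intro x p
    constructor
    · rintro ⟨⟨x', p'⟩, hq, hle⟩
      refine ⟨(x', p' - (L, 0)), by rw [← h.fst]; simpa using hq, ?_⟩
      simp only [Prod.fst_add, Prod.snd_add, Prod.fst_sub, Prod.snd_sub] at hle ⊢
      convert hle using 3 <;> ring
    · rintro ⟨⟨x', p'⟩, hq, hle⟩
      exact ⟨(x', p' + (L, 0)), (h.fst _ _).2 hq, by simpa using hle⟩
  snd := by
    intro x p
    constructor
    · rintro ⟨⟨x', p'⟩, hq, hle⟩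
      refine ⟨(x', p' - (0, L)), by rw [← h.snd]; simpa using hq, ?_⟩
      simp only [Prod.fst_add, Prod.snd_add, Prod.fst_sub, Prod.snd_sub] at hle ⊢
      convert hle using 3 <;> ring
    · rintro ⟨⟨x', p'⟩, hq, hle⟩
      exact ⟨(x', p' + (0, L)), (h.snd _ _).2 hq, by simpa using hle⟩
  bdd := by
    obtain ⟨R, hR0, hR⟩ := h.bdd
    refine ⟨R + ε, by linarith, ?_⟩
    rintro q ⟨q', hq', hle⟩
    have := disc_add_subset hR0 hε (add_mem_add (hR q' hq') (show q.1 - q'.1 ∈ disc ε by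
      simp only [disc, mem_ofPred_eq, Prod.fst_sub, Prod.snd_sub]
      nlinarith [sq_nonneg (q.2.1 - q'.2.1), sq_nonneg (q.2.2 - q'.2.2)]))
    simpa using this

theorem perVol_le (_ : PerBody L K) (hL : 0 < L) (hLpi : L ^ 2 = 4 * π) (x : ℝ × ℝ) :
    perVol L (Prod.mk x ⁻¹' K) ≤ 4 * π := by
  rw [← hLpi, perVol]
  refine (measureReal_mono inter_subset_right (by simp [volume_cell hL])).trans ?_
  rw [measureReal_def, volume_cell hL, ENNReal.toReal_ofReal (by positivity)]

theorem measurable_perVol (h : PerBody L K) :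
    Measurable fun x => volume ((Prod.mk x ⁻¹' K) ∩ cell L 0 0) :=
  measurable_measure_prodMk_left
    (h.closed.measurableSet.inter (measurable_snd (measurableSet_cell L 0 0)))

theorem bodyVol_eq_lintegral (h : PerBody L K) (hL : 0 < L) :
    bodyVol L K = ∫⁻ x, ENNReal.ofReal (perVol L (Prod.mk x ⁻¹' K)) := by
  rw [bodyVol, Measure.volume_eq_prod, Measure.prod_apply
    (h.closed.measurableSet.inter (measurable_snd (measurableSet_cell L 0 0)))]
  refine lintegral_congr fun x => ?_
  rw [perVol, measureReal_def, ENNReal.ofReal_toReal (measure_inter_cell_ne_top hL _ _ _)]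
  rfl

theorem ne_bot_of_mem_capBase (_ : PerBody L K) {θ : ℝ} (hθ : θ ∈ Ioo 0 π) {x : ℝ × ℝ}
    (hx : x ∈ capBase L K θ) : (Prod.mk x ⁻¹' K).Nonempty := by
  by_contra hn
  rw [not_nonempty_iff_eq_empty] at hn
  simp only [capBase, mem_ofPred_eq, hn, perVol, empty_inter, measureReal_empty] at hx
  have : cos θ < 1 := by
    rw [← cos_zero]
    exact cos_lt_cos_of_nonneg_of_le_pi le_rfl hθ.2.le hθ.1
  nlinarith [Real.pi_pos]

theorem capBase_subset (h : PerBody L K) {R : ℝ} (hR : ∀ q ∈ K, q.1 ∈ disc R) {θ : ℝ}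
    (hθ : θ ∈ Ioo 0 π) : capBase L K θ ⊆ disc R := by
  intro x hx
  obtain ⟨p, hp⟩ := h.ne_bot_of_mem_capBase hθ hx
  exact hR _ hp

theorem isCompact_capBase (h : PerBody L K) (hL : 0 < L) {θ : ℝ} (hθ : θ ∈ Ioo 0 π) :
    IsCompact (capBase L K θ) := by
  obtain ⟨R, hR0, hR⟩ := h.bdd
  refine (isCompact_disc R).of_isClosed_subset ?_ (h.capBase_subset hR hθ)
  have hK : IsCompact (K ∩ disc R ×ˢ (Icc 0 L ×ˢ Icc 0 L)) :=
    ((isCompact_disc R).prod (isCompact_Icc.prod isCompact_Icc)).inter_left h.closed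
  convert isClosed_setOf_le_measure_slice volume hK (ENNReal.ofReal (2 * π * (1 - cos θ))) using 1
  ext x
  have e : volume (Prod.mk x ⁻¹' (K ∩ disc R ×ˢ (Icc 0 L ×ˢ Icc 0 L)))
      = volume ((Prod.mk x ⁻¹' K) ∩ cell L 0 0) := by
    have e1 : Prod.mk x ⁻¹' (K ∩ disc R ×ˢ (Icc 0 L ×ˢ Icc 0 L))
      = (Prod.mk x ⁻¹' K) ∩ (Icc 0 L ×ˢ Icc 0 L) := by
      ext p
      simp only [mem_preimage, mem_inter_iff, mem_prod]
      exact ⟨fun hh => ⟨hh.1, hh.2.2⟩, fun hh => ⟨hh.1, hR _ hh.1, hh.2⟩⟩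
    rw [e1]
    refine measure_congr (Filter.EventuallyEq.inter (Filter.EventuallyEq.refl _ _) ?_)
    rw [cell, zero_add, Measure.volume_eq_prod]
    exact Measure.set_prod_ae_eq Ico_ae_eq_Icc.symm Ico_ae_eq_Icc.symm
  simp only [capBase, mem_ofPred_eq]
  rw [e, ENNReal.ofReal_le_iff_le_toReal (measure_inter_cell_ne_top hL _ _ _)]
  rfl

end PerBody

open Pointwise in
/-- Product symmetrization does not increase neighbourhoods. -/
theorem le_volume_capBase_bodyNhd {L : ℝ} (hL : 0 < L) (hLpi : L ^ 2 = 4 * π)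
    {K : Set ((ℝ × ℝ) × (ℝ × ℝ))} (h : PerBody L K) {θ θ' ρ ρ' d₁ d₂ ε : ℝ} (hε : 0 ≤ ε)
    (hθ : θ ∈ Ioo 0 π) (hθ' : θ' ∈ Ioo 0 π) (hρ0 : 0 ≤ ρ) (hρ' : 0 < ρ') (hd₁ : 0 ≤ d₁) (hd₂ : 0 ≤ d₂)
    (h1 : θ ≤ θ' + d₁) (h2 : ρ ≤ ρ' + d₂) (hd : d₁ ^ 2 + d₂ ^ 2 ≤ ε ^ 2)
    (hN : π * ρ' ^ 2 ≤ volume.real (capBase L K θ')) :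
    π * ρ ^ 2 ≤ volume.real (capBase L (bodyNhd ε K) θ) := by
  have hpi := Real.pi_pos
  have hne : (capBase L K θ').Nonempty := by
    by_contra hn
    rw [not_nonempty_iff_eq_empty] at hn
    rw [hn, measureReal_empty] at hN
    have : 0 < π * ρ' ^ 2 := by positivity
    linarith
  have hbm := le_volume_add_disc (h.isCompact_capBase hL hθ') hne hd₂
  have hsub : capBase L K θ' + disc d₂ ⊆ capBase L (bodyNhd ε K) θ := by
    rintro _ ⟨x, hx, z, hz, rfl⟩
    have h3 := perVol_add_disc hL hLpi (h.slice x) (h.ne_bot_of_mem_capBase hθ' hx) hθ'.1.le hθ'.2.le hx hd₁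
    have h4 : cos (min (θ' + d₁) π) ≤ cos θ :=
      cos_le_cos_of_nonneg_of_le_pi hθ.1.le (min_le_right _ _) (le_min h1 hθ.2.le)
    have h5 : 2 * π * (1 - cos θ) ≤ 2 * π * (1 - cos (min (θ' + d₁) π)) := by gcongr
    refine h5.trans (h3.trans (perVol_mono hL ?_))
    rintro _ ⟨p, hp, d, hd, rfl⟩
    refine ⟨(x, p), hp, ?_⟩
    simp only [disc, mem_ofPred_eq] at hz hd
    simp only [Prod.fst_add, Prod.snd_add, add_sub_cancel_left]
    linarith
  have h6 := measureReal_mono hsub (((h.bodyNhd hε).isCompact_capBase hL hθ).measure_ne_top (μ := volume))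
  refine le_trans ?_ (hbm.trans h6)
  have h7 : √π * ρ' ≤ √(volume.real (capBase L K θ')) := by
    apply Real.le_sqrt_of_sq_le
    rwa [mul_pow, Real.sq_sqrt hpi.le]
  have h8 : √π * ρ ≤ √(volume.real (capBase L K θ')) + √π * d₂ := by
    have : √π * ρ ≤ √π * (ρ' + d₂) := by gcongr
    linarith
  calc π * ρ ^ 2 = (√π * ρ) ^ 2 := by rw [mul_pow, Real.sq_sqrt hpi.le]
    _ ≤ _ := by gcongr

end

section

open Set

/-- The sine function, extended by zero outside `[0, π]`. -/
def clampSin (θ : ℝ) : ℝ := sin (max 0 (min θ π))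

/-- The density of the volume of `S² × ℝ²` in polar coordinates. -/
def polarWeight (θ ρ : ℝ) : ℝ := 4 * π ^ 2 * clampSin θ * max ρ 0

theorem continuous_clampSin : Continuous clampSin := by unfold clampSin; fun_prop

theorem clampSin_nonneg (θ : ℝ) : 0 ≤ clampSin θ :=
  sin_nonneg_of_nonneg_of_le_pi (le_max_left _ _) (max_le Real.pi_pos.le (min_le_right _ _))

theorem clampSin_of_mem {θ : ℝ} (h : θ ∈ Icc 0 π) : clampSin θ = sin θ := by
  rw [clampSin, min_eq_left h.2, max_eq_right h.1]

theorem clampSin_of_notMem {θ : ℝ} (h : θ ∉ Ioo 0 π) : clampSin θ = 0 := by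
  rcases le_or_gt θ 0 with h0 | h0
  · rw [clampSin, max_eq_left ((min_le_left _ _).trans h0), sin_zero]
  · have : π ≤ θ := by
      by_contra hn
      exact h ⟨h0, not_le.1 hn⟩
    rw [clampSin, min_eq_right this, max_eq_right Real.pi_pos.le, sin_pi]

theorem polarWeight_nonneg (θ ρ : ℝ) : 0 ≤ polarWeight θ ρ := by
  have := clampSin_nonneg θ
  unfold polarWeight; positivity

theorem continuous_polarWeight : Continuous fun q : ℝ × ℝ => polarWeight q.1 q.2 := by
  unfold polarWeight
  have := continuous_clampSin
  fun_prop

theorem lintegral_cap {m : ℝ} (h0 : 0 ≤ m) (h1 : m ≤ 4 * π) :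
    ∫⁻ θ in Ioo 0 π ∩ {θ | 2 * π * (1 - cos θ) ≤ m}, ENNReal.ofReal (2 * π * sin θ)
      = ENNReal.ofReal m := by
  have hpi := Real.pi_pos
  set α := arccos (1 - m / (2 * π))
  have hα0 : 0 ≤ α := arccos_nonneg _
  have hαpi : α ≤ π := arccos_le_pi _
  have hm : m / (2 * π) ≤ 2 := by rw [div_le_iff₀ (by positivity)]; linarith
  have hcos : cos α = 1 - m / (2 * π) := cos_arccos (by linarith) (by
    have : 0 ≤ m / (2 * π) := by positivity
    linarith)
  have hset : Ioo 0 π ∩ {θ | 2 * π * (1 - cos θ) ≤ m} = Ioo 0 π ∩ Iic α := by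
    ext θ
    simp only [mem_inter_iff, mem_ofPred_eq, mem_Iic, and_congr_right_iff]
    intro hθ
    rw [← strictAntiOn_cos.le_iff_ge ⟨hα0, hαpi⟩ ⟨hθ.1.le, hθ.2.le⟩, hcos, sub_le_iff_le_add,
      ← sub_le_iff_le_add', le_div_iff₀' (by positivity)]
  have hae : (Ioo 0 π ∩ Iic α : Set ℝ) =ᵐ[volume] Ioc 0 α := by
    have : Ioc 0 α = Ioc 0 π ∩ Iic α := by
      ext θ; simp only [mem_Ioc, mem_inter_iff, mem_Iic]
      exact ⟨fun h => ⟨⟨h.1, h.2.trans hαpi⟩, h.2⟩, fun h => ⟨h.1.1, h.2⟩⟩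
    rw [this]
    exact Ioo_ae_eq_Ioc.inter (Filter.EventuallyEq.refl _ _)
  rw [hset, setLIntegral_congr hae, ← ofReal_integral_eq_lintegral_ofReal,
    ← intervalIntegral.integral_of_le hα0, intervalIntegral.integral_const_mul, integral_sin, hcos]
  · congr 1; rw [cos_zero]; field_simp; ring
  · exact ((continuous_const.mul continuous_sin).integrableOn_Icc).mono_set Ioc_subset_Icc_self
  · refine (ae_restrict_iff' measurableSet_Ioc).2 (Filter.Eventually.of_forall fun θ hθ => ?_)
    have := sin_nonneg_of_nonneg_of_le_pi hθ.1.le (hθ.2.trans hαpi)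
    simp only [Pi.zero_apply]
    positivity

theorem lintegral_ball {N : ℝ} (h0 : 0 ≤ N) :
    ∫⁻ ρ in Ioi 0 ∩ {ρ | π * ρ ^ 2 ≤ N}, ENNReal.ofReal (2 * π * ρ) = ENNReal.ofReal N := by
  have hpi := Real.pi_pos
  have hset : Ioi 0 ∩ {ρ | π * ρ ^ 2 ≤ N} = Ioc 0 (√(N / π)) := by
    ext ρ
    simp only [mem_inter_iff, mem_ofPred_eq, mem_Ioi, mem_Ioc, and_congr_right_iff]
    intro hρ
    rw [Real.le_sqrt hρ.le (by positivity), le_div_iff₀' hpi]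
  rw [hset, ← ofReal_integral_eq_lintegral_ofReal,
    ← intervalIntegral.integral_of_le (Real.sqrt_nonneg _), intervalIntegral.integral_const_mul,
    integral_id, Real.sq_sqrt (by positivity)]
  · congr 1; field_simp; ring
  · exact ((continuous_const.mul continuous_id).integrableOn_Icc).mono_set Ioc_subset_Icc_self
  · refine (ae_restrict_iff' measurableSet_Ioc).2 (Filter.Eventually.of_forall fun θ hθ => ?_)
    have := hθ.1
    simp only [Pi.zero_apply]
    positivity

/-- The polar domain of the symmetrization of `K`. -/
def polarDom (L : ℝ) (K : Set ((ℝ × ℝ) × (ℝ × ℝ))) : Set (ℝ × ℝ) :=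
  {q | q.1 ∈ Ioo 0 π ∧ 0 < q.2 ∧ π * q.2 ^ 2 ≤ volume.real (capBase L K q.1)}

namespace PerBody

variable {L : ℝ} {K : Set ((ℝ × ℝ) × (ℝ × ℝ))}

theorem measurable_perVol_real (h : PerBody L K) :
    Measurable fun x => perVol L (Prod.mk x ⁻¹' K) := h.measurable_perVol.ennreal_toReal

theorem bodyVol_eq_lintegral_capBase (h : PerBody L K) (hL : 0 < L) (hLpi : L ^ 2 = 4 * π) :
    bodyVol L K = ∫⁻ θ in Ioo 0 π, ENNReal.ofReal (2 * π * sin θ) * volume (capBase L K θ) := by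
  rw [h.bodyVol_eq_lintegral hL]
  have hm := h.measurable_perVol_real
  have hS : ∀ x, MeasurableSet {θ | 2 * π * (1 - cos θ) ≤ perVol L (Prod.mk x ⁻¹' K)} := fun x =>
    measurableSet_le (by fun_prop) measurable_const
  have h1 : ∀ x, ENNReal.ofReal (perVol L (Prod.mk x ⁻¹' K)) = ∫⁻ θ in Ioo 0 π,
      {q : (ℝ × ℝ) × ℝ | 2 * π * (1 - cos q.2) ≤ perVol L (Prod.mk q.1 ⁻¹' K)}.indicator
        (fun q => ENNReal.ofReal (2 * π * sin q.2)) (x, θ) := by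
    intro x
    rw [← lintegral_cap (show 0 ≤ perVol L (Prod.mk x ⁻¹' K) from measureReal_nonneg)
      (h.perVol_le hL hLpi x), inter_comm,
      ← Measure.restrict_restrict (hS x), ← lintegral_indicator (hS x)]
    rfl
  simp_rw [h1]
  rw [lintegral_lintegral_swap]
  · refine lintegral_congr fun θ => ?_
    have : MeasurableSet (capBase L K θ) := measurableSet_le measurable_const hm
    rw [← setLIntegral_const, ← lintegral_indicator this]
    rfl
  · refine Measurable.aemeasurable ?_
    refine Measurable.indicator (by fun_prop) ?_
    exact measurableSet_le (by fun_prop) (hm.comp measurable_fst)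

theorem measurable_volume_capBase (h : PerBody L K) :
    Measurable fun θ => volume (capBase L K θ) := by
  have : MeasurableSet {q : ℝ × (ℝ × ℝ) | 2 * π * (1 - cos q.1) ≤ perVol L (Prod.mk q.2 ⁻¹' K)} :=
    measurableSet_le (by fun_prop) (h.measurable_perVol_real.comp measurable_snd)
  exact measurable_measure_prodMk_left this

theorem measurableSet_polarDom (h : PerBody L K) : MeasurableSet (polarDom L K) := by
  have := h.measurable_volume_capBase.ennreal_toReal
  refine (measurable_fst measurableSet_Ioo).inter ((measurableSet_lt measurable_const measurable_snd).inter
    (measurableSet_le (by fun_prop) (this.comp measurable_fst)))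

theorem bodyVol_eq_setLIntegral (h : PerBody L K) (hL : 0 < L) (hLpi : L ^ 2 = 4 * π) :
    bodyVol L K = ∫⁻ q in polarDom L K, ENNReal.ofReal (polarWeight q.1 q.2) := by
  have hpi := Real.pi_pos
  have hR : ∫⁻ q in polarDom L K, ENNReal.ofReal (polarWeight q.1 q.2) = ∫⁻ θ : ℝ, ∫⁻ ρ : ℝ,
      (polarDom L K).indicator (fun q => ENNReal.ofReal (polarWeight q.1 q.2)) (θ, ρ) := by
    rw [← lintegral_indicator h.measurableSet_polarDom]
    exact lintegral_prod _ ((Measurable.indicator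
      continuous_polarWeight.measurable.ennreal_ofReal h.measurableSet_polarDom).aemeasurable)
  rw [h.bodyVol_eq_lintegral_capBase hL hLpi, hR, ← lintegral_indicator measurableSet_Ioo]
  refine lintegral_congr fun θ => ?_
  by_cases hθ : θ ∈ Ioo 0 π
  · rw [indicator_of_mem hθ]
    have hS : MeasurableSet (Ioi 0 ∩ {ρ | π * ρ ^ 2 ≤ volume.real (capBase L K θ)}) :=
      measurableSet_Ioi.inter (measurableSet_le (by fun_prop) measurable_const)
    have e := lintegral_ball (N := volume.real (capBase L K θ)) measureReal_nonneg
    rw [measureReal_def, ENNReal.ofReal_toReal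
      ((h.isCompact_capBase hL hθ).measure_ne_top (μ := volume)), ← measureReal_def] at e
    rw [← e, ← lintegral_const_mul' _ _ ENNReal.ofReal_ne_top, ← lintegral_indicator hS]
    refine lintegral_congr fun ρ => ?_
    have hmem : (θ, ρ) ∈ polarDom L K ↔ ρ ∈ Ioi 0 ∩ {ρ | π * ρ ^ 2 ≤ volume.real (capBase L K θ)} := by
      simp [polarDom, hθ.1, hθ.2]
    by_cases hρ : ρ ∈ Ioi 0 ∩ {ρ | π * ρ ^ 2 ≤ volume.real (capBase L K θ)}
    · rw [indicator_of_mem hρ, indicator_of_mem (hmem.2 hρ), polarWeight,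
        clampSin_of_mem ⟨hθ.1.le, hθ.2.le⟩, max_eq_left (show 0 ≤ ρ from hρ.1.le),
        ← ENNReal.ofReal_mul (by have := sin_pos_of_mem_Ioo hθ; positivity)]
      ring_nf
    · rw [indicator_of_notMem hρ, indicator_of_notMem (fun hh => hρ (hmem.1 hh))]
  · rw [indicator_of_notMem hθ]
    have : ∀ ρ, (polarDom L K).indicator (fun q => ENNReal.ofReal (polarWeight q.1 q.2)) (θ, ρ) = 0 :=
      fun ρ => indicator_of_notMem (fun hh => hθ hh.1) _
    simp [this]

theorem polarDom_bodyNhd (h : PerBody L K) (hL : 0 < L) (hLpi : L ^ 2 = 4 * π) {ε : ℝ} (hε : 0 ≤ ε)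
    {q q₀ q₁ : ℝ × ℝ} (h0 : q₀ ∈ polarDom L K) (h1 : q₁.1 ≤ q₀.1) (h2 : q₁.2 ≤ q₀.2)
    (hq : q.1 ∈ Ioo 0 π) (hq2 : 0 < q.2) (hd : (q.1 - q₁.1) ^ 2 + (q.2 - q₁.2) ^ 2 ≤ ε ^ 2) :
    q ∈ polarDom L (_root_.bodyNhd ε K) := by
  refine ⟨hq, hq2, ?_⟩
  refine le_volume_capBase_bodyNhd hL hLpi h hε hq h0.1 hq2.le h0.2.1 (d₁ := max (q.1 - q₀.1) 0)
    (d₂ := max (q.2 - q₀.2) 0) (le_max_right _ _) (le_max_right _ _) ?_ ?_ ?_ h0.2.2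
  · linarith [le_max_left (q.1 - q₀.1) 0]
  · linarith [le_max_left (q.2 - q₀.2) 0]
  · have aux : ∀ a b : ℝ, a ≤ b → (max a 0) ^ 2 ≤ b ^ 2 := by
      intro a b hab
      rcases le_total a 0 with ha | ha
      · rw [max_eq_right ha]; nlinarith [sq_nonneg b]
      · rw [max_eq_left ha]; gcongr
    linarith [aux (q.1 - q₀.1) (q.1 - q₁.1) (by linarith), aux (q.2 - q₀.2) (q.2 - q₁.2) (by linarith)]

theorem snd_le_of_mem_polarDom (h : PerBody L K) {R : ℝ} (hR0 : 0 ≤ R)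
    (hR : ∀ q ∈ K, q.1 ∈ disc R) {q : ℝ × ℝ} (hq : q ∈ polarDom L K) : q.2 ≤ R := by
  have h1 := hq.2.2.trans (measureReal_mono (h.capBase_subset hR hq.1)
    ((isCompact_disc R).measure_ne_top (μ := volume)))
  rw [volume_disc hR0] at h1
  exact abs_le_of_sq_le_sq' (le_of_mul_le_mul_left h1 Real.pi_pos) hR0 |>.2

theorem bodyVol_ne_top (h : PerBody L K) : bodyVol L K ≠ ⊤ := by
  obtain ⟨R, hR0, hR⟩ := h.bdd
  refine ne_top_of_le_ne_top ((isCompact_disc R).prod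
    ((isCompact_Icc (a := (0:ℝ)) (b := 0 + L)).prod (isCompact_Icc (a := (0:ℝ)) (b := 0 + L)))).measure_ne_top
    (measure_mono (μ := volume) ?_)
  rintro q ⟨hq, hc⟩
  exact ⟨hR q hq, prod_mono Ico_subset_Icc_self Ico_subset_Icc_self hc⟩

theorem bodyVol_le_add (_ : PerBody L K) (ε : ℝ) :
    bodyVol L (_root_.bodyNhd ε K) ≤ bodyVol L K + bodyVol L (_root_.bodyNhd ε K \ K) := by
  refine (measure_mono ?_).trans (measure_union_le _ _)
  rintro q ⟨hq, hc⟩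
  by_cases hk : q ∈ K
  · exact Or.inl ⟨hk, hc⟩
  · exact Or.inr ⟨⟨hq, hk⟩, hc⟩

end PerBody

end

section

open Set Filter Topology

/-- The upper boundary of the lower closure of a planar set `D`, in the coordinates
`s = θ - ρ`, `u = ρ`. -/
def profileFun (D : Set (ℝ × ℝ)) (s : ℝ) : ℝ := ⨆ q : D, min (q.1.1 - s) q.1.2

/-- The speed of the curve `s ↦ (U s + s, U s)`. -/
def curveSpeed (U : ℝ → ℝ) (s : ℝ) : ℝ := √(deriv U s ^ 2 + (1 + deriv U s) ^ 2)

section profileFun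

variable {D : Set (ℝ × ℝ)} {M R : ℝ}

theorem bddAbove_profileFun (hR : ∀ q ∈ D, q.2 ≤ R) (s : ℝ) :
    BddAbove (range fun q : D => min (q.1.1 - s) q.1.2) :=
  ⟨R, by rintro _ ⟨q, rfl⟩; exact (min_le_right _ _).trans (hR _ q.2)⟩

theorem min_le_profileFun (hR : ∀ q ∈ D, q.2 ≤ R) {q : ℝ × ℝ} (hq : q ∈ D) (s : ℝ) :
    min (q.1 - s) q.2 ≤ profileFun D s :=
  le_ciSup (bddAbove_profileFun hR s) ⟨q, hq⟩

theorem snd_le_profileFun (hR : ∀ q ∈ D, q.2 ≤ R) {q : ℝ × ℝ} (hq : q ∈ D) :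
    q.2 ≤ profileFun D (q.1 - q.2) := by
  simpa using min_le_profileFun hR hq (q.1 - q.2)

theorem exists_of_lt_profileFun (hne : D.Nonempty) {s u : ℝ} (hu : u < profileFun D s) :
    ∃ q ∈ D, u + s < q.1 ∧ u < q.2 := by
  have := hne.to_subtype
  obtain ⟨q, hq⟩ := exists_lt_of_lt_ciSup hu
  exact ⟨q.1, q.2, by linarith [hq.trans_le (min_le_left _ _)], hq.trans_le (min_le_right _ _)⟩

theorem profileFun_le (hne : D.Nonempty) (hR : ∀ q ∈ D, q.2 ≤ R) (s : ℝ) :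
    profileFun D s ≤ R := by
  have := hne.to_subtype
  exact ciSup_le fun q => (min_le_right _ _).trans (hR _ q.2)

theorem antitone_profileFun (hne : D.Nonempty) (hR : ∀ q ∈ D, q.2 ≤ R) :
    Antitone (profileFun D) := by
  intro s s' hs
  have := hne.to_subtype
  exact ciSup_le fun q => (min_le_min_right _ (by linarith)).trans (min_le_profileFun hR q.2 s)

theorem monotone_profileFun_add (hne : D.Nonempty) (hR : ∀ q ∈ D, q.2 ≤ R) :
    Monotone fun s => profileFun D s + s := by
  intro s s' hs
  have := hne.to_subtype
  have : profileFun D s ≤ profileFun D s' + (s' - s) := ciSup_le fun q => by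
    have := min_le_profileFun hR q.2 s'
    rcases min_cases (q.1.1 - s') q.1.2 with h | h
    · exact (min_le_left _ _).trans (by linarith)
    · exact (min_le_right _ _).trans (by linarith)
  simp only
  linarith

end profileFun

theorem lipschitzWith_of_antitone_of_monotone_add {U : ℝ → ℝ} (ha : Antitone U)
    (hm : Monotone fun s => U s + s) : LipschitzWith 1 U := by
  refine LipschitzWith.of_le_add_mul 1 fun x y => ?_
  rw [NNReal.coe_one, one_mul, Real.dist_eq]
  rcases le_total x y with h | h
  · have : U x + x ≤ U y + y := hm h
    linarith [neg_abs_le (x - y)]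
  · linarith [ha h, abs_nonneg (x - y)]

theorem HasDerivAt.eventually_exists_lt_graph {U : ℝ → ℝ} {s d t : ℝ} (hd : HasDerivAt U d s)
    (ht0 : 0 < t) (ht1 : t < 1) :
    ∀ᶠ ε in 𝓝[>] (0 : ℝ), ∀ k, 0 < k → k < t * √(d ^ 2 + (1 + d) ^ 2) * ε →
      ∃ s₀ u₀, u₀ < U s₀ ∧ ((s - s₀) + (U s + k - u₀)) ^ 2 + (U s + k - u₀) ^ 2 < ε ^ 2 := by
  set S := d ^ 2 + (1 + d) ^ 2 with hS
  have hS0 : 0 < S := by nlinarith [sq_nonneg (2 * d + 1)]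
  have hsq : √S ^ 2 = S := Real.sq_sqrt hS0.le
  have hs0 : 0 < √S := Real.sqrt_pos.2 hS0
  set a := (1 + 2 * d) / S with ha
  set η := min 1 ((1 - t ^ 2) / (2 + 2 * S)) with hη
  have ht2 : t ^ 2 < 1 := by nlinarith
  have hη0 : 0 < η := lt_min one_pos (div_pos (by linarith) (by positivity))
  have hη1 : η ≤ 1 := min_le_left _ _
  have hη2 : η * (2 + 2 * S) ≤ 1 - t ^ 2 := (le_div_iff₀ (by positivity)).1 (min_le_right _ _)
  have hc : 0 < η / (|a| + 1) := by positivity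
  have hlo := (hasDerivAt_iff_isLittleO.1 hd).bound hc
  obtain ⟨δ, hδ, hball⟩ := Metric.eventually_nhds_iff.1 hlo
  have hev : ∀ᶠ ε in 𝓝[>] (0 : ℝ), ε < δ / (√S * (|a| + 1)) :=
    nhdsWithin_le_nhds (Iio_mem_nhds (by positivity))
  filter_upwards [hev, self_mem_nhdsWithin] with ε hε hε0 k hk hkε
  have hε0 : 0 < ε := hε0
  have hkε' : k < √S * ε := by nlinarith [mul_pos hs0 hε0]
  rw [lt_div_iff₀ (by positivity)] at hε
  have hka : k * (|a| + 1) < δ := by nlinarith [abs_nonneg a]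
  have hx := hball (y := s + k * a) (by
    rw [Real.dist_eq, add_sub_cancel_left, abs_mul, abs_of_pos hk]; nlinarith [abs_nonneg a])
  rw [add_sub_cancel_left, Real.norm_eq_abs, Real.norm_eq_abs, abs_mul k, abs_of_pos hk,
    smul_eq_mul] at hx
  have hx2 : η / (|a| + 1) * (k * |a|) < η * k := by
    rw [div_mul_eq_mul_div, div_lt_iff₀ (by positivity)]
    nlinarith [mul_pos hη0 hk]
  refine ⟨s + k * a, U s + k * a * d - η * k, by linarith [(abs_le.1 hx).1], ?_⟩
  have e1 : 1 - a * d = (1 + d) / S := by rw [ha]; field_simp; rw [hS]; ring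
  have e2 : 1 - a - a * d = -d / S := by rw [ha]; field_simp; rw [hS]; ring
  have e3 : U s + k - (U s + k * a * d - η * k) = k * ((1 - a * d) + η) := by ring
  have e4 : s - (s + k * a) + k * ((1 - a * d) + η) = k * ((1 - a - a * d) + η) := by ring
  rw [e3, e4, e1, e2]
  have e5 : (k * (-d / S + η)) ^ 2 + (k * ((1 + d) / S + η)) ^ 2
      = k ^ 2 / S * (1 + 2 * η + 2 * η ^ 2 * S) := by
    field_simp; rw [hS]; ring
  rw [e5]
  have h6 : k ^ 2 / S < t ^ 2 * ε ^ 2 := by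
    rw [div_lt_iff₀ hS0]
    calc k ^ 2 < (t * √S * ε) ^ 2 := by gcongr
      _ = t ^ 2 * ε ^ 2 * S := by rw [mul_pow, mul_pow, hsq]; ring
  have h7 : 1 + 2 * η + 2 * η ^ 2 * S ≤ 2 - t ^ 2 := by nlinarith [mul_pos hη0 hS0]
  have h8 : 0 < 1 + 2 * η + 2 * η ^ 2 * S := by positivity
  calc k ^ 2 / S * (1 + 2 * η + 2 * η ^ 2 * S) < t ^ 2 * ε ^ 2 * (1 + 2 * η + 2 * η ^ 2 * S) := by
        gcongr
    _ ≤ t ^ 2 * ε ^ 2 * (2 - t ^ 2) := by gcongr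
    _ ≤ ε ^ 2 := by nlinarith [sq_nonneg (1 - t ^ 2), sq_nonneg ε, mul_nonneg (sq_nonneg (1 - t ^ 2)) (sq_nonneg ε)]

/-- The points above the graph of `U` at distance less than `ε` of the subgraph. -/
def collar (U : ℝ → ℝ) (ε : ℝ) : Set (ℝ × ℝ) :=
  {p | U p.1 < p.2 ∧ ∃ s₀ u₀, u₀ < U s₀ ∧ ((p.1 - s₀) + (p.2 - u₀)) ^ 2 + (p.2 - u₀) ^ 2 < ε ^ 2}

theorem measurableSet_collar {U : ℝ → ℝ} (hU : Continuous U) (ε : ℝ) :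
    MeasurableSet (collar U ε) := by
  have h1 : IsOpen {p : ℝ × ℝ | U p.1 < p.2} := isOpen_lt (by fun_prop) (by fun_prop)
  have : {p : ℝ × ℝ | ∃ s₀ u₀, u₀ < U s₀ ∧ ((p.1 - s₀) + (p.2 - u₀)) ^ 2 + (p.2 - u₀) ^ 2 < ε ^ 2} =
      ⋃ (s₀ : ℝ) (u₀ : ℝ) (_ : u₀ < U s₀),
        {p : ℝ × ℝ | ((p.1 - s₀) + (p.2 - u₀)) ^ 2 + (p.2 - u₀) ^ 2 < ε ^ 2} := by
    ext p; simp
  have h2 := isOpen_iUnion fun s₀ => isOpen_iUnion fun u₀ => isOpen_iUnion fun _ : u₀ < U s₀ =>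
    isOpen_lt (f := fun p : ℝ × ℝ => ((p.1 - s₀) + (p.2 - u₀)) ^ 2 + (p.2 - u₀) ^ 2)
      (by fun_prop) (continuous_const (y := ε ^ 2))
  rw [← this] at h2
  exact h1.measurableSet.inter h2.measurableSet

theorem ofReal_le_liminf_collar {U : ℝ → ℝ} {s : ℝ} (hd : DifferentiableAt ℝ U s)
    {w : ℝ × ℝ → ℝ} (hw : Continuous w) (hw0 : ∀ q, 0 ≤ w q) {ε : ℕ → ℝ}
    (hε : Tendsto ε atTop (𝓝[>] 0)) :
    ENNReal.ofReal (w (U s + s, U s) * curveSpeed U s) ≤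
      liminf (fun n => (∫⁻ u in Prod.mk s ⁻¹' collar U (ε n), ENNReal.ofReal (w (u + s, u))) /
        ENNReal.ofReal (ε n)) atTop := by
  have hsp0 : 0 < deriv U s ^ 2 + (1 + deriv U s) ^ 2 := by
    nlinarith [sq_nonneg (2 * deriv U s + 1)]
  have hsp : 0 < curveSpeed U s := Real.sqrt_pos.2 hsp0
  set W := w (U s + s, U s) with hW
  rcases (hw0 (U s + s, U s)).eq_or_lt with h0 | hpos
  · rw [hW, ← h0]; simp
  refine le_of_forall_lt fun c hc => ?_
  have hcr : c.toReal < W * curveSpeed U s := by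
    rw [← ENNReal.ofReal_lt_ofReal_iff (by positivity), ENNReal.ofReal_toReal hc.ne_top]; exact hc
  set r := c.toReal / (W * curveSpeed U s)
  have hr0 : 0 ≤ r := by positivity
  have hr1 : r < 1 := by rw [div_lt_one (by positivity)]; exact hcr
  have hrc : c.toReal = r * (W * curveSpeed U s) := by
    rw [div_mul_cancel₀ _ (by positivity)]
  set t := (1 + r) / 2
  have ht0 : 0 < t := by positivity
  have ht1 : t < 1 := by simp only [t]; linarith
  have htr : r < t ^ 2 := by simp only [t]; nlinarith
  have h1 := hd.hasDerivAt.eventually_exists_lt_graph ht0 ht1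
  have h2 : ∀ᶠ u in 𝓝 (U s), t * W < w (u + s, u) := by
    have : Continuous fun u => w (u + s, u) := by fun_prop
    exact this.continuousAt.eventually (Ioi_mem_nhds (by nlinarith))
  obtain ⟨δ, hδ, hball⟩ := Metric.eventually_nhds_iff.1 h2
  have h3 : ∀ᶠ x in 𝓝[>] (0 : ℝ), x < δ / curveSpeed U s :=
    nhdsWithin_le_nhds (Iio_mem_nhds (by positivity))
  have h4 := hε.eventually (h1.and (h3.and self_mem_nhdsWithin))
  have h5 : c < ENNReal.ofReal (t ^ 2 * (W * curveSpeed U s)) := by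
    rw [← ENNReal.ofReal_toReal hc.ne_top]
    refine (ENNReal.ofReal_lt_ofReal_iff (by positivity)).2 ?_
    rw [hrc]; gcongr
  refine h5.trans_le (le_liminf_of_le (by isBoundedDefault) ?_)
  filter_upwards [h4] with n ⟨hn1, hn2, hn3⟩
  have hn3 : 0 < ε n := hn3
  rw [lt_div_iff₀ hsp] at hn2
  rw [ENNReal.le_div_iff_mul_le (Or.inl (by simpa using hn3)) (Or.inl ENNReal.ofReal_ne_top)]
  set b := t * curveSpeed U s * ε n
  have hb : b < δ := by
    refine lt_of_le_of_lt ?_ hn2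
    simp only [b]; nlinarith [mul_pos hsp hn3]
  have hsub : Ioo (U s) (U s + b) ⊆ Prod.mk s ⁻¹' collar U (ε n) := by
    intro u hu
    obtain ⟨s₀, u₀, hu0, hh⟩ := hn1 (u - U s) (by linarith [hu.1]) (by
      have := hu.2; simp only [b, curveSpeed] at this; linarith)
    rw [add_sub_cancel] at hh
    exact ⟨hu.1, s₀, u₀, hu0, hh⟩
  calc ENNReal.ofReal (t ^ 2 * (W * curveSpeed U s)) * ENNReal.ofReal (ε n)
      = ENNReal.ofReal (t * W) * volume (Ioo (U s) (U s + b)) := by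
        rw [Real.volume_Ioo, ← ENNReal.ofReal_mul (by positivity),
          ← ENNReal.ofReal_mul (by positivity)]
        congr 1; simp only [b]; ring
    _ = ∫⁻ u in Ioo (U s) (U s + b), ENNReal.ofReal (t * W) := by rw [setLIntegral_const]
    _ ≤ ∫⁻ u in Ioo (U s) (U s + b), ENNReal.ofReal (w (u + s, u)) := by
        refine setLIntegral_mono' measurableSet_Ioo fun u hu => ENNReal.ofReal_le_ofReal ?_
        refine (hball ?_).le
        rw [Real.dist_eq, abs_of_pos (by linarith [hu.1])]
        linarith [hu.2]
    _ ≤ _ := lintegral_mono_set hsub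

theorem lintegral_curve_le_liminf_collar {U : ℝ → ℝ} (hU : LipschitzWith 1 U)
    {w : ℝ × ℝ → ℝ} (hw : Continuous w) (hw0 : ∀ q, 0 ≤ w q) {ε : ℕ → ℝ}
    (hε : Tendsto ε atTop (𝓝[>] 0)) :
    ∫⁻ s, ENNReal.ofReal (w (U s + s, U s) * curveSpeed U s) ≤
      liminf (fun n => (∫⁻ p in collar U (ε n), ENNReal.ofReal (w (p.2 + p.1, p.2))) /
        ENNReal.ofReal (ε n)) atTop := by
  have hm : ∀ n, Measurable ((collar U (ε n)).indicator
      fun p : ℝ × ℝ => ENNReal.ofReal (w (p.2 + p.1, p.2))) := fun n =>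
    Measurable.indicator (by fun_prop) (measurableSet_collar hU.continuous _)
  have key : ∀ n, (∫⁻ p in collar U (ε n), ENNReal.ofReal (w (p.2 + p.1, p.2))) /
      ENNReal.ofReal (ε n) = ∫⁻ s : ℝ, (∫⁻ u in Prod.mk s ⁻¹' collar U (ε n),
        ENNReal.ofReal (w (u + s, u))) / ENNReal.ofReal (ε n) := by
    intro n
    have h1 : ∀ s : ℝ, ∫⁻ u in Prod.mk s ⁻¹' collar U (ε n), ENNReal.ofReal (w (u + s, u)) =
        ∫⁻ u : ℝ, (collar U (ε n)).indicator
          (fun p : ℝ × ℝ => ENNReal.ofReal (w (p.2 + p.1, p.2))) (s, u) := fun s => by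
      rw [← lintegral_indicator (measurable_prodMk_left (measurableSet_collar hU.continuous _))]
      rfl
    simp_rw [h1, div_eq_mul_inv]
    rw [lintegral_mul_const _ (hm n).lintegral_prod_right',
      ← lintegral_indicator (measurableSet_collar hU.continuous _)]
    congr 1
    exact lintegral_prod _ (hm n).aemeasurable
  simp_rw [key]
  refine (lintegral_mono_ae ?_).trans (lintegral_liminf_le fun n => ?_)
  · filter_upwards [hU.ae_differentiableAt_real] with s hs
    exact ofReal_le_liminf_collar hs hw hw0 hε
  · have h1 : ∀ s : ℝ, ∫⁻ u in Prod.mk s ⁻¹' collar U (ε n), ENNReal.ofReal (w (u + s, u)) =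
        ∫⁻ u : ℝ, (collar U (ε n)).indicator
          (fun p : ℝ × ℝ => ENNReal.ofReal (w (p.2 + p.1, p.2))) (s, u) := fun s => by
      rw [← lintegral_indicator (measurable_prodMk_left (measurableSet_collar hU.continuous _))]
      rfl
    simp_rw [h1]
    exact (hm n).lintegral_prod_right'.div_const _

theorem measurePreserving_shear :
    MeasurePreserving (fun p : ℝ × ℝ => (p.2 + p.1, p.2)) volume volume := by
  have := measurePreserving_add_prod (volume : Measure ℝ) (volume : Measure ℝ)
  simp_rw [add_comm] at this ⊢
  exact this

namespace PerBody

variable {L : ℝ} {K : Set ((ℝ × ℝ) × (ℝ × ℝ))}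

theorem setLIntegral_collar_le (h : PerBody L K) (hL : 0 < L) (hLpi : L ^ 2 = 4 * π)
    (hne : (polarDom L K).Nonempty) {ε : ℝ} (hε : 0 < ε) :
    ∫⁻ p in collar (profileFun (polarDom L K)) ε, ENNReal.ofReal (polarWeight (p.2 + p.1) p.2) ≤
      bodyVol L (_root_.bodyNhd ε K \ K) := by
  obtain ⟨R, hR0, hR⟩ := h.bdd
  have hR' := fun q hq => h.snd_le_of_mem_polarDom hR0 hR (q := q) hq
  have hb := h.bodyNhd hε.le
  have hcont := (lipschitzWith_of_antitone_of_monotone_add (antitone_profileFun hne hR')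
    (monotone_profileFun_add hne hR')).continuous
  set U := profileFun (polarDom L K)
  set W : ℝ × ℝ → ℝ≥0∞ := fun q => ENNReal.ofReal (polarWeight q.1 q.2) with hWdef
  have hWm : Measurable W := continuous_polarWeight.measurable.ennreal_ofReal
  set D := polarDom L K
  set D' := polarDom L (_root_.bodyNhd ε K)
  have hDm : MeasurableSet D := h.measurableSet_polarDom
  have hDm' : MeasurableSet D' := hb.measurableSet_polarDom
  have hDD : D ⊆ D' := fun q hq => h.polarDom_bodyNhd hL hLpi hε.le hq le_rfl le_rfl hq.1 hq.2.1
    (by simp; positivity)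
  have hsplit : ∫⁻ q in D', W q = (∫⁻ q in D, W q) + ∫⁻ q in D' \ D, W q := by
    rw [← lintegral_inter_add_sdiff W D' hDm, inter_eq_right.2 hDD]
  have hpull : ∫⁻ p in collar U ε, W (p.2 + p.1, p.2) ≤ ∫⁻ q in D' \ D, W q := by
    rw [← lintegral_indicator (hDm'.diff hDm), ← lintegral_indicator (measurableSet_collar hcont ε),
      ← measurePreserving_shear.lintegral_comp (hWm.indicator (hDm'.diff hDm))]
    refine lintegral_mono fun p => ?_
    by_cases hp : p ∈ collar U ε
    · rw [indicator_of_mem hp]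
      by_cases hq : (p.2 + p.1, p.2) ∈ D' \ D
      · simp only [indicator_of_mem hq]; exact le_rfl
      · have hz : W (p.2 + p.1, p.2) = 0 := by
          by_contra hW0
          have h1 : p.2 + p.1 ∈ Ioo 0 π := by
            by_contra hh
            exact hW0 (by simp [hWdef, polarWeight, clampSin_of_notMem hh])
          have h2 : 0 < p.2 := by
            by_contra hh
            exact hW0 (by simp [hWdef, polarWeight, max_eq_right (not_lt.1 hh)])
          obtain ⟨hpU, s₀, u₀, hu, hd⟩ := hp
          obtain ⟨q₀, hq0, hq1, hq2⟩ := exists_of_lt_profileFun hne hu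
          refine hq ⟨h.polarDom_bodyNhd hL hLpi hε.le hq0 (q₁ := (u₀ + s₀, u₀)) hq1.le hq2.le h1 h2
            ?_, fun hmem => ?_⟩
          · refine le_trans (le_of_eq ?_) hd.le
            simp only; ring
          · have := snd_le_profileFun hR' hmem
            simp only [add_sub_cancel_left] at this
            exact absurd hpU (not_lt.2 this)
        rw [hz]; exact zero_le
    · rw [indicator_of_notMem hp]; exact zero_le
  refine hpull.trans ?_
  have h1 := h.bodyVol_le_add ε
  rw [hb.bodyVol_eq_setLIntegral hL hLpi, h.bodyVol_eq_setLIntegral hL hLpi] at h1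
  have hfin := h.bodyVol_ne_top
  rw [h.bodyVol_eq_setLIntegral hL hLpi] at hfin
  change ∫⁻ q in D', W q ≤ (∫⁻ q in D, W q) + _ at h1
  rw [hsplit] at h1
  exact (ENNReal.add_le_add_iff_left hfin).1 h1

/-- The weighted length of the profile curve is bounded by the lower Minkowski content. -/
theorem lintegral_profile_le (h : PerBody L K) (hL : 0 < L) (hLpi : L ^ 2 = 4 * π)
    (hne : (polarDom L K).Nonempty) {ε : ℕ → ℝ} (hε : Tendsto ε atTop (𝓝[>] 0)) :
    ∫⁻ s, ENNReal.ofReal (polarWeight (profileFun (polarDom L K) s + s)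
        (profileFun (polarDom L K) s) * curveSpeed (profileFun (polarDom L K)) s) ≤
      liminf (fun n => bodyVol L (_root_.bodyNhd (ε n) K \ K) / ENNReal.ofReal (ε n)) atTop := by
  obtain ⟨R, hR0, hR⟩ := h.bdd
  have hR' := fun q hq => h.snd_le_of_mem_polarDom hR0 hR (q := q) hq
  have hlip := lipschitzWith_of_antitone_of_monotone_add (antitone_profileFun hne hR')
    (monotone_profileFun_add hne hR')
  refine (lintegral_curve_le_liminf_collar hlip continuous_polarWeight
    (fun q => polarWeight_nonneg _ _) hε).trans (liminf_le_liminf ?_)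
  filter_upwards [hε.eventually self_mem_nhdsWithin] with n hn
  gcongr
  exact h.setLIntegral_collar_le hL hLpi hne hn

end PerBody

end

section

open Set Filter Topology

theorem haus_eq_hausdorffMeasure {X : Type*} [EMetricSpace X] [MeasurableSpace X] [BorelSpace X]
    (d : ℕ) (s : Set X) : haus X d s = μH[d] s := by
  unfold haus
  have := BorelSpace.measurable_eq (α := X)
  subst this
  rfl

/-- The normalizing constant of the Euclidean Hausdorff measure. -/
def hausFactor (d : ℕ) : ℝ≥0 :=
  Measure.addHaarScalarFactor (volume : Measure (EuclideanSpace ℝ (Fin d))) μH[d]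

theorem hausFactor_ne_zero (d : ℕ) : hausFactor d ≠ 0 :=
  Measure.addHaarScalarFactor_volume_hausdorffMeasure_ne_zero d

theorem euclideanHausdorffMeasure_eq_mul {X : Type*} [EMetricSpace X] [MeasurableSpace X]
    [BorelSpace X] (d : ℕ) (s : Set X) : μHE[d] s = hausFactor d * haus X d s := by
  rw [haus_eq_hausdorffMeasure, Measure.euclideanHausdorffMeasure_def]
  rfl

section Comparison

variable {ι X Y : Type*} [EMetricSpace X] [MeasurableSpace X] [BorelSpace X]
  [EMetricSpace Y] [MeasurableSpace Y] [BorelSpace Y]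

theorem LipschitzOnWith.euclideanHausdorffMeasure_image_le {K : ℝ≥0} {f : X → Y} {s : Set X}
    (h : LipschitzOnWith K f s) (d : ℕ) : μHE[d] (f '' s) ≤ (K : ℝ≥0∞) ^ d * μHE[d] s := by
  have := h.hausdorffMeasure_image_le (d := d) (by positivity)
  rw [euclideanHausdorffMeasure_eq_mul, euclideanHausdorffMeasure_eq_mul,
    haus_eq_hausdorffMeasure, haus_eq_hausdorffMeasure]
  rw [ENNReal.rpow_natCast] at this
  calc (hausFactor d : ℝ≥0∞) * μH[d] (f '' s) ≤ hausFactor d * (K ^ d * μH[d] s) := by gcongr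
    _ = _ := by ring

theorem euclideanHausdorffMeasure_image_le_of_edist_le {K : ℝ≥0} {f : ι → X} {g : ι → Y}
    {s : Set ι} (h : ∀ i ∈ s, ∀ j ∈ s, edist (f i) (f j) ≤ K * edist (g i) (g j)) (d : ℕ) :
    μHE[d] (f '' s) ≤ (K : ℝ≥0∞) ^ d * μHE[d] (g '' s) := by
  rcases s.eq_empty_or_nonempty with rfl | ⟨i₀, -⟩
  · simp
  have : Nonempty ι := ⟨i₀⟩
  have hF : LipschitzOnWith K (f ∘ Function.invFunOn g s) (g '' s) := by
    intro y hy z hz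
    have := h _ (Function.invFunOn_mem hy) _ (Function.invFunOn_mem hz)
    rwa [Function.invFunOn_eq hy, Function.invFunOn_eq hz] at this
  refine le_trans (measure_mono ?_) (hF.euclideanHausdorffMeasure_image_le d)
  rintro _ ⟨i, hi, rfl⟩
  have hy : g i ∈ g '' s := mem_image_of_mem g hi
  refine ⟨g i, hy, ?_⟩
  have := h _ (Function.invFunOn_mem hy) _ hi
  rw [Function.invFunOn_eq hy, edist_self, mul_zero] at this
  exact edist_le_zero.1 this

end Comparison

theorem MeasurableSet.exists_partition {ι : Type*} [TopologicalSpace ι] [SecondCountableTopology ι]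
    [MeasurableSpace ι] [OpensMeasurableSpace ι] {Ω : Set ι} (hΩ : MeasurableSet Ω)
    {P : Set ι → Prop} (hP : ∀ s t, s ⊆ t → P t → P s) (h : ∀ x ∈ Ω, ∃ N ∈ 𝓝 x, P N) :
    ∃ E : ℕ → Set ι, (∀ n, MeasurableSet (E n)) ∧ Pairwise (Function.onFun Disjoint E) ∧
      ⋃ n, E n = Ω ∧ ∀ n, E n = ∅ ∨ P (E n) := by
  have h' : ∀ x : ι, ∃ V : Set ι, IsOpen V ∧ (x ∈ Ω → x ∈ V ∧ P V) := by
    intro x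
    by_cases hx : x ∈ Ω
    · obtain ⟨N, hN, hPN⟩ := h x hx
      obtain ⟨V, hVN, hV, hxV⟩ := mem_nhds_iff.1 hN
      exact ⟨V, hV, fun _ => ⟨hxV, hP _ _ hVN hPN⟩⟩
    · exact ⟨∅, isOpen_empty, fun h => absurd h hx⟩
  choose V hVo hV using h'
  obtain ⟨t, htΩ, htc, hcov⟩ := TopologicalSpace.countable_cover_nhdsWithin
    (f := V) (s := Ω) fun x hx => mem_nhdsWithin_of_mem_nhds ((hVo x).mem_nhds (hV x hx).1)
  rcases t.eq_empty_or_nonempty with rfl | hne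
  · refine ⟨fun _ => ∅, fun _ => MeasurableSet.empty, fun i j _ => disjoint_bot_left, ?_,
      fun n => Or.inl rfl⟩
    rw [iUnion_empty]
    refine (eq_empty_of_forall_notMem fun y hy => ?_).symm
    simpa using hcov hy
  obtain ⟨x, hx⟩ := htc.exists_eq_range hne
  refine ⟨disjointed fun n => V (x n) ∩ Ω, fun n => ?_, disjoint_disjointed _, ?_, fun n => Or.inr ?_⟩
  · exact MeasurableSet.disjointed (fun n => (hVo _).measurableSet.inter hΩ) n
  · rw [iUnion_disjointed, ← iUnion_inter]
    refine inter_eq_right.2 (hcov.trans ?_)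
    rw [hx, biUnion_range]
  · refine hP _ _ ((disjointed_subset _ n).trans inter_subset_left) (hV _ (htΩ ?_)).2
    rw [hx]; exact mem_range_self n

section Local

variable {ι X : Type*} [TopologicalSpace ι] [MeasurableSpace ι] [BorelSpace ι] [MeasurableSpace X]
  (μ : Measure X) (ν : Measure ι) {Φ : ι → X} {Ω : Set ι}

theorem measure_image_le_of_locally [SecondCountableTopology ι] (hΩ : MeasurableSet Ω)
    (h : ∀ x ∈ Ω, ∃ N ∈ 𝓝 x, ∀ E ⊆ N, MeasurableSet E → E ⊆ Ω → μ (Φ '' E) ≤ ν E) :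
    μ (Φ '' Ω) ≤ ν Ω := by
  obtain ⟨E, hEm, hEd, hEU, hE⟩ := hΩ.exists_partition
    (fun s t hst ht E hE => ht E (hE.trans hst)) h
  rw [← hEU, image_iUnion, measure_iUnion hEd hEm]
  refine (measure_iUnion_le _).trans (ENNReal.tsum_le_tsum fun n => ?_)
  rcases hE n with h0 | h0
  · simp [h0]
  · exact h0 _ Subset.rfl (hEm n) ((subset_iUnion E n).trans hEU.le)

theorem le_measure_image_of_locally [PolishSpace ι] [TopologicalSpace X] [T2Space X]
    [BorelSpace X] (hΩ : MeasurableSet Ω) (hc : ContinuousOn Φ Ω)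
    (hi : InjOn Φ Ω)
    (h : ∀ x ∈ Ω, ∃ N ∈ 𝓝 x, ∀ E ⊆ N, MeasurableSet E → E ⊆ Ω → ν E ≤ μ (Φ '' E)) :
    ν Ω ≤ μ (Φ '' Ω) := by
  obtain ⟨E, hEm, hEd, hEU, hE⟩ := hΩ.exists_partition
    (fun s t hst ht E hE => ht E (hE.trans hst)) h
  have hsub : ∀ n, E n ⊆ Ω := fun n => (subset_iUnion E n).trans hEU.le
  rw [← hEU, image_iUnion, measure_iUnion hEd hEm, measure_iUnion]
  · refine ENNReal.tsum_le_tsum fun n => ?_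
    rcases hE n with h0 | h0
    · simp [h0]
    · exact h0 _ Subset.rfl (hEm n) (hsub n)
  · intro i j hij
    exact (hEd hij).image hi (hsub i) (hsub j)
  · exact fun n => (hEm n).image_of_continuousOn_injOn (hc.mono (hsub n)) (hi.mono (hsub n))

end Local

end

section

open Set Filter Topology

theorem WithLp.prod_dist_sq {α β : Type*} [PseudoMetricSpace α] [PseudoMetricSpace β]
    (x y : WithLp 2 (α × β)) : dist x y ^ 2 = dist x.fst y.fst ^ 2 + dist x.snd y.snd ^ 2 := by
  rw [WithLp.prod_dist_eq_add (by simp), ← Real.rpow_natCast, ← Real.rpow_mul (by positivity)]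
  simp

/-- The point of the unit sphere with colatitude `θ` and longitude `φ`. -/
def sphPt (θ φ : ℝ) : Sph2 :=
  ⟨!₂[sin θ * cos φ, sin θ * sin φ, cos θ], by
    rw [mem_sphere_zero_iff_norm, EuclideanSpace.norm_eq, Real.sqrt_eq_one]
    simp only [Fin.sum_univ_three, Real.norm_eq_abs, sq_abs]
    simp only [Matrix.cons_val_zero, Matrix.cons_val_one, Matrix.cons_val]
    nlinarith [sin_sq_add_cos_sq θ, sin_sq_add_cos_sq φ]⟩

/-- The point of the plane with polar coordinates `ρ`, `ψ`. -/
def planePt (ρ ψ : ℝ) : EucSp 2 := !₂[ρ * cos ψ, ρ * sin ψ]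

theorem four_sin_half_sq (x : ℝ) : 4 * sin (x / 2) ^ 2 = 2 - 2 * cos x := by
  have : cos x = 2 * cos (x / 2) ^ 2 - 1 := by rw [← cos_two_mul, mul_div_cancel₀ _ two_ne_zero]
  nlinarith [sin_sq_add_cos_sq (x / 2)]

theorem dist_sphPt_sq (θ φ θ' φ' : ℝ) : dist (sphPt θ φ) (sphPt θ' φ') ^ 2 =
    4 * sin ((θ - θ') / 2) ^ 2 + sin θ * sin θ' * (4 * sin ((φ - φ') / 2) ^ 2) := by
  rw [Subtype.dist_eq, EuclideanSpace.dist_eq, Real.sq_sqrt (by positivity)]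
  simp only [Fin.sum_univ_three, Real.dist_eq, sq_abs, sphPt]
  simp only [Matrix.cons_val_zero, Matrix.cons_val_one, Matrix.cons_val]
  rw [four_sin_half_sq, four_sin_half_sq, cos_sub, cos_sub]
  linear_combination (sin θ ^ 2) * (sin_sq_add_cos_sq φ) + (sin θ' ^ 2) * (sin_sq_add_cos_sq φ') +
    sin_sq_add_cos_sq θ + sin_sq_add_cos_sq θ'

theorem dist_planePt_sq (ρ ψ ρ' ψ' : ℝ) : dist (planePt ρ ψ) (planePt ρ' ψ') ^ 2 =
    (ρ - ρ') ^ 2 + ρ * ρ' * (4 * sin ((ψ - ψ') / 2) ^ 2) := by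
  rw [EuclideanSpace.dist_eq, Real.sq_sqrt (by positivity)]
  simp only [Fin.sum_univ_two, Real.dist_eq, sq_abs, planePt]
  simp only [Matrix.cons_val_zero, Matrix.cons_val_one]
  rw [four_sin_half_sq, cos_sub]
  linear_combination (ρ ^ 2) * (sin_sq_add_cos_sq ψ) + (ρ' ^ 2) * (sin_sq_add_cos_sq ψ')

theorem norm_planePt {ρ : ℝ} (h : 0 ≤ ρ) (ψ : ℝ) : ‖planePt ρ ψ‖ = ρ := by
  rw [← dist_zero_right, ← abs_of_nonneg h, ← abs_of_nonneg (dist_nonneg (x := planePt |ρ| ψ)),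
    ← sq_eq_sq_iff_abs_eq_abs]
  have := dist_planePt_sq |ρ| ψ 0 0
  have h0 : planePt 0 0 = 0 := by ext i; fin_cases i <;> simp [planePt]
  rw [h0] at this
  rw [this]; simp

theorem continuous_sphPt : Continuous fun q : ℝ × ℝ => sphPt q.1 q.2 := by
  unfold sphPt
  refine Continuous.subtype_mk ?_ _
  refine (PiLp.continuous_toLp 2 _).comp (continuous_pi fun i => ?_)
  fin_cases i <;> simp <;> fun_prop

theorem continuous_planePt : Continuous fun q : ℝ × ℝ => planePt q.1 q.2 := by
  unfold planePt
  refine (PiLp.continuous_toLp 2 _).comp (continuous_pi fun i => ?_)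
  fin_cases i <;> simp <;> fun_prop

theorem exists_planePt_eq (x : EucSp 2) : ∃ ψ ∈ Ioc (-π) π, planePt ‖x‖ ψ = x := by
  set z : ℂ := ⟨x 0, x 1⟩
  have hz : ‖z‖ = ‖x‖ := by
    rw [Complex.norm_eq_sqrt_sq_add_sq, EuclideanSpace.norm_eq]
    simp [z]
  refine ⟨z.arg, Complex.arg_mem_Ioc z, ?_⟩
  ext i
  fin_cases i
  · simpa [planePt, hz] using Complex.norm_mul_cos_arg z
  · simpa [planePt, hz] using Complex.norm_mul_sin_arg z

theorem exists_sphPt_eq (p : Sph2) :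
    ∃ φ ∈ Ioc (-π) π, sphPt (arccos (p.1 2)) φ = p := by
  have hp : p.1 0 ^ 2 + p.1 1 ^ 2 + p.1 2 ^ 2 = 1 := by
    have := mem_sphere_zero_iff_norm.1 p.2
    rw [EuclideanSpace.norm_eq, Real.sqrt_eq_one] at this
    simpa [Fin.sum_univ_three] using this
  have h2 : -1 ≤ p.1 2 ∧ p.1 2 ≤ 1 := by constructor <;> nlinarith [sq_nonneg (p.1 0), sq_nonneg (p.1 1)]
  set z : ℂ := ⟨p.1 0, p.1 1⟩
  have hz : ‖z‖ = sin (arccos (p.1 2)) := by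
    rw [Complex.norm_eq_sqrt_sq_add_sq, sin_arccos]
    congr 1; simp only [z]; linarith
  refine ⟨z.arg, Complex.arg_mem_Ioc z, ?_⟩
  ext i
  fin_cases i
  · change sin (arccos _) * cos z.arg = _
    rw [← hz]; exact Complex.norm_mul_cos_arg z
  · change sin (arccos _) * sin z.arg = _
    rw [← hz]; exact Complex.norm_mul_sin_arg z
  · simpa [sphPt] using cos_arccos h2.1 h2.2

theorem sphPt_injOn : InjOn (fun q : ℝ × ℝ => sphPt q.1 q.2) (Ioo 0 π ×ˢ Ioo (-π) π) := by
  rintro ⟨θ, φ⟩ ⟨hθ, hφ⟩ ⟨θ', φ'⟩ ⟨hθ', hφ'⟩ h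
  have h1 := dist_sphPt_sq θ φ θ' φ'
  simp only at h hθ hφ hθ' hφ'
  rw [h, dist_self] at h1
  have hpi := Real.pi_pos
  have s1 := sin_pos_of_mem_Ioo hθ
  have s2 := sin_pos_of_mem_Ioo hθ'
  have s12 := mul_pos s1 s2
  have e1 : sin ((θ - θ') / 2) = 0 := by
    have := mul_nonneg s12.le (sq_nonneg (sin ((φ - φ') / 2)))
    exact pow_eq_zero_iff two_ne_zero |>.1 (by nlinarith [sq_nonneg (sin ((θ - θ') / 2))])
  have e2 : sin ((φ - φ') / 2) = 0 := by
    rw [e1] at h1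
    exact pow_eq_zero_iff two_ne_zero |>.1 (mul_left_cancel₀ s12.ne' (by linarith))
  rw [sin_eq_zero_iff_of_lt_of_lt (by linarith [hθ.1, hθ'.2]) (by linarith [hθ.2, hθ'.1])] at e1
  rw [sin_eq_zero_iff_of_lt_of_lt (by linarith [hφ.1, hφ'.2]) (by linarith [hφ.2, hφ'.1])] at e2
  ext <;> simp only <;> linarith

theorem planePt_injOn : InjOn (fun q : ℝ × ℝ => planePt q.1 q.2) (Ioi 0 ×ˢ Ioo (-π) π) := by
  rintro ⟨ρ, φ⟩ ⟨hρ, hφ⟩ ⟨ρ', φ'⟩ ⟨hρ', hφ'⟩ h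
  have h1 := dist_planePt_sq ρ φ ρ' φ'
  simp only [mem_Ioi] at h hρ hφ hρ' hφ'
  rw [h, dist_self] at h1
  have s12 := mul_pos hρ hρ'
  have e1 : ρ - ρ' = 0 := by
    have := mul_nonneg s12.le (sq_nonneg (sin ((φ - φ') / 2)))
    exact pow_eq_zero_iff two_ne_zero |>.1 (by nlinarith [sq_nonneg (ρ - ρ')])
  have e2 : sin ((φ - φ') / 2) = 0 := by
    rw [e1] at h1
    exact pow_eq_zero_iff two_ne_zero |>.1 (mul_left_cancel₀ s12.ne' (by linarith))
  rw [sin_eq_zero_iff_of_lt_of_lt (by linarith [hφ.1, hφ'.2]) (by linarith [hφ.2, hφ'.1])] at e2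
  ext <;> simp only <;> linarith

theorem four_sin_half_sq_le (x : ℝ) : 4 * sin (x / 2) ^ 2 ≤ x ^ 2 := by
  have := abs_sin_le_abs (x := x / 2)
  have := sq_le_sq' (by linarith [abs_nonneg (sin (x/2)), abs_nonneg (x / 2)]) this
  rw [sq_abs, sq_abs] at this
  linarith

theorem exists_forall_le_four_sin_half_sq {c : ℝ} (hc : c < 1) :
    ∃ δ > 0, ∀ x : ℝ, |x| < δ → c * x ^ 2 ≤ 4 * sin (x / 2) ^ 2 := by
  have h : HasDerivAt (fun x => 2 * sin (x / 2)) 1 0 := by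
    have := ((hasDerivAt_id (0 : ℝ)).div_const 2).sin.const_mul 2
    simpa using this
  rcases le_or_gt c 0 with h0 | h0
  · exact ⟨1, one_pos, fun x _ => by nlinarith [sq_nonneg x, sq_nonneg (sin (x / 2))]⟩
  have hs : √c < 1 := by rw [Real.sqrt_lt' one_pos]; simpa
  obtain ⟨δ, hδ, hb⟩ := Metric.eventually_nhds_iff.1
    ((hasDerivAt_iff_isLittleO.1 h).bound (sub_pos.2 hs))
  refine ⟨δ, hδ, fun x hx => ?_⟩
  have := hb (y := x) (by simpa using hx)
  simp only [zero_div, sin_zero, mul_zero, sub_zero, smul_eq_mul, mul_one, Real.norm_eq_abs] at this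
  have h2 : √c * |x| ≤ |2 * sin (x / 2)| := by
    have := abs_sub_abs_le_abs_sub x (2 * sin (x / 2))
    rw [abs_sub_comm] at this
    linarith
  have h3 := pow_le_pow_left₀ (by positivity) h2 2
  rw [mul_pow, sq_abs, sq_abs, Real.sq_sqrt h0.le, mul_pow] at h3
  linarith

end

section

open Set Filter Topology

theorem euclideanHausdorffMeasure_image_le_of_dist_sq_le {ι X Y : Type*}
    [MetricSpace X] [MeasurableSpace X] [BorelSpace X]
    [MetricSpace Y] [MeasurableSpace Y] [BorelSpace Y] {K : ℝ} (hK : 0 ≤ K) {f : ι → X} {g : ι → Y}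
    {s : Set ι} (h : ∀ i ∈ s, ∀ j ∈ s, dist (f i) (f j) ^ 2 ≤ K ^ 2 * dist (g i) (g j) ^ 2)
    (d : ℕ) : μHE[d] (f '' s) ≤ ENNReal.ofReal (K ^ d) * μHE[d] (g '' s) := by
  have := euclideanHausdorffMeasure_image_le_of_edist_le (K := K.toNNReal) (f := f) (g := g) (s := s)
    (fun i hi j hj => ?_) d
  · rwa [ENNReal.ofReal_pow hK]
  · rw [edist_dist, edist_dist]
    change _ ≤ ENNReal.ofReal K * _
    rw [← ENNReal.ofReal_mul hK]
    refine ENNReal.ofReal_le_ofReal (abs_le_of_sq_le_sq' ?_ (by positivity)).2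
    rw [mul_pow]; exact h i hi j hj

theorem le_of_forall_ofReal_pow_mul_le {I m : ℝ≥0∞} (n : ℕ)
    (h : ∀ c : ℝ, 0 < c → c < 1 → ENNReal.ofReal (c ^ n) * I ≤ m) : I ≤ m := by
  have h1 : Tendsto (fun c : ℝ => ENNReal.ofReal (c ^ n) * I) (𝓝[<] 1) (𝓝 (1 * I)) := by
    refine ENNReal.Tendsto.mul_const ?_ (Or.inl one_ne_zero)
    have : Continuous fun c : ℝ => ENNReal.ofReal (c ^ n) :=
      ENNReal.continuous_ofReal.comp (continuous_pow n)
    have := this.tendsto 1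
    simp only [one_pow, ENNReal.ofReal_one] at this
    exact this.mono_left nhdsWithin_le_nhds
  rw [one_mul] at h1
  refine le_of_tendsto h1 ?_
  filter_upwards [Ioo_mem_nhdsLT (zero_lt_one (α := ℝ))] with c hc using h c hc.1 hc.2

theorem measurePreserving_const_mul {a : ℝ} (ha : 0 < a) :
    MeasurePreserving (fun x : ℝ => a * x) (ENNReal.ofReal a • volume) volume :=
  ⟨by fun_prop, by
    rw [Measure.map_smul]
    simpa [abs_of_pos ha] using Real.smul_map_volume_mul_left ha.ne'⟩

/-- A linear model for the metric of `S² × ℝ²` in polar coordinates. -/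
def polarModel (a b : ℝ) (q : (ℝ × ℝ) × (ℝ × ℝ)) : WithLp 2 (WithLp 2 (ℝ × ℝ) × WithLp 2 (ℝ × ℝ)) :=
  WithLp.toLp 2 (WithLp.toLp 2 (q.1.1, a * q.1.2), WithLp.toLp 2 (q.2.1, b * q.2.2))

theorem dist_polarModel_sq (a b : ℝ) (p q : (ℝ × ℝ) × (ℝ × ℝ)) :
    dist (polarModel a b p) (polarModel a b q) ^ 2 = (p.1.1 - q.1.1) ^ 2 +
      a ^ 2 * (p.1.2 - q.1.2) ^ 2 + ((p.2.1 - q.2.1) ^ 2 + b ^ 2 * (p.2.2 - q.2.2) ^ 2) := by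
  rw [WithLp.prod_dist_sq, WithLp.prod_dist_sq, WithLp.prod_dist_sq]
  change dist p.1.1 q.1.1 ^ 2 + dist (a * p.1.2) (a * q.1.2) ^ 2 +
    (dist p.2.1 q.2.1 ^ 2 + dist (b * p.2.2) (b * q.2.2) ^ 2) = _
  simp only [Real.dist_eq, sq_abs]
  ring

theorem euclideanHausdorffMeasure_polarModel_image {a b : ℝ} (ha : 0 < a) (hb : 0 < b)
    (E : Set ((ℝ × ℝ) × (ℝ × ℝ))) :
    μHE[4] (polarModel a b '' E) = ENNReal.ofReal (a * b) * volume E := by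
  have hdim : Module.finrank ℝ (WithLp 2 (WithLp 2 (ℝ × ℝ) × WithLp 2 (ℝ × ℝ))) = 4 := by
    rw [(WithLp.linearEquiv 2 ℝ _).finrank_eq, Module.finrank_prod,
      (WithLp.linearEquiv 2 ℝ (ℝ × ℝ)).finrank_eq, Module.finrank_prod, Module.finrank_self]
  have hv : (μHE[4] : Measure (WithLp 2 (WithLp 2 (ℝ × ℝ) × WithLp 2 (ℝ × ℝ)))) = volume := by
    rw [← InnerProductSpace.euclideanHausdorffMeasure_eq_volume, hdim]
  have hmp : MeasurePreserving (polarModel a b)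
      (((volume : Measure ℝ).prod (ENNReal.ofReal a • volume)).prod
        ((volume : Measure ℝ).prod (ENNReal.ofReal b • volume))) volume := by
    have h1 : ∀ {c : ℝ}, 0 < c → MeasurePreserving (fun x : ℝ × ℝ => WithLp.toLp 2 (x.1, c * x.2))
        ((volume : Measure ℝ).prod (ENNReal.ofReal c • volume)) volume := fun hc =>
      (WithLp.volume_preserving_toLp ℝ ℝ).comp
        ((MeasurePreserving.id volume).prod (measurePreserving_const_mul hc))
    exact (WithLp.volume_preserving_toLp _ _).comp ((h1 ha).prod (h1 hb))
  have hcont : Continuous (polarModel a b) := by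
    unfold polarModel
    fun_prop
  have hinj : Function.Injective (polarModel a b) := by
    intro p q h
    have := dist_polarModel_sq a b p q
    rw [h, dist_self] at this
    have e1 := sq_nonneg (p.1.1 - q.1.1)
    have e2 := mul_nonneg (sq_nonneg a) (sq_nonneg (p.1.2 - q.1.2))
    have e3 := sq_nonneg (p.2.1 - q.2.1)
    have e4 := mul_nonneg (sq_nonneg b) (sq_nonneg (p.2.2 - q.2.2))
    ext
    · exact sub_eq_zero.1 (pow_eq_zero_iff two_ne_zero |>.1 (by linarith))
    · exact sub_eq_zero.1 (pow_eq_zero_iff two_ne_zero |>.1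
        (mul_left_cancel₀ (pow_pos ha 2).ne' (by linarith)))
    · exact sub_eq_zero.1 (pow_eq_zero_iff two_ne_zero |>.1 (by linarith))
    · exact sub_eq_zero.1 (pow_eq_zero_iff two_ne_zero |>.1
        (mul_left_cancel₀ (pow_pos hb 2).ne' (by linarith)))
  rw [hv, ← hmp.measure_preimage_emb (hcont.measurableEmbedding hinj), hinj.preimage_image,
    Measure.prod_smul_right, Measure.prod_smul_right, Measure.prod_smul_right,
    Measure.prod_smul_left, smul_smul, mul_comm, ENNReal.ofReal_mul ha.le]
  rfl

/-- Polar coordinates on `S² × ℝ²`. -/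
def polarMap (q : (ℝ × ℝ) × (ℝ × ℝ)) : WithLp 2 (Sph2 × EucSp 2) :=
  WithLp.toLp 2 (sphPt q.1.1 q.1.2, planePt q.2.1 q.2.2)

theorem continuous_polarMap : Continuous polarMap := by
  unfold polarMap
  have h1 := continuous_sphPt
  have h2 := continuous_planePt
  exact (WithLp.prod_continuous_toLp 2 _ _).comp
    ((h1.comp continuous_fst).prodMk (h2.comp continuous_snd))

theorem dist_polarMap_sq (p q : (ℝ × ℝ) × (ℝ × ℝ)) : dist (polarMap p) (polarMap q) ^ 2 =
    4 * sin ((p.1.1 - q.1.1) / 2) ^ 2 +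
      sin p.1.1 * sin q.1.1 * (4 * sin ((p.1.2 - q.1.2) / 2) ^ 2) +
    ((p.2.1 - q.2.1) ^ 2 + p.2.1 * q.2.1 * (4 * sin ((p.2.2 - q.2.2) / 2) ^ 2)) := by
  rw [WithLp.prod_dist_sq]
  exact congrArg₂ (· + ·) (dist_sphPt_sq _ _ _ _) (dist_planePt_sq _ _ _ _)

theorem lintegral_le_euclideanHausdorffMeasure_polarMap_image {Ω : Set ((ℝ × ℝ) × (ℝ × ℝ))}
    (hΩm : MeasurableSet Ω)
    (hΩ : Ω ⊆ (Ioo 0 π ×ˢ Ioo (-π) π) ×ˢ (Ioi 0 ×ˢ Ioo (-π) π)) :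
    ∫⁻ q in Ω, ENNReal.ofReal (sin q.1.1 * q.2.1) ≤ μHE[4] (polarMap '' Ω) := by
  refine le_of_forall_ofReal_pow_mul_le 9 fun c hc0 hc1 => ?_
  set W : (ℝ × ℝ) × (ℝ × ℝ) → ℝ≥0∞ := fun q => ENNReal.ofReal (sin q.1.1 * q.2.1) with hW
  have hWm : Measurable W := by fun_prop
  have hinj : InjOn polarMap Ω := by
    intro p hp q hq h
    have h1 := congrArg WithLp.fst h
    have h2 := congrArg WithLp.snd h
    exact Prod.ext (sphPt_injOn (hΩ hp).1 (hΩ hq).1 h1) (planePt_injOn (hΩ hp).2 (hΩ hq).2 h2)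
  have key := le_measure_image_of_locally (μHE[4]) (ENNReal.ofReal (c ^ 9) • volume.withDensity W)
    hΩm continuous_polarMap.continuousOn hinj ?_
  · rwa [Measure.smul_apply, withDensity_apply _ hΩm, smul_eq_mul] at key
  intro q₀ hq₀
  obtain ⟨⟨hθ, hφ⟩, hρ, hψ⟩ := hΩ hq₀
  set a := sin q₀.1.1
  set b := q₀.2.1
  have ha : 0 < a := sin_pos_of_mem_Ioo hθ
  have hb : 0 < b := hρ
  obtain ⟨δ, hδ, hsin⟩ := exists_forall_le_four_sin_half_sq hc1
  have hN : ∀ᶠ q in 𝓝 q₀, dist q q₀ < δ / 2 ∧ c * a < sin q.1.1 ∧ c * b < q.2.1 ∧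
      sin q.1.1 * q.2.1 * c < a * b := by
    refine Filter.Eventually.and (Metric.ball_mem_nhds q₀ (half_pos hδ)) ?_
    have e1 : ContinuousAt (fun q : (ℝ × ℝ) × (ℝ × ℝ) => sin q.1.1) q₀ := by fun_prop
    have e2 : ContinuousAt (fun q : (ℝ × ℝ) × (ℝ × ℝ) => q.2.1) q₀ := by fun_prop
    have e3 : ContinuousAt (fun q : (ℝ × ℝ) × (ℝ × ℝ) => sin q.1.1 * q.2.1 * c) q₀ := by fun_prop
    refine (e1.eventually (lt_mem_nhds ?_)).and ((e2.eventually (lt_mem_nhds ?_)).and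
      (e3.eventually (gt_mem_nhds ?_)))
    · exact mul_lt_of_lt_one_left ha hc1
    · exact mul_lt_of_lt_one_left hb hc1
    · exact mul_lt_of_lt_one_right (mul_pos ha hb) hc1
  refine ⟨_, hN, fun E hE hEm hEΩ => ?_⟩
  have h1 : μHE[4] (polarModel a b '' E) ≤ ENNReal.ofReal (((c ^ 2)⁻¹) ^ 4) * μHE[4] (polarMap '' E) := by
    refine euclideanHausdorffMeasure_image_le_of_dist_sq_le (by positivity) (fun p hp q hq => ?_) 4
    obtain ⟨hp1, hp2, hp3, -⟩ := hE hp
    obtain ⟨hq1, hq2, hq3, -⟩ := hE hq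
    have hd : dist p q < δ := by
      have := dist_triangle_right p q q₀
      linarith
    have hd11 : |p.1.1 - q.1.1| < δ :=
      ((le_max_left _ _).trans ((le_max_left _ _).trans_eq rfl)).trans_lt hd
    have hd12 : |p.1.2 - q.1.2| < δ :=
      ((le_max_right _ _).trans ((le_max_left _ _).trans_eq rfl)).trans_lt hd
    have hd22 : |p.2.2 - q.2.2| < δ :=
      ((le_max_right _ _).trans ((le_max_right _ _).trans_eq rfl)).trans_lt hd
    rw [inv_pow, ← pow_mul, ← div_eq_inv_mul, le_div_iff₀ (by positivity), dist_polarModel_sq,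
      dist_polarMap_sq]
    have i1 := hsin _ hd11
    have i2 := hsin _ hd12
    have i4 := hsin _ hd22
    have j2 : (c * a) * (c * a) * (c * (p.1.2 - q.1.2) ^ 2) ≤
        sin p.1.1 * sin q.1.1 * (4 * sin ((p.1.2 - q.1.2) / 2) ^ 2) :=
      mul_le_mul (mul_le_mul hp2.le hq2.le (by positivity) (by linarith [mul_pos hc0 ha])) i2
        (by positivity) (by nlinarith [mul_pos hc0 ha])
    have j4 : (c * b) * (c * b) * (c * (p.2.2 - q.2.2) ^ 2) ≤
        p.2.1 * q.2.1 * (4 * sin ((p.2.2 - q.2.2) / 2) ^ 2) :=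
      mul_le_mul (mul_le_mul hp3.le hq3.le (by positivity) (by linarith [mul_pos hc0 hb])) i4
        (by positivity) (by nlinarith [mul_pos hc0 hb])
    have c1 : c ^ 4 ≤ c := pow_le_of_le_one hc0.le hc1.le (by norm_num)
    have c3 : c ^ 4 ≤ c ^ 3 := pow_le_pow_of_le_one hc0.le hc1.le (by norm_num)
    have k1 : c ^ 4 * (p.1.1 - q.1.1) ^ 2 ≤ c * (p.1.1 - q.1.1) ^ 2 := by gcongr
    have k2 : c ^ 4 * (a ^ 2 * (p.1.2 - q.1.2) ^ 2) ≤ c ^ 3 * (a ^ 2 * (p.1.2 - q.1.2) ^ 2) := by gcongr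
    have k3 : c ^ 4 * (p.2.1 - q.2.1) ^ 2 ≤ 1 * (p.2.1 - q.2.1) ^ 2 := by
      gcongr; linarith
    have k4 : c ^ 4 * (b ^ 2 * (p.2.2 - q.2.2) ^ 2) ≤ c ^ 3 * (b ^ 2 * (p.2.2 - q.2.2) ^ 2) := by gcongr
    nlinarith
  rw [euclideanHausdorffMeasure_polarModel_image ha hb] at h1
  rw [Measure.smul_apply, withDensity_apply _ hEm, smul_eq_mul]
  have h2 : ENNReal.ofReal c * ∫⁻ q in E, W q ≤ ENNReal.ofReal (a * b) * volume E := by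
    rw [← lintegral_const_mul _ hWm, ← setLIntegral_const]
    refine setLIntegral_mono' hEm fun q hq => ?_
    rw [hW, ← ENNReal.ofReal_mul hc0.le]
    exact ENNReal.ofReal_le_ofReal (by linarith [(hE hq).2.2.2])
  calc ENNReal.ofReal (c ^ 9) * ∫⁻ q in E, W q
      = ENNReal.ofReal (c ^ 8) * (ENNReal.ofReal c * ∫⁻ q in E, W q) := by
        rw [← mul_assoc, ← ENNReal.ofReal_mul (by positivity)]; rfl
    _ ≤ ENNReal.ofReal (c ^ 8) * (ENNReal.ofReal (((c ^ 2)⁻¹) ^ 4) * μHE[4] (polarMap '' E)) :=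
        mul_le_mul' le_rfl (h2.trans h1)
    _ = μHE[4] (polarMap '' E) := by
        rw [← mul_assoc, ← ENNReal.ofReal_mul (by positivity)]
        have : c ^ 8 * ((c ^ 2)⁻¹) ^ 4 = 1 := by field_simp
        rw [this, ENNReal.ofReal_one, one_mul]

end

section

open Set Filter Topology

theorem measurable_curveSpeed (U : ℝ → ℝ) : Measurable (curveSpeed U) := by
  have := measurable_deriv U
  unfold curveSpeed
  fun_prop

theorem half_le_curveSpeed (U : ℝ → ℝ) (s : ℝ) : 1 / 2 ≤ curveSpeed U s := by
  refine Real.le_sqrt_of_sq_le ?_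
  nlinarith [sq_nonneg (2 * deriv U s + 1)]

theorem curveSpeed_le {U : ℝ → ℝ} (hU : LipschitzWith 1 U) (s : ℝ) : curveSpeed U s ≤ 3 := by
  have h := norm_deriv_le_of_lipschitz hU (x₀ := s)
  rw [Real.norm_eq_abs, NNReal.coe_one, abs_le] at h
  refine Real.sqrt_le_iff.2 ⟨by norm_num, ?_⟩
  nlinarith [h.1, h.2]

theorem intervalIntegrable_curveSpeed {U : ℝ → ℝ} (hU : LipschitzWith 1 U) (s t : ℝ) :
    IntervalIntegrable (curveSpeed U) volume s t := by
  rw [intervalIntegrable_iff]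
  refine Measure.integrableOn_of_bounded (M := 3) (by simp)
    (measurable_curveSpeed U).aestronglyMeasurable (ae_of_all _ fun x => ?_)
  rw [Real.norm_eq_abs, abs_of_nonneg (by linarith [half_le_curveSpeed U x])]
  exact curveSpeed_le hU x

/-- The arc length of the curve `s ↦ (U s + s, U s)` measured from `s = 0`. -/
def arcLength (U : ℝ → ℝ) (s : ℝ) : ℝ := ∫ t in (0)..s, curveSpeed U t

theorem arcLength_sub {U : ℝ → ℝ} (hU : LipschitzWith 1 U) (s t : ℝ) :
    arcLength U t - arcLength U s = ∫ x in s..t, curveSpeed U x :=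
  intervalIntegral.integral_interval_sub_left (intervalIntegrable_curveSpeed hU _ _)
    (intervalIntegrable_curveSpeed hU _ _)

theorem half_mul_sub_le_arcLength_sub {U : ℝ → ℝ} (hU : LipschitzWith 1 U) {s t : ℝ} (h : s ≤ t) :
    1 / 2 * (t - s) ≤ arcLength U t - arcLength U s := by
  rw [arcLength_sub hU]
  have := intervalIntegral.integral_mono_on h (f := fun _ => (1 : ℝ) / 2) (g := curveSpeed U)
    intervalIntegrable_const (intervalIntegrable_curveSpeed hU _ _)
    fun x _ => half_le_curveSpeed U x
  rwa [intervalIntegral.integral_const, smul_eq_mul, mul_comm] at this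

theorem strictMono_arcLength {U : ℝ → ℝ} (hU : LipschitzWith 1 U) : StrictMono (arcLength U) :=
  fun s t h => by linarith [half_mul_sub_le_arcLength_sub hU h.le]

theorem continuous_arcLength {U : ℝ → ℝ} (hU : LipschitzWith 1 U) : Continuous (arcLength U) :=
  intervalIntegral.continuous_primitive (fun _ _ => intervalIntegrable_curveSpeed hU _ _) 0

theorem surjective_arcLength {U : ℝ → ℝ} (hU : LipschitzWith 1 U) :
    Function.Surjective (arcLength U) := by
  have h0 : arcLength U 0 = 0 := by simp [arcLength]
  refine (continuous_arcLength hU).surjective ?_ ?_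
  · refine tendsto_atTop_mono' atTop (f₁ := fun t => (1 / 2 : ℝ) * t) ?_
      (tendsto_id.const_mul_atTop one_half_pos)
    filter_upwards [eventually_ge_atTop 0] with t ht
    linarith [half_mul_sub_le_arcLength_sub hU ht]
  · refine tendsto_atBot_mono' atBot (f₁ := fun t => (1 / 2 : ℝ) * t) ?_
      (tendsto_id.const_mul_atBot one_half_pos)
    filter_upwards [eventually_le_atBot 0] with t ht
    linarith [half_mul_sub_le_arcLength_sub hU ht]

theorem measurePreserving_arcLength {U : ℝ → ℝ} (hU : LipschitzWith 1 U) :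
    MeasurePreserving (arcLength U)
      (volume.withDensity fun s => ENNReal.ofReal (curveSpeed U s)) volume := by
  refine ⟨(continuous_arcLength hU).measurable, (Real.measure_ext_Ioo_rat fun a b => ?_).symm⟩
  obtain ⟨s, hs⟩ := surjective_arcLength hU a
  obtain ⟨t, ht⟩ := surjective_arcLength hU b
  have hpre : arcLength U ⁻¹' Ioo (a : ℝ) b = Ioo s t := by
    ext x
    simp [← hs, ← ht, (strictMono_arcLength hU).lt_iff_lt]
  rw [Measure.map_apply (continuous_arcLength hU).measurable measurableSet_Ioo, hpre,
    withDensity_apply _ measurableSet_Ioo, Real.volume_Ioo, ← hs, ← ht]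
  rcases le_total s t with h | h
  · rw [arcLength_sub hU, intervalIntegral.integral_of_le h, integral_Ioc_eq_integral_Ioo,
      ofReal_integral_eq_lintegral_ofReal]
    · exact ((intervalIntegrable_curveSpeed hU s t).1).mono_set Ioo_subset_Ioc_self
    · exact ae_of_all _ fun x => by
        change 0 ≤ curveSpeed U x
        linarith [half_le_curveSpeed U x]
  · rw [Ioo_eq_empty (not_lt.2 h), setLIntegral_empty, ENNReal.ofReal_eq_zero.2]
    linarith [half_mul_sub_le_arcLength_sub hU h]

theorem sq_add_sq_le_arcLength_sub_sq {U : ℝ → ℝ} (hU : LipschitzWith 1 U) (s t : ℝ) :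
    (U t + t - (U s + s)) ^ 2 + (U t - U s) ^ 2 ≤ (arcLength U t - arcLength U s) ^ 2 := by
  wlog h : s ≤ t generalizing s t
  · have := this t s (le_of_not_ge h)
    nlinarith
  set B := U t - U s
  set A := U t + t - (U s + s)
  have hac := hU.lipschitzOnWith (s := uIcc s t) |>.absolutelyContinuousOnInterval
  have h_int := hac.intervalIntegrable_deriv
  have hB : ∫ x in s..t, deriv U x = B := hac.integral_deriv_eq_sub
  have hA : ∫ x in s..t, (1 + deriv U x) = A := by
    rw [intervalIntegral.integral_add intervalIntegrable_const h_int, hB]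
    simp only [intervalIntegral.integral_const, smul_eq_mul, A, B]
    ring
  have h1 : A ^ 2 + B ^ 2 = ∫ x in s..t, (A * (1 + deriv U x) + B * deriv U x) := by
    rw [intervalIntegral.integral_add, intervalIntegral.integral_const_mul,
      intervalIntegral.integral_const_mul, hA, hB]
    · ring
    · exact (intervalIntegrable_const.add h_int).const_mul _
    · exact h_int.const_mul _
  have h2 : A ^ 2 + B ^ 2 ≤ √(A ^ 2 + B ^ 2) * (arcLength U t - arcLength U s) := by
    rw [arcLength_sub hU, ← intervalIntegral.integral_const_mul]
    conv_lhs => rw [h1]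
    refine intervalIntegral.integral_mono_on h
      (((intervalIntegrable_const.add h_int).const_mul _).add (h_int.const_mul _))
      ((intervalIntegrable_curveSpeed hU s t).const_mul _) fun x _ => ?_
    rw [curveSpeed, ← Real.sqrt_mul (by positivity)]
    refine Real.le_sqrt_of_sq_le ?_
    nlinarith [sq_nonneg (A * deriv U x - B * (1 + deriv U x))]
  have hn : 0 ≤ arcLength U t - arcLength U s := by
    linarith [half_mul_sub_le_arcLength_sub hU h]
  have hsq : √(A ^ 2 + B ^ 2) ^ 2 = A ^ 2 + B ^ 2 := Real.sq_sqrt (by positivity)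
  have h3 : √(A ^ 2 + B ^ 2) ≤ arcLength U t - arcLength U s := by
    rcases (Real.sqrt_nonneg (A ^ 2 + B ^ 2)).eq_or_lt with h0 | h0
    · rw [← h0]; exact hn
    · refine le_of_mul_le_mul_left ?_ h0
      nlinarith
  nlinarith [Real.sqrt_nonneg (A ^ 2 + B ^ 2)]

/-- A linear model for the metric of a rotationally symmetric hypersurface of `S² × ℝ²`. -/
def curveModel (U : ℝ → ℝ) (a b : ℝ) (q : ℝ × (ℝ × ℝ)) : WithLp 2 (ℝ × WithLp 2 (ℝ × ℝ)) :=
  WithLp.toLp 2 (arcLength U q.1, WithLp.toLp 2 (a * q.2.1, b * q.2.2))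

theorem dist_curveModel_sq (U : ℝ → ℝ) (a b : ℝ) (p q : ℝ × (ℝ × ℝ)) :
    dist (curveModel U a b p) (curveModel U a b q) ^ 2 = (arcLength U p.1 - arcLength U q.1) ^ 2 +
      (a ^ 2 * (p.2.1 - q.2.1) ^ 2 + b ^ 2 * (p.2.2 - q.2.2) ^ 2) := by
  rw [WithLp.prod_dist_sq, WithLp.prod_dist_sq]
  change dist (arcLength U p.1) (arcLength U q.1) ^ 2 + (dist (a * p.2.1) (a * q.2.1) ^ 2 +
    dist (b * p.2.2) (b * q.2.2) ^ 2) = _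
  simp only [Real.dist_eq, sq_abs]
  ring

theorem euclideanHausdorffMeasure_curveModel_image {U : ℝ → ℝ} (hU : LipschitzWith 1 U) {a b : ℝ}
    (ha : 0 < a) (hb : 0 < b) {E : Set (ℝ × (ℝ × ℝ))} (hE : MeasurableSet E) :
    μHE[3] (curveModel U a b '' E) =
      ∫⁻ q in E, ENNReal.ofReal (a * b) * ENNReal.ofReal (curveSpeed U q.1) := by
  have hsm : Measurable fun s => ENNReal.ofReal (curveSpeed U s) :=
    (measurable_curveSpeed U).ennreal_ofReal
  have hdim : Module.finrank ℝ (WithLp 2 (ℝ × WithLp 2 (ℝ × ℝ))) = 3 := by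
    rw [(WithLp.linearEquiv 2 ℝ _).finrank_eq, Module.finrank_prod,
      (WithLp.linearEquiv 2 ℝ (ℝ × ℝ)).finrank_eq, Module.finrank_prod, Module.finrank_self]
  have hv : (μHE[3] : Measure (WithLp 2 (ℝ × WithLp 2 (ℝ × ℝ)))) = volume := by
    rw [← InnerProductSpace.euclideanHausdorffMeasure_eq_volume, hdim]
  have hmp : MeasurePreserving (curveModel U a b)
      ((volume.withDensity fun s => ENNReal.ofReal (curveSpeed U s)).prod
        ((ENNReal.ofReal a • (volume : Measure ℝ)).prod (ENNReal.ofReal b • (volume : Measure ℝ))))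
      volume :=
    (WithLp.volume_preserving_toLp _ _).comp ((measurePreserving_arcLength hU).prod
      ((WithLp.volume_preserving_toLp ℝ ℝ).comp
        ((measurePreserving_const_mul ha).prod (measurePreserving_const_mul hb))))
  have hcont : Continuous (curveModel U a b) := by
    have := continuous_arcLength hU
    unfold curveModel
    fun_prop
  have hinj : Function.Injective (curveModel U a b) := by
    intro p q h
    have := dist_curveModel_sq U a b p q
    rw [h, dist_self] at this
    have e1 := sq_nonneg (arcLength U p.1 - arcLength U q.1)
    have e2 := mul_nonneg (sq_nonneg a) (sq_nonneg (p.2.1 - q.2.1))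
    have e4 := mul_nonneg (sq_nonneg b) (sq_nonneg (p.2.2 - q.2.2))
    ext
    · exact (strictMono_arcLength hU).injective
        (sub_eq_zero.1 (pow_eq_zero_iff two_ne_zero |>.1 (by linarith)))
    · exact sub_eq_zero.1 (pow_eq_zero_iff two_ne_zero |>.1
        (mul_left_cancel₀ (pow_pos ha 2).ne' (by linarith)))
    · exact sub_eq_zero.1 (pow_eq_zero_iff two_ne_zero |>.1
        (mul_left_cancel₀ (pow_pos hb 2).ne' (by linarith)))
  rw [hv, ← hmp.measure_preimage_emb (hcont.measurableEmbedding hinj), hinj.preimage_image,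
    Measure.prod_smul_right, Measure.prod_smul_left, Measure.prod_smul_right,
    Measure.prod_smul_right, prod_withDensity_left hsm, smul_smul, Measure.smul_apply,
    withDensity_apply _ hE, smul_eq_mul, lintegral_const_mul, ENNReal.ofReal_mul ha.le, mul_comm
      (ENNReal.ofReal a)]
  · rfl
  · exact hsm.comp measurable_fst

/-- Parametrization of a rotationally symmetric hypersurface of `S² × ℝ²`. -/
def curveMap (U : ℝ → ℝ) (q : ℝ × (ℝ × ℝ)) : WithLp 2 (Sph2 × EucSp 2) :=
  WithLp.toLp 2 (sphPt (U q.1 + q.1) q.2.1, planePt (U q.1) q.2.2)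

theorem dist_curveMap_sq (U : ℝ → ℝ) (p q : ℝ × (ℝ × ℝ)) :
    dist (curveMap U p) (curveMap U q) ^ 2 =
    4 * sin ((U p.1 + p.1 - (U q.1 + q.1)) / 2) ^ 2 +
      sin (U p.1 + p.1) * sin (U q.1 + q.1) * (4 * sin ((p.2.1 - q.2.1) / 2) ^ 2) +
    ((U p.1 - U q.1) ^ 2 + U p.1 * U q.1 * (4 * sin ((p.2.2 - q.2.2) / 2) ^ 2)) := by
  rw [WithLp.prod_dist_sq]
  exact congrArg₂ (· + ·) (dist_sphPt_sq _ _ _ _) (dist_planePt_sq _ _ _ _)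

theorem euclideanHausdorffMeasure_curveMap_image_le {U : ℝ → ℝ} (hU : LipschitzWith 1 U)
    {Ω : Set (ℝ × (ℝ × ℝ))} (hΩm : MeasurableSet Ω)
    (hΩ : ∀ q ∈ Ω, U q.1 + q.1 ∈ Ioo 0 π ∧ 0 < U q.1) :
    μHE[3] (curveMap U '' Ω) ≤
      ∫⁻ q in Ω, ENNReal.ofReal (sin (U q.1 + q.1) * U q.1 * curveSpeed U q.1) := by
  refine le_of_forall_ofReal_pow_mul_le 3 fun c hc0 hc1 => ?_
  set W : ℝ × (ℝ × ℝ) → ℝ≥0∞ :=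
    fun q => ENNReal.ofReal (sin (U q.1 + q.1) * U q.1 * curveSpeed U q.1) with hW
  have hUc := hU.continuous
  have hWm : Measurable W := by
    have := measurable_curveSpeed U
    have := hUc.measurable
    fun_prop
  have key := measure_image_le_of_locally (μ := μHE[3]) (Φ := curveMap U)
    (ν := ENNReal.ofReal ((c ^ 3)⁻¹) • volume.withDensity W) hΩm ?_
  · rw [Measure.smul_apply, withDensity_apply _ hΩm, smul_eq_mul] at key
    calc _ ≤ ENNReal.ofReal (c ^ 3) * (ENNReal.ofReal ((c ^ 3)⁻¹) * ∫⁻ q in Ω, W q) :=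
          mul_le_mul' le_rfl key
      _ = _ := by
        rw [← mul_assoc, ← ENNReal.ofReal_mul (by positivity),
          mul_inv_cancel₀ (pow_pos hc0 3).ne', ENNReal.ofReal_one, one_mul]
  intro q₀ hq₀
  obtain ⟨hθ, hρ⟩ := hΩ q₀ hq₀
  set a := sin (U q₀.1 + q₀.1) with ha_def
  set b := U q₀.1 with hb_def
  have ha : 0 < a := sin_pos_of_mem_Ioo hθ
  have hb : 0 < b := hρ
  have hN : ∀ᶠ q in 𝓝 q₀, (sin (U q.1 + q.1) < a / c ∧ U q.1 < b / c) ∧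
      a * b * c < sin (U q.1 + q.1) * U q.1 := by
    have e1 : ContinuousAt (fun q : ℝ × (ℝ × ℝ) => sin (U q.1 + q.1)) q₀ := by fun_prop
    have e2 : ContinuousAt (fun q : ℝ × (ℝ × ℝ) => U q.1) q₀ := by fun_prop
    have e3 : ContinuousAt (fun q : ℝ × (ℝ × ℝ) => sin (U q.1 + q.1) * U q.1) q₀ := by fun_prop
    refine ((e1.eventually (gt_mem_nhds ?_)).and (e2.eventually (gt_mem_nhds ?_))).and
      (e3.eventually (lt_mem_nhds ?_))
    · rw [lt_div_iff₀ hc0]; exact mul_lt_of_lt_one_right ha hc1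
    · rw [lt_div_iff₀ hc0]; exact mul_lt_of_lt_one_right hb hc1
    · exact mul_lt_of_lt_one_right (mul_pos ha hb) hc1
  refine ⟨_, hN, fun E hE hEm hEΩ => ?_⟩
  have h1 : μHE[3] (curveMap U '' E) ≤
      ENNReal.ofReal (1 ^ 3) * μHE[3] (curveModel U (a / c) (b / c) '' E) := by
    refine euclideanHausdorffMeasure_image_le_of_dist_sq_le zero_le_one (fun p hp q hq => ?_) 3
    obtain ⟨⟨hp2, hp3⟩, -⟩ := hE hp
    obtain ⟨⟨hq2, hq3⟩, -⟩ := hE hq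
    obtain ⟨hp4, hp5⟩ := hΩ p (hEΩ hp)
    obtain ⟨hq4, hq5⟩ := hΩ q (hEΩ hq)
    have hp6 := sin_pos_of_mem_Ioo hp4
    have hq6 := sin_pos_of_mem_Ioo hq4
    rw [one_pow, one_mul, dist_curveModel_sq, dist_curveMap_sq]
    have i1 := four_sin_half_sq_le (U p.1 + p.1 - (U q.1 + q.1))
    have i2 := sq_add_sq_le_arcLength_sub_sq hU q.1 p.1
    have j2 : sin (U p.1 + p.1) * sin (U q.1 + q.1) * (4 * sin ((p.2.1 - q.2.1) / 2) ^ 2) ≤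
        (a / c) * (a / c) * (p.2.1 - q.2.1) ^ 2 :=
      mul_le_mul (mul_le_mul hp2.le hq2.le hq6.le (by positivity)) (four_sin_half_sq_le _)
        (by positivity) (by positivity)
    have j4 : U p.1 * U q.1 * (4 * sin ((p.2.2 - q.2.2) / 2) ^ 2) ≤
        (b / c) * (b / c) * (p.2.2 - q.2.2) ^ 2 :=
      mul_le_mul (mul_le_mul hp3.le hq3.le hq5.le (by positivity)) (four_sin_half_sq_le _)
        (by positivity) (by positivity)
    nlinarith
  rw [euclideanHausdorffMeasure_curveModel_image hU (div_pos ha hc0) (div_pos hb hc0) hEm,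
    one_pow, ENNReal.ofReal_one, one_mul] at h1
  rw [Measure.smul_apply, withDensity_apply _ hEm, smul_eq_mul]
  refine h1.trans ?_
  rw [← lintegral_const_mul _ hWm]
  refine setLIntegral_mono' hEm fun q hq => ?_
  have hs : 0 ≤ curveSpeed U q.1 := by linarith [half_le_curveSpeed U q.1]
  rw [hW, ← ENNReal.ofReal_mul (by positivity), ← ENNReal.ofReal_mul (by positivity), ← mul_assoc]
  refine ENNReal.ofReal_le_ofReal (mul_le_mul_of_nonneg_right ?_ hs)
  calc a / c * (b / c) = (c ^ 3)⁻¹ * (a * b * c) := by field_simp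
    _ ≤ _ := mul_le_mul_of_nonneg_left (hE hq).2.le (by positivity)

theorem euclideanHausdorffMeasure_curveMap_le {U : ℝ → ℝ} (hU : LipschitzWith 1 U) :
    μHE[3] (curveMap U '' ({s | U s + s ∈ Ioo 0 π ∧ 0 < U s} ×ˢ (Ioc (-π) π ×ˢ Ioc (-π) π))) ≤
      ∫⁻ s, ENNReal.ofReal (polarWeight (U s + s) (U s) * curveSpeed U s) := by
  have hUc := hU.continuous
  have hUm := hUc.measurable
  have hSm := measurable_curveSpeed U
  have hpi := Real.pi_pos
  have hm : MeasurableSet {s | U s + s ∈ Ioo 0 π ∧ 0 < U s} :=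
    ((isOpen_Ioo.preimage (by fun_prop : Continuous fun s => U s + s)).inter
      (isOpen_Ioi.preimage hUc)).measurableSet
  refine (euclideanHausdorffMeasure_curveMap_image_le hU
    (hm.prod (measurableSet_Ioc.prod measurableSet_Ioc)) fun q hq => hq.1).trans ?_
  have hfm : Measurable fun s => ENNReal.ofReal (sin (U s + s) * U s * curveSpeed U s) := by
    fun_prop
  rw [Measure.volume_eq_prod ℝ (ℝ × ℝ), ← Measure.prod_restrict,
    lintegral_prod _ (Measurable.aemeasurable (by fun_prop))]
  simp only [lintegral_const, Measure.restrict_apply_univ, Measure.volume_eq_prod ℝ ℝ,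
    Measure.prod_prod, Real.volume_Ioc]
  refine (setLIntegral_mono' hm fun s hs => ?_).trans (setLIntegral_le_lintegral _ _)
  have hs0 : 0 ≤ curveSpeed U s := by linarith [half_le_curveSpeed U s]
  have h1 := (sin_pos_of_mem_Ioo hs.1).le
  have h2 : 0 ≤ U s := hs.2.le
  rw [← ENNReal.ofReal_mul (by linarith), ← ENNReal.ofReal_mul (by positivity), polarWeight,
    clampSin_of_mem ⟨hs.1.1.le, hs.1.2.le⟩, max_eq_left h2]
  exact ENNReal.ofReal_le_ofReal (le_of_eq (by ring))

end

section

open Set Filter Topology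

/-- The colatitude of the spherical component of a point of `S² × ℝ²`. -/
def colat (p : WithLp 2 (Sph2 × EucSp 2)) : ℝ := arccos ((p.fst : EucSp 3) 2)

theorem continuous_colat : Continuous colat := by
  have h1 : Continuous fun p : WithLp 2 (Sph2 × EucSp 2) => (p.fst : EucSp 3) :=
    continuous_subtype_val.comp (continuous_fst.comp (WithLp.prod_continuous_ofLp 2 _ _))
  exact continuous_arccos.comp ((EuclideanSpace.proj (𝕜 := ℝ) (2 : Fin 3)).continuous.comp h1)

theorem continuous_norm_snd : Continuous fun p : WithLp 2 (Sph2 × EucSp 2) => ‖p.snd‖ :=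
  continuous_norm.comp (continuous_snd.comp (WithLp.prod_continuous_ofLp 2 _ _))

theorem colat_mem (p : WithLp 2 (Sph2 × EucSp 2)) : colat p ∈ Icc 0 π :=
  ⟨arccos_nonneg _, arccos_le_pi _⟩

theorem colat_polarMap {q : (ℝ × ℝ) × (ℝ × ℝ)} (h : q.1.1 ∈ Icc 0 π) :
    colat (polarMap q) = q.1.1 :=
  arccos_cos h.1 h.2

theorem norm_snd_polarMap {q : (ℝ × ℝ) × (ℝ × ℝ)} (h : 0 ≤ q.2.1) :
    ‖(polarMap q).snd‖ = q.2.1 :=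
  norm_planePt h _

theorem exists_polarMap_eq (p : WithLp 2 (Sph2 × EucSp 2)) :
    ∃ φ ∈ Ioc (-π) π, ∃ ψ ∈ Ioc (-π) π, polarMap ((colat p, φ), (‖p.snd‖, ψ)) = p := by
  obtain ⟨φ, hφ, h1⟩ := exists_sphPt_eq p.fst
  obtain ⟨ψ, hψ, h2⟩ := exists_planePt_eq p.snd
  refine ⟨φ, hφ, ψ, hψ, ?_⟩
  change WithLp.toLp 2 (sphPt (arccos (p.fst.1 2)) φ, planePt ‖p.snd‖ ψ) = p
  rw [h1, h2]
  rfl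

/-- A defining function of the rotationally symmetric region with profile curve
`s ↦ (U s + s, μ U s)`. -/
def profileGap (U : ℝ → ℝ) (μ : ℝ) (p : WithLp 2 (Sph2 × EucSp 2)) : ℝ :=
  U (colat p - ‖p.snd‖ / μ) - ‖p.snd‖ / μ

theorem continuous_profileGap {U : ℝ → ℝ} (hU : Continuous U) (μ : ℝ) :
    Continuous (profileGap U μ) := by
  have h1 := continuous_colat
  have h2 := continuous_norm_snd
  unfold profileGap
  fun_prop

/-- Dilation of the Euclidean factor of `S² × ℝ²`. -/
def dilate (c : ℝ) (p : WithLp 2 (Sph2 × EucSp 2)) : WithLp 2 (Sph2 × EucSp 2) :=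
  WithLp.toLp 2 (p.fst, c • p.snd)

theorem norm_snd_dilate {c : ℝ} (hc : 0 ≤ c) (p : WithLp 2 (Sph2 × EucSp 2)) :
    ‖(dilate c p).snd‖ = c * ‖p.snd‖ := by
  change ‖c • p.snd‖ = _
  rw [norm_smul, Real.norm_eq_abs, abs_of_nonneg hc]

theorem profileGap_dilate (U : ℝ → ℝ) {c μ : ℝ} (hc : 0 < c)
    (p : WithLp 2 (Sph2 × EucSp 2)) : profileGap U (c * μ) (dilate c p) = profileGap U μ p := by
  have h : ‖(dilate c p).snd‖ / (c * μ) = ‖p.snd‖ / μ := by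
    rw [norm_snd_dilate hc.le, mul_div_mul_left _ _ hc.ne']
  unfold profileGap
  rw [h]
  rfl

theorem dilate_dilate_inv {c : ℝ} (hc : c ≠ 0) (p : WithLp 2 (Sph2 × EucSp 2)) :
    dilate c (dilate c⁻¹ p) = p := by
  change WithLp.toLp 2 (p.fst, c • c⁻¹ • p.snd) = p
  rw [smul_inv_smul₀ hc]
  rfl

theorem euclideanHausdorffMeasure_dilate_image_le {c K : ℝ} (hc : 0 ≤ c) (hcK : c ≤ K) (hK : 1 ≤ K)
    (s : Set (WithLp 2 (Sph2 × EucSp 2))) (d : ℕ) :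
    μHE[d] (dilate c '' s) ≤ ENNReal.ofReal (K ^ d) * μHE[d] s := by
  have := euclideanHausdorffMeasure_image_le_of_dist_sq_le (f := dilate c) (g := id) (s := s)
    (K := K) (by linarith) (fun p _ q _ => ?_) d
  · rwa [image_id] at this
  · rw [WithLp.prod_dist_sq, id, id, WithLp.prod_dist_sq p q]
    change dist p.fst q.fst ^ 2 + dist (c • p.snd) (c • q.snd) ^ 2 ≤ _
    rw [dist_smul₀, Real.norm_eq_abs, abs_of_nonneg hc, mul_pow, mul_add]
    have h1 : 1 ≤ K ^ 2 := by nlinarith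
    have h2 : c ^ 2 ≤ K ^ 2 := by gcongr
    exact add_le_add (le_mul_of_one_le_left (by positivity) h1) (by gcongr)

theorem profileGap_setOf_eq_image (U : ℝ → ℝ) {c μ : ℝ} (hc : 0 < c) (P : ℝ → Prop) :
    {p | P (profileGap U (c * μ) p)} = dilate c '' {p | P (profileGap U μ p)} := by
  ext p
  constructor
  · intro hp
    refine ⟨dilate c⁻¹ p, ?_, dilate_dilate_inv hc.ne' p⟩
    rw [mem_ofPred_eq, ← profileGap_dilate U hc, dilate_dilate_inv hc.ne']
    exact hp
  · rintro ⟨q, hq, rfl⟩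
    rw [mem_ofPred_eq, profileGap_dilate U hc]
    exact hq

theorem euclideanHausdorffMeasure_polarMap_image_le {R : ℝ} (hR : 0 < R)
    {E : Set ((ℝ × ℝ) × (ℝ × ℝ))} (hE : ∀ q ∈ E, 0 ≤ q.2.1 ∧ q.2.1 ≤ R) :
    μHE[4] (polarMap '' E) ≤ ENNReal.ofReal R * volume E := by
  have := euclideanHausdorffMeasure_image_le_of_dist_sq_le (f := polarMap) (g := polarModel 1 R)
    (s := E) zero_le_one (fun p hp q hq => ?_) 4
  · rwa [euclideanHausdorffMeasure_polarModel_image one_pos hR, one_pow, ENNReal.ofReal_one,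
      one_mul, one_mul] at this
  · rw [dist_polarMap_sq, dist_polarModel_sq, one_pow, one_mul, one_mul]
    obtain ⟨hp1, hp2⟩ := hE p hp
    obtain ⟨hq1, hq2⟩ := hE q hq
    have j2 : sin p.1.1 * sin q.1.1 * (4 * sin ((p.1.2 - q.1.2) / 2) ^ 2) ≤
        1 * (p.1.2 - q.1.2) ^ 2 := by
      refine mul_le_mul ?_ (four_sin_half_sq_le _) (by positivity) zero_le_one
      nlinarith [sq_nonneg (sin p.1.1 - sin q.1.1), sin_sq_le_one p.1.1, sin_sq_le_one q.1.1]
    have j4 : p.2.1 * q.2.1 * (4 * sin ((p.2.2 - q.2.2) / 2) ^ 2) ≤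
        R * R * (p.2.2 - q.2.2) ^ 2 :=
      mul_le_mul (mul_le_mul hp2 hq2 hq1 hR.le) (four_sin_half_sq_le _)
        (by positivity) (by positivity)
    nlinarith [four_sin_half_sq_le (p.1.1 - q.1.1)]

theorem euclideanHausdorffMeasure_setOf_norm_snd_le {R : ℝ} (hR : 0 < R) :
    μHE[4] {p : WithLp 2 (Sph2 × EucSp 2) | ‖p.snd‖ ≤ R} ≤
      ENNReal.ofReal (R * (π * (π - -π) * (R * (π - -π)))) := by
  have hpi := Real.pi_pos
  refine (measure_mono fun p hp => ?_).trans ((euclideanHausdorffMeasure_polarMap_image_le hR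
    (E := (Icc 0 π ×ˢ Ioc (-π) π) ×ˢ (Icc 0 R ×ˢ Ioc (-π) π)) fun q hq => hq.2.1).trans ?_)
  · obtain ⟨φ, hφ, ψ, hψ, h⟩ := exists_polarMap_eq p
    exact ⟨((colat p, φ), (‖p.snd‖, ψ)), ⟨⟨colat_mem p, hφ⟩, ⟨norm_nonneg _, hp⟩, hψ⟩, h⟩
  · rw [Measure.volume_eq_prod (ℝ × ℝ) (ℝ × ℝ), Measure.prod_prod, Measure.volume_eq_prod ℝ ℝ,
      Measure.prod_prod, Measure.prod_prod, Real.volume_Icc, Real.volume_Icc, Real.volume_Ioc,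
      sub_zero, sub_zero, ← ENNReal.ofReal_mul hpi.le, ← ENNReal.ofReal_mul hR.le,
      ← ENNReal.ofReal_mul (mul_nonneg hpi.le (by linarith)), ← ENNReal.ofReal_mul hR.le]

theorem euclideanHausdorffMeasure_image_eq_zero_of_lipschitz {E X : Type*} [NormedAddCommGroup E]
    [NormedSpace ℝ E] [FiniteDimensional ℝ E] [MetricSpace X] [MeasurableSpace X]
    [BorelSpace X] {K : ℝ≥0} {f : E → X} (hf : LipschitzWith K f) {d : ℕ}
    (hd : Module.finrank ℝ E < d) : μHE[d] (range f) = 0 := by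
  have h1 : dimH (range f) < ((d : ℝ≥0) : ℝ≥0∞) := by
    refine (hf.dimH_range_le).trans_lt ?_
    rw [Real.dimH_univ_eq_finrank]
    exact_mod_cast hd
  have h2 := hausdorffMeasure_of_dimH_lt h1
  rw [euclideanHausdorffMeasure_eq_mul, haus_eq_hausdorffMeasure]
  rw [NNReal.coe_natCast] at h2
  rw [h2, mul_zero]

theorem euclideanHausdorffMeasure_setOf_sin_colat_eq_zero :
    μHE[3] {p : WithLp 2 (Sph2 × EucSp 2) | sin (colat p) = 0} = 0 := by
  have h1 (p₀ : Sph2) : μHE[3] (range fun x : EucSp 2 =>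
      (WithLp.toLp 2 (p₀, x) : WithLp 2 (Sph2 × EucSp 2))) = 0 := by
    refine euclideanHausdorffMeasure_image_eq_zero_of_lipschitz (K := 1) ?_ (by simp)
    refine LipschitzWith.of_dist_le_mul fun x y => (abs_le_of_sq_le_sq' ?_ (by positivity)).2
    rw [WithLp.prod_dist_sq, NNReal.coe_one, one_mul]
    change dist p₀ p₀ ^ 2 + dist x y ^ 2 ≤ _
    simp
  refine measure_mono_null (fun p hp => ?_) (measure_union_null (h1 (sphPt 0 0)) (h1 (sphPt π 0)))
  obtain ⟨φ, -, ψ, -, h⟩ := exists_polarMap_eq p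
  have hp0 : colat p = 0 ∨ colat p = π := by
    by_contra! hh
    have := sin_pos_of_mem_Ioo ⟨lt_of_le_of_ne (colat_mem p).1 hh.1.symm,
      lt_of_le_of_ne (colat_mem p).2 hh.2⟩
    exact this.ne' hp
  have h2 : sphPt (colat p) φ = sphPt (colat p) 0 := by
    rw [← dist_eq_zero, ← pow_eq_zero_iff two_ne_zero, dist_sphPt_sq, sub_self,
      show sin (colat p) = 0 from hp]
    simp
  have h3 : WithLp.toLp 2 (sphPt (colat p) 0, planePt ‖p.snd‖ ψ) = p := by
    rw [← h2]; exact h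
  rcases hp0 with h0 | h0
  · exact Or.inl ⟨_, by rw [h0] at h3; exact h3⟩
  · exact Or.inr ⟨_, by rw [h0] at h3; exact h3⟩

theorem euclideanHausdorffMeasure_setOf_snd_eq_zero :
    μHE[3] {p : WithLp 2 (Sph2 × EucSp 2) | ‖p.snd‖ = 0} = 0 := by
  have h1 : μHE[3] (range fun q : ℝ × ℝ =>
      (WithLp.toLp 2 (sphPt q.1 q.2, 0) : WithLp 2 (Sph2 × EucSp 2))) = 0 := by
    refine euclideanHausdorffMeasure_image_eq_zero_of_lipschitz (K := 2) ?_ (by simp)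
    refine LipschitzWith.of_dist_le_mul fun x y => (abs_le_of_sq_le_sq' ?_ (by positivity)).2
    rw [WithLp.prod_dist_sq]
    change dist (sphPt x.1 x.2) (sphPt y.1 y.2) ^ 2 + dist (0 : EucSp 2) 0 ^ 2 ≤ _
    rw [dist_self, dist_sphPt_sq, mul_pow]
    have j2 : sin x.1 * sin y.1 * (4 * sin ((x.2 - y.2) / 2) ^ 2) ≤
        1 * (x.2 - y.2) ^ 2 := by
      refine mul_le_mul ?_ (four_sin_half_sq_le _) (by positivity) zero_le_one
      nlinarith [sq_nonneg (sin x.1 - sin y.1), sin_sq_le_one x.1, sin_sq_le_one y.1]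
    have j1 := four_sin_half_sq_le (x.1 - y.1)
    have k1 : (x.1 - y.1) ^ 2 ≤ dist x y ^ 2 :=
      sq_le_sq' (neg_le_of_abs_le (le_max_left _ _)) (le_of_abs_le (le_max_left _ _))
    have k2 : (x.2 - y.2) ^ 2 ≤ dist x y ^ 2 :=
      sq_le_sq' (neg_le_of_abs_le (le_max_right _ _)) (le_of_abs_le (le_max_right _ _))
    push_cast
    nlinarith [sq_nonneg (dist x y)]
  refine measure_mono_null (fun p hp => ?_) h1
  obtain ⟨φ, -, h⟩ := exists_sphPt_eq p.fst
  refine ⟨(arccos (p.fst.1 2), φ), ?_⟩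
  change WithLp.toLp 2 (sphPt (arccos (p.fst.1 2)) φ, 0) = p
  rw [h, ← norm_eq_zero.1 hp]
  rfl

theorem euclideanHausdorffMeasure_profileGap_eq_zero_le {U : ℝ → ℝ} (hU : LipschitzWith 1 U) :
    μHE[3] {p | profileGap U 1 p = 0} ≤
      ∫⁻ s, ENNReal.ofReal (polarWeight (U s + s) (U s) * curveSpeed U s) := by
  refine le_trans ?_ (euclideanHausdorffMeasure_curveMap_le hU)
  have hnull := measure_union_null euclideanHausdorffMeasure_setOf_sin_colat_eq_zero
    euclideanHausdorffMeasure_setOf_snd_eq_zero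
  refine (measure_mono fun p hp => ?_).trans ((measure_union_le _ _).trans_eq
    ((congrArg (· + _) hnull).trans (zero_add _)))
  by_cases h1 : sin (colat p) = 0
  · exact Or.inl (Or.inl h1)
  by_cases h2 : ‖p.snd‖ = 0
  · exact Or.inl (Or.inr h2)
  refine Or.inr ?_
  obtain ⟨φ, hφ, ψ, hψ, h⟩ := exists_polarMap_eq p
  have hU1 : U (colat p - ‖p.snd‖) = ‖p.snd‖ := by
    have : U (colat p - ‖p.snd‖ / 1) - ‖p.snd‖ / 1 = 0 := hp
    rw [div_one] at this
    linarith
  have hmem := colat_mem p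
  refine ⟨(colat p - ‖p.snd‖, φ, ψ), ⟨⟨?_, ?_⟩, hφ, hψ⟩, ?_⟩
  · rw [hU1, add_sub_cancel]
    refine ⟨lt_of_le_of_ne hmem.1 fun h0 => h1 ?_, lt_of_le_of_ne hmem.2 fun h0 => h1 ?_⟩
    · rw [← h0, sin_zero]
    · rw [h0, sin_pi]
  · rw [hU1]
    exact lt_of_le_of_ne (norm_nonneg _) (Ne.symm h2)
  · unfold curveMap
    simp only [hU1, add_sub_cancel]
    exact h

theorem exists_eq_of_pow_mul_le {V : ℝ → ℝ≥0∞} (n : ℕ) (hmono : ∀ a b, 0 < a → a ≤ b → V a ≤ V b)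
    (hs : ∀ a c, 0 < a → 0 < c → c < 1 → ENNReal.ofReal (c ^ n) * V a ≤ V (c * a)) {v : ℝ≥0∞}
    {a₀ a₁ : ℝ} (ha₀ : 0 < a₀) (h₀ : V a₀ < v) (ha₁ : 0 < a₁) (h₁ : v ≤ V a₁) :
    ∃ a, 0 < a ∧ a ≤ a₁ ∧ V a = v := by
  set S := {a | 0 < a ∧ v ≤ V a}
  have hlb : ∀ a ∈ S, a₀ ≤ a := fun a ha => by
    by_contra! h
    exact ((ha.2.trans (hmono a a₀ ha.1 h.le)).trans_lt h₀).false
  have hbdd : BddBelow S := ⟨a₀, hlb⟩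
  have hpos : 0 < sInf S := ha₀.trans_le (le_csInf ⟨a₁, ha₁, h₁⟩ hlb)
  refine ⟨sInf S, hpos, csInf_le hbdd ⟨ha₁, h₁⟩, le_antisymm ?_ ?_⟩
  · refine le_of_forall_ofReal_pow_mul_le n fun c hc0 hc1 => (hs _ c hpos hc0 hc1).trans ?_
    by_contra! h
    have := csInf_le hbdd (show c * sInf S ∈ S from ⟨mul_pos hc0 hpos, h.le⟩)
    nlinarith
  · refine le_of_forall_ofReal_pow_mul_le n fun c hc0 hc1 => ?_
    have hlt : sInf S < sInf S / c := by rw [lt_div_iff₀ hc0]; nlinarith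
    obtain ⟨a, ha, hac⟩ := exists_lt_of_csInf_lt (s := S) ⟨a₁, ha₁, h₁⟩ hlt
    have h2 : v ≤ V (sInf S / c) := ha.2.trans (hmono _ _ ha.1 hac.le)
    have h3 := hs (sInf S / c) c (by positivity) hc0 hc1
    rw [mul_div_cancel₀ _ hc0.ne'] at h3
    exact (mul_le_mul' le_rfl h2).trans h3

end

section

open Set Filter Topology

theorem lintegral_polar_coords {g : ℝ × ℝ → ℝ≥0∞} (hg : Measurable g) :
    ∫⁻ q : (ℝ × ℝ) × (ℝ × ℝ), (Ioo (-π) π).indicator 1 q.1.2 *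
      (g (q.1.1, q.2.1) * (Ioo (-π) π).indicator 1 q.2.2) =
      ENNReal.ofReal (4 * π ^ 2) * ∫⁻ q, g q := by
  have hpi := Real.pi_pos
  have hI : ∫⁻ x : ℝ, (Ioo (-π) π).indicator (1 : ℝ → ℝ≥0∞) x = ENNReal.ofReal (2 * π) := by
    rw [lintegral_indicator_one measurableSet_Ioo, Real.volume_Ioo]
    congr 1; ring
  have hIm : Measurable ((Ioo (-π) π).indicator (1 : ℝ → ℝ≥0∞)) :=
    measurable_one.indicator measurableSet_Ioo
  rw [Measure.volume_eq_prod (ℝ × ℝ) (ℝ × ℝ), lintegral_prod _ (Measurable.aemeasurable (by fun_prop))]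
  have h1 (z : ℝ × ℝ) : ∫⁻ y : ℝ × ℝ, (Ioo (-π) π).indicator 1 z.2 *
      (g (z.1, y.1) * (Ioo (-π) π).indicator 1 y.2) =
      ((∫⁻ ρ, g (z.1, ρ)) * ENNReal.ofReal (2 * π)) * (Ioo (-π) π).indicator 1 z.2 := by
    rw [lintegral_const_mul _ (by fun_prop), mul_comm, Measure.volume_eq_prod ℝ ℝ,
      lintegral_prod_mul (f := fun ρ => g (z.1, ρ)) (Measurable.aemeasurable (by fun_prop))
        hIm.aemeasurable, hI]
  simp only [h1]
  have hGm : Measurable fun θ => ∫⁻ ρ, g (θ, ρ) := hg.lintegral_prod_right'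
  rw [Measure.volume_eq_prod ℝ ℝ, lintegral_prod_mul (f := fun θ => (∫⁻ ρ, g (θ, ρ)) *
    ENNReal.ofReal (2 * π)) (Measurable.aemeasurable (by fun_prop)) hIm.aemeasurable, hI,
    lintegral_mul_const _ hGm, lintegral_prod _ hg.aemeasurable, mul_assoc,
    ← ENNReal.ofReal_mul (by positivity), mul_comm]
  congr 2; ring

theorem lintegral_le_euclideanHausdorffMeasure_profileGap {U : ℝ → ℝ} {D : Set (ℝ × ℝ)}
    (hDm : MeasurableSet D) (hD : D ⊆ Ioo 0 π ×ˢ Ioi 0) (hDU : ∀ q ∈ D, q.2 ≤ U (q.1 - q.2))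
    {μ : ℝ} (hμ : 0 < μ) :
    ENNReal.ofReal (μ ^ 2) * ∫⁻ q in D, ENNReal.ofReal (polarWeight q.1 q.2) ≤
      μHE[4] {p | 0 ≤ profileGap U μ p} := by
  have hpi := Real.pi_pos
  set T : ℝ × ℝ → ℝ × ℝ := fun q => (q.1, q.2 / μ)
  have hTm : Measurable T := by fun_prop
  set Ω : Set ((ℝ × ℝ) × (ℝ × ℝ)) :=
    {q | T (q.1.1, q.2.1) ∈ D ∧ q.1.2 ∈ Ioo (-π) π ∧ q.2.2 ∈ Ioo (-π) π} with hΩdef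
  have hΩm : MeasurableSet Ω :=
    ((hTm.comp (by fun_prop : Measurable fun q : (ℝ × ℝ) × (ℝ × ℝ) => (q.1.1, q.2.1))) hDm).inter
      (((by fun_prop : Measurable fun q : (ℝ × ℝ) × (ℝ × ℝ) => q.1.2) measurableSet_Ioo).inter
      ((by fun_prop : Measurable fun q : (ℝ × ℝ) × (ℝ × ℝ) => q.2.2) measurableSet_Ioo))
  have hpos : ∀ q ∈ Ω, 0 < q.2.1 := fun q hq => by
    have := (hD hq.1).2
    exact (div_pos_iff_of_pos_right hμ).1 this
  have hΩ : Ω ⊆ (Ioo 0 π ×ˢ Ioo (-π) π) ×ˢ (Ioi 0 ×ˢ Ioo (-π) π) := fun q hq =>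
    ⟨⟨(hD hq.1).1, hq.2.1⟩, hpos q hq, hq.2.2⟩
  refine le_trans ?_ ((lintegral_le_euclideanHausdorffMeasure_polarMap_image hΩm hΩ).trans
    (measure_mono ?_))
  · set g : ℝ × ℝ → ℝ≥0∞ := (T ⁻¹' D).indicator fun q => ENNReal.ofReal (sin q.1 * q.2) with hg
    have hgm : Measurable g := Measurable.indicator (by fun_prop) (hTm hDm)
    have h1 : ∫⁻ q in Ω, ENNReal.ofReal (sin q.1.1 * q.2.1) =
        ENNReal.ofReal (4 * π ^ 2) * ∫⁻ q, g q := by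
      rw [← lintegral_polar_coords hgm, ← lintegral_indicator hΩm]
      refine lintegral_congr fun q => ?_
      by_cases h1 : T (q.1.1, q.2.1) ∈ D <;> by_cases h2 : q.1.2 ∈ Ioo (-π) π <;>
        by_cases h3 : q.2.2 ∈ Ioo (-π) π <;>
        simp [hΩdef, hg, indicator, h1, h2, h3, -mem_Ioo]
    have h2 : ∫⁻ q, g q = ENNReal.ofReal μ * ∫⁻ q : ℝ × ℝ, g (q.1, μ * q.2) := by
      have hmp : MeasurePreserving (fun q : ℝ × ℝ => (q.1, μ * q.2))
          ((volume : Measure ℝ).prod (ENNReal.ofReal μ • volume)) (volume.prod volume) :=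
        (MeasurePreserving.id volume).prod (measurePreserving_const_mul hμ)
      rw [Measure.volume_eq_prod ℝ ℝ, ← hmp.lintegral_comp hgm, Measure.prod_smul_right,
        lintegral_smul_measure, smul_eq_mul]
    rw [h1, h2, ← mul_assoc, ← ENNReal.ofReal_mul (by positivity), ← lintegral_indicator hDm,
      ← lintegral_const_mul _ (Measurable.indicator
        continuous_polarWeight.measurable.ennreal_ofReal hDm),
      ← lintegral_const_mul _ (by fun_prop)]
    refine lintegral_mono fun q => ?_
    by_cases hq : q ∈ D
    · have hq' : (q.1, μ * q.2) ∈ T ⁻¹' D := by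
        change (q.1, μ * q.2 / μ) ∈ D
        rwa [mul_div_cancel_left₀ _ hμ.ne']
      obtain ⟨h3, h4⟩ := hD hq
      rw [indicator_of_mem hq, hg, indicator_of_mem hq', ← ENNReal.ofReal_mul (by positivity),
        ← ENNReal.ofReal_mul (by positivity), polarWeight, clampSin_of_mem ⟨h3.1.le, h3.2.le⟩,
        max_eq_left (show 0 ≤ q.2 from h4.le)]
      exact ENNReal.ofReal_le_ofReal (le_of_eq (by ring))
    · rw [indicator_of_notMem hq, mul_zero]
      exact zero_le
  · rintro _ ⟨q, hq, rfl⟩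
    have h3 := (hD hq.1).1
    have h4 := hDU _ hq.1
    change 0 ≤ U _ - _
    rw [colat_polarMap ⟨h3.1.le, h3.2.le⟩, norm_snd_polarMap (hpos q hq).le]
    exact sub_nonneg.2 h4

theorem hausFactor_mul_isoProfile_sphere_le_of_profile {U : ℝ → ℝ} (ha : Antitone U)
    (hm : Monotone fun s => U s + s) {R : ℝ} (hR : 0 < R) (hUR : ∀ s, U s ≤ R) {v : ℝ≥0∞}
    (hv0 : v ≠ 0) {μ : ℝ} (hμ : 1 ≤ μ)
    (hvol : hausFactor 4 * v ≤ μHE[4] {p | 0 ≤ profileGap U μ p}) :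
    hausFactor 3 * isoProfile (WithLp 2 (Sph2 × EucSp 2)) 4 v ≤
      ENNReal.ofReal (μ ^ 3) *
        ∫⁻ s, ENNReal.ofReal (polarWeight (U s + s) (U s) * curveSpeed U s) := by
  have hU := lipschitzWith_of_antitone_of_monotone_add ha hm
  set A := ∫⁻ s, ENNReal.ofReal (polarWeight (U s + s) (U s) * curveSpeed U s)
  by_cases hA : A = ∞
  · rw [hA, ENNReal.mul_top]
    · exact le_top
    · exact (ENNReal.ofReal_pos.2 (by positivity)).ne'
  have hmono : ∀ a b, 0 < a → a ≤ b → μHE[4] {p | 0 ≤ profileGap U a p} ≤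
      μHE[4] {p | 0 ≤ profileGap U b p} := by
    refine fun a b ha0 hab => measure_mono fun p hp => ?_
    have h1 : ‖p.snd‖ / b ≤ ‖p.snd‖ / a := by gcongr
    have h2 := hm (show colat p - ‖p.snd‖ / a ≤ colat p - ‖p.snd‖ / b by linarith)
    have h3 : 0 ≤ U (colat p - ‖p.snd‖ / a) - ‖p.snd‖ / a := hp
    change 0 ≤ U (colat p - ‖p.snd‖ / b) - ‖p.snd‖ / b
    simp only at h2
    linarith
  have hs : ∀ a c, 0 < a → 0 < c → c < 1 → ENNReal.ofReal (c ^ 4) *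
      μHE[4] {p | 0 ≤ profileGap U a p} ≤ μHE[4] {p | 0 ≤ profileGap U (c * a) p} := by
    intro a c ha0 hc0 hc1
    have h1 : (1 : ℝ) ≤ c⁻¹ := (one_le_inv₀ hc0).2 hc1.le
    have h2 := euclideanHausdorffMeasure_dilate_image_le (inv_pos.2 hc0).le le_rfl h1
      {p | 0 ≤ profileGap U (c * a) p} 4
    rw [← profileGap_setOf_eq_image U (inv_pos.2 hc0) (fun x => 0 ≤ x),
      inv_mul_cancel_left₀ hc0.ne'] at h2
    refine (mul_le_mul' le_rfl h2).trans_eq ?_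
    rw [← mul_assoc, ← ENNReal.ofReal_mul (by positivity), ← mul_pow, mul_inv_cancel₀ hc0.ne',
      one_pow, ENNReal.ofReal_one, one_mul]
  have hk4 : (hausFactor 4 : ℝ≥0∞) ≠ 0 := ENNReal.coe_ne_zero.2 (hausFactor_ne_zero 4)
  obtain ⟨a₀, ha₀, hsmall⟩ : ∃ a₀, 0 < a₀ ∧
      μHE[4] {p | 0 ≤ profileGap U a₀ p} < hausFactor 4 * v := by
    have hpi := Real.pi_pos
    have hlim : Tendsto (fun a : ℝ => ENNReal.ofReal ((a * R) * (π * (π - -π) *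
        ((a * R) * (π - -π))))) (𝓝[>] 0) (𝓝 0) := by
      have hc : Continuous fun a : ℝ => ENNReal.ofReal ((a * R) * (π * (π - -π) *
        ((a * R) * (π - -π)))) := ENNReal.continuous_ofReal.comp (by fun_prop)
      have := hc.tendsto 0
      simp only [zero_mul, ENNReal.ofReal_zero] at this
      exact this.mono_left nhdsWithin_le_nhds
    obtain ⟨a, h1, h2⟩ := ((hlim.eventually (gt_mem_nhds
      (pos_iff_ne_zero.2 (mul_ne_zero hk4 hv0)))).and self_mem_nhdsWithin).exists
    have ha0 : 0 < a := h2
    refine ⟨a, ha0, lt_of_le_of_lt ?_ h1⟩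
    refine (measure_mono fun p hp => ?_).trans
      (euclideanHausdorffMeasure_setOf_norm_snd_le (mul_pos ha0 hR))
    have h3 : 0 ≤ U (colat p - ‖p.snd‖ / a) - ‖p.snd‖ / a := hp
    have h4 : ‖p.snd‖ / a ≤ R := (sub_nonneg.1 h3).trans (hUR _)
    rw [div_le_iff₀ ha0] at h4
    change ‖p.snd‖ ≤ a * R
    linarith
  obtain ⟨a, ha0, haμ, hVa⟩ := exists_eq_of_pow_mul_le 4 hmono hs ha₀ hsmall
    (zero_lt_one.trans_le hμ) hvol
  set G := profileGap U a
  have hGc : Continuous G := continuous_profileGap hU.continuous a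
  have hZ : μHE[3] {p | G p = 0} ≤ ENNReal.ofReal (μ ^ 3) * A := by
    have h1 := euclideanHausdorffMeasure_dilate_image_le ha0.le haμ hμ
      {p | profileGap U 1 p = 0} 3
    rw [← profileGap_setOf_eq_image U ha0 (fun x => x = 0), mul_one] at h1
    exact h1.trans (mul_le_mul' le_rfl (euclideanHausdorffMeasure_profileGap_eq_zero_le hU))
  have hZ0 : μHE[4] {p | G p = 0} = 0 := by
    have h1 : μHE[3] {p | G p = 0} ≠ ∞ :=
      (hZ.trans_lt (ENNReal.mul_lt_top ENNReal.ofReal_lt_top (lt_top_iff_ne_top.2 hA))).ne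
    rcases Measure.euclideanHausdorffMeasure_zero_or_top (show 3 < 4 by norm_num)
      {p | G p = 0} with h | h
    · exact h
    · exact absurd h h1
  have hcl : closure {p | 0 < G p} ⊆ {p | 0 ≤ G p} :=
    closure_minimal (fun p (hp : 0 < G p) => (hp.le : 0 ≤ G p)) (isClosed_le continuous_const hGc)
  have hvolcl : μHE[4] (closure {p | 0 < G p}) = hausFactor 4 * v := by
    refine le_antisymm ((measure_mono hcl).trans_eq hVa) (hVa.symm.le.trans ?_)
    refine (measure_mono fun p hp => ?_).trans ((measure_union_le _ _).trans_eq
      ((congrArg (· + _) hZ0).trans (zero_add _)))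
    rcases (show 0 ≤ G p from hp).eq_or_lt with h | h
    · exact Or.inl h.symm
    · exact Or.inr (subset_closure h)
  have hregion : IsClosedRegion (closure {p | 0 < G p}) ∧
      haus (WithLp 2 (Sph2 × EucSp 2)) 4 (closure {p | 0 < G p}) = v := by
    refine ⟨⟨_, isOpen_lt continuous_const hGc, rfl⟩, ?_⟩
    rw [euclideanHausdorffMeasure_eq_mul] at hvolcl
    exact (ENNReal.mul_right_inj hk4 ENNReal.coe_ne_top).1 hvolcl
  calc _ ≤ hausFactor 3 * haus (WithLp 2 (Sph2 × EucSp 2)) 3 (frontier (closure {p | 0 < G p})) :=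
        mul_le_mul' le_rfl (iInf₂_le (closure {p | 0 < G p}) hregion)
    _ = μHE[3] (frontier (closure {p | 0 < G p})) := (euclideanHausdorffMeasure_eq_mul 3 _).symm
    _ ≤ μHE[3] {p | G p = 0} := by
        refine measure_mono fun p hp => ?_
        have h1 : 0 ≤ G p := hcl (isClosed_closure.frontier_subset hp)
        refine le_antisymm (not_lt.1 fun h => ?_) h1
        exact hp.2 (interior_maximal subset_closure (isOpen_lt continuous_const hGc) h)
    _ ≤ _ := hZ

/-- A periodic body of `ℝ² × ℝ²` produces a competitor for the profile of `S² × ℝ²`. -/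
theorem PerBody.hausFactor_mul_isoProfile_sphere_le {L : ℝ} {K : Set ((ℝ × ℝ) × (ℝ × ℝ))}
    (h : PerBody L K) (hL : 0 < L) (hLpi : L ^ 2 = 4 * π) {v : ℝ≥0∞} (hv0 : v ≠ 0)
    {μ : ℝ} (hμ : 1 ≤ μ) (hvol : hausFactor 4 * v ≤ ENNReal.ofReal (μ ^ 2) * bodyVol L K)
    {ε : ℕ → ℝ} (hε : Tendsto ε atTop (𝓝[>] 0)) :
    hausFactor 3 * isoProfile (WithLp 2 (Sph2 × EucSp 2)) 4 v ≤ ENNReal.ofReal (μ ^ 3) *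
      liminf (fun n => bodyVol L (_root_.bodyNhd (ε n) K \ K) / ENNReal.ofReal (ε n)) atTop := by
  have hk4 : (hausFactor 4 : ℝ≥0∞) ≠ 0 := ENNReal.coe_ne_zero.2 (hausFactor_ne_zero 4)
  have h_int := h.bodyVol_eq_setLIntegral hL hLpi
  have hne : (polarDom L K).Nonempty := by
    rw [nonempty_iff_ne_empty]
    intro h0
    rw [h_int, h0, setLIntegral_empty, mul_zero] at hvol
    exact mul_ne_zero hk4 hv0 (le_zero_iff.1 hvol)
  obtain ⟨R, hR0, hR⟩ := h.bdd
  have hR' := fun q hq => h.snd_le_of_mem_polarDom hR0 hR (q := q) hq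
  refine (hausFactor_mul_isoProfile_sphere_le_of_profile (antitone_profileFun hne hR')
    (monotone_profileFun_add hne hR') (R := R + 1) (by linarith)
    (fun s => (profileFun_le hne hR' s).trans (by linarith)) hv0 hμ (hvol.trans ?_)).trans
    (mul_le_mul' le_rfl (h.lintegral_profile_le hL hLpi hne hε))
  rw [h_int]
  exact lintegral_le_euclideanHausdorffMeasure_profileGap h.measurableSet_polarDom
    (fun q hq => ⟨hq.1, hq.2.1⟩) (fun q hq => snd_le_profileFun hR' hq) (by linarith)

end

section

open Set Module RealInnerProductSpace

theorem isCompact_segment_meets {E : Type*} [NormedAddCommGroup E] [NormedSpace ℝ E] {S : Set E} (hS : IsCompact S) (h : E) :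
    IsCompact {w | ∃ τ ∈ Icc (0 : ℝ) 1, w + τ • h ∈ S} := by
  have : {w | ∃ τ ∈ Icc (0 : ℝ) 1, w + τ • h ∈ S} =
      (fun q : ℝ × E => q.2 - q.1 • h) '' (Icc 0 1 ×ˢ S) := by
    ext w
    constructor
    · rintro ⟨τ, hτ, hw⟩
      exact ⟨(τ, w + τ • h), ⟨hτ, hw⟩, by simp⟩
    · rintro ⟨⟨τ, w'⟩, ⟨hτ, hw⟩, rfl⟩
      exact ⟨τ, hτ, by simpa using hw⟩
  rw [this]
  exact (isCompact_Icc.prod hS).image (by fun_prop)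

variable {E : Type*} [NormedAddCommGroup E] [InnerProductSpace ℝ E] [FiniteDimensional ℝ E]
  [MeasurableSpace E] [BorelSpace E]

/-- The set of starting points of translates of a segment that meet a compact set `S` is bounded
in volume by the length of the segment times the hypersurface area of `S`. -/
theorem volume_segment_meets_le {S : Set E} (hS : IsCompact S) {h : E} (hh : h ≠ 0) :
    volume {w | ∃ τ ∈ Icc (0 : ℝ) 1, w + τ • h ∈ S} ≤ ‖h‖ₑ * μHE[finrank ℝ E - 1] S := by
  set n := finrank ℝ E - 1
  by_cases hfin : μHE[n] S = ∞
  · rw [hfin, ENNReal.mul_top (by simpa using hh)]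
    exact le_top
  set D := {w | ∃ τ ∈ Icc (0 : ℝ) 1, w + τ • h ∈ S}
  set φ : E → ℝ := fun w => ⟪h, w⟫ / ‖h‖ ^ 2 with hφ
  have hn : 0 < ‖h‖ ^ 2 := by positivity
  have hφc : Continuous φ := by fun_prop
  have hφh : φ h = 1 := by rw [hφ]; simp only [real_inner_self_eq_norm_sq]; exact div_self hn.ne'
  have hφadd : ∀ a b, φ (a + b) = φ a + φ b := fun a b => by
    simp only [hφ, inner_add_right, add_div]
  have hφsmul : ∀ (t : ℝ) b, φ (t • b) = t * φ b := fun a b => by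
    simp only [hφ, inner_smul_right, mul_div_assoc]
  rw [← InnerProductSpace.euclideanHausdorffMeasure_eq_volume,
    EuclideanGeometry.euclideanHausdorffMeasure_eq_lintegral (0 : E) hh
      (isCompact_segment_meets hS h).measurableSet]
  gcongr
  have hslice : ∀ x : ℝ, μHE[n] (D ∩ AffineSubspace.mk' (x • h +ᵥ (0 : E)) (ℝ ∙ h)ᗮ) ≤
      μHE[n] (S ∩ φ ⁻¹' Icc x (x + 1)) := by
    intro x
    set P : E → E := fun w => w - (φ w - x) • h
    have hP : LipschitzWith 1 P := by
      refine LipschitzWith.of_dist_le_mul fun a b => ?_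
      rw [NNReal.coe_one, one_mul, dist_eq_norm, dist_eq_norm]
      have e : P a - P b = (a - b) - φ (a - b) • h := by
        have : φ (a - b) = φ a - φ b := by
          have := hφadd (a - b) b
          rw [sub_add_cancel] at this; linarith
        simp only [P, this, sub_smul]; abel
      rw [e]
      generalize a - b = z
      rw [← sq_le_sq₀ (norm_nonneg _) (norm_nonneg _), norm_sub_sq_real, norm_smul,
        inner_smul_right, real_inner_comm]
      have h1 : ⟪h, z⟫ = φ z * ‖h‖ ^ 2 := by simp only [hφ]; field_simp
      rw [h1, Real.norm_eq_abs, mul_pow, sq_abs]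
      nlinarith [sq_nonneg (φ z * ‖h‖)]
    have hsub : D ∩ AffineSubspace.mk' (x • h +ᵥ (0 : E)) (ℝ ∙ h)ᗮ ⊆
        P '' (S ∩ φ ⁻¹' Icc x (x + 1)) := by
      rintro w ⟨⟨τ, hτ, hw⟩, hw2⟩
      have h1 : φ w = x := by
        have h2 : ⟪h, w - x • h⟫ = 0 := by
          have : w -ᵥ (x • h +ᵥ (0 : E)) ∈ (ℝ ∙ h)ᗮ := hw2
          simpa [Submodule.mem_orthogonal_singleton_iff_inner_right] using this
        rw [inner_sub_right, inner_smul_right, real_inner_self_eq_norm_sq] at h2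
        simp only [hφ]
        rw [div_eq_iff hn.ne']; linarith
      have h3 : φ (w + τ • h) = x + τ := by rw [hφadd, hφsmul, h1, hφh, mul_one]
      refine ⟨w + τ • h, ⟨hw, ?_⟩, ?_⟩
      · rw [mem_preimage, h3]; exact ⟨by linarith [hτ.1], by linarith [hτ.2]⟩
      · simp only [P, h3]; rw [add_sub_cancel_left]; abel
    refine (measure_mono hsub).trans ?_
    have := (hP.lipschitzOnWith (s := S ∩ φ ⁻¹' Icc x (x + 1))).euclideanHausdorffMeasure_image_le n
    simpa using this
  refine (lintegral_mono hslice).trans ?_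
  set ν := (μHE[n] : Measure E).restrict S
  have : IsFiniteMeasure ν := ⟨by simpa [ν] using lt_top_iff_ne_top.2 hfin⟩
  have hm : MeasurableSet {q : ℝ × E | φ q.2 ∈ Icc q.1 (q.1 + 1)} :=
    ((isClosed_le continuous_fst (hφc.comp continuous_snd)).inter
      (isClosed_le (hφc.comp continuous_snd) (continuous_fst.add continuous_const))).measurableSet
  have e1 : ∀ x : ℝ, μHE[n] (S ∩ φ ⁻¹' Icc x (x + 1)) =
      ν (Prod.mk x ⁻¹' {q : ℝ × E | φ q.2 ∈ Icc q.1 (q.1 + 1)}) := fun x => by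
    rw [Measure.restrict_apply (hm.preimage (by fun_prop)), inter_comm]
    rfl
  simp only [e1]
  rw [← Measure.prod_apply hm, Measure.prod_apply_symm hm]
  have e2 : ∀ w : E, (volume : Measure ℝ)
      ((fun x => (x, w)) ⁻¹' {q : ℝ × E | φ q.2 ∈ Icc q.1 (q.1 + 1)}) = 1 := fun w => by
    have : ((fun x => (x, w)) ⁻¹' {q : ℝ × E | φ q.2 ∈ Icc q.1 (q.1 + 1)}) =
        Icc (φ w - 1) (φ w) := by
      ext x
      simp only [mem_preimage, mem_ofPred_eq, mem_Icc]
      constructor <;> rintro ⟨h1, h2⟩ <;> constructor <;> linarith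
    rw [this]; simp
  simp only [e2]
  simp [ν]

theorem IsPreconnected.inter_frontier_nonempty {X : Type*} [TopologicalSpace X] {s U : Set X}
    (hs : IsPreconnected s) (h1 : (s ∩ U).Nonempty) (h2 : (s ∩ Uᶜ).Nonempty) :
    (s ∩ frontier U).Nonempty := by
  by_contra hne
  rw [not_nonempty_iff_eq_empty, ← disjoint_iff_inter_eq_empty, disjoint_left] at hne
  obtain ⟨a, ha, haU⟩ := h1
  obtain ⟨b, hb, hbU⟩ := h2
  obtain ⟨c, -, h3, h4⟩ := hs (interior U) (closure U)ᶜ isOpen_interior isClosed_closure.isOpen_compl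
    (fun x hx => by
      by_contra h
      rw [mem_union, not_or, notMem_compl_iff] at h
      exact hne hx ⟨h.2, h.1⟩)
    ⟨a, ha, by_contra fun h => hne ha ⟨subset_closure haU, h⟩⟩
    ⟨b, hb, fun h => hne hb ⟨h, fun h' => hbU (interior_subset h')⟩⟩
  exact h4 (subset_closure (interior_subset h3))

/-- The local volume function of a closed set changes at a rate controlled by the boundary. -/
theorem volume_inter_closedBall_add_le (U : Set E) (y h : E) {r : ℝ} :
    volume (U ∩ Metric.closedBall (y + h) r) ≤ volume (U ∩ Metric.closedBall y r) +
      ‖h‖ₑ * μHE[finrank ℝ E - 1] (frontier U ∩ Metric.closedBall y (r + ‖h‖)) := by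
  rcases eq_or_ne h 0 with rfl | hh
  · simp
  have hS : IsCompact (frontier U ∩ Metric.closedBall y (r + ‖h‖)) :=
    (isCompact_closedBall y _).inter_left isClosed_frontier
  refine le_trans ?_ (add_le_add le_rfl (volume_segment_meets_le hS hh))
  rw [← measure_preimage_add_right volume h (U ∩ Metric.closedBall (y + h) r)]
  refine (measure_mono fun w hw => ?_).trans (measure_union_le _ _)
  have hwb : w ∈ Metric.closedBall y r := by simpa using hw.2
  by_cases hwU : w ∈ U
  · exact Or.inl ⟨hwU, hwb⟩
  · right
    have hpre : IsPreconnected ((fun τ : ℝ => w + τ • h) '' Icc 0 1) :=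
      isPreconnected_Icc.image _ (by fun_prop)
    obtain ⟨_, ⟨τ, hτ, rfl⟩, hf⟩ := hpre.inter_frontier_nonempty
      (U := U) ⟨w + h, ⟨1, by simp, by simp⟩, hw.1⟩ ⟨w, ⟨0, by simp, by simp⟩, hwU⟩
    refine ⟨τ, hτ, hf, ?_⟩
    rw [Metric.mem_closedBall, dist_eq_norm] at hwb ⊢
    calc ‖w + τ • h - y‖ = ‖(w - y) + τ • h‖ := by congr 1; abel
      _ ≤ ‖w - y‖ + ‖τ • h‖ := norm_add_le _ _
      _ ≤ r + ‖h‖ := by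
        gcongr
        rw [norm_smul, Real.norm_of_nonneg hτ.1]
        exact mul_le_of_le_one_left (norm_nonneg _) hτ.2

end

section

open Set Module Filter Topology Metric Pointwise

variable {E : Type*} [NormedAddCommGroup E] [InnerProductSpace ℝ E] [FiniteDimensional ℝ E]
  [MeasurableSpace E] [BorelSpace E] {Γ : AddSubgroup E} {F : Set E}

theorem euclideanHausdorffMeasure_inter_closedBall_eq_tsum [Countable Γ] (hF : MeasurableSet F)
    (hΓ : ∀ x, ∃! g : Γ, g +ᵥ x ∈ F) {S : Set E} (hS : ∀ (g : Γ) x, g +ᵥ x ∈ S ↔ x ∈ S) (d : ℕ)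
    (y : E) (R : ℝ) : μHE[d] (S ∩ closedBall y R) =
      ∑' g : Γ, (μHE[d]).restrict (S ∩ F) (closedBall (g +ᵥ y) R) := by
  have hfd : IsAddFundamentalDomain Γ F (μHE[d] : Measure E) :=
    IsAddFundamentalDomain.mk' hF.nullMeasurableSet hΓ
  rw [hfd.measure_eq_tsum]
  refine tsum_congr fun g => ?_
  rw [Measure.restrict_apply isClosed_closedBall.measurableSet]
  congr 1
  ext x
  have hd : dist (-g +ᵥ x) y = dist x (g +ᵥ y) := by
    rw [AddSubgroup.vadd_def, AddSubgroup.vadd_def, vadd_eq_add, vadd_eq_add, dist_eq_norm,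
      dist_eq_norm, NegMemClass.coe_neg]
    congr 1; abel
  rw [mem_inter_iff, mem_vadd_set_iff_neg_vadd_mem, mem_inter_iff, hS, mem_inter_iff,
    mem_inter_iff, mem_closedBall, mem_closedBall, hd]
  tauto

theorem measurable_measure_closedBall (ν : Measure E) [SFinite ν] (R : ℝ) :
    Measurable fun y => ν (closedBall y R) := by
  have hm : MeasurableSet {q : E × E | dist q.2 q.1 ≤ R} :=
    (isClosed_le (continuous_snd.dist continuous_fst) continuous_const).measurableSet
  exact measurable_measure_prodMk_left hm

theorem isFiniteMeasure_restrict {X : Type*} [MeasurableSpace X] {μ : Measure X} {s : Set X}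
    (h : μ s ≠ ∞) : IsFiniteMeasure (μ.restrict s) :=
  ⟨by simpa using lt_top_iff_ne_top.2 h⟩

theorem measurable_euclideanHausdorffMeasure_inter_closedBall [Countable Γ] (hF : MeasurableSet F)
    (hΓ : ∀ x, ∃! g : Γ, g +ᵥ x ∈ F) {S : Set E} (hS : ∀ (g : Γ) x, g +ᵥ x ∈ S ↔ x ∈ S) {d : ℕ}
    (hfin : μHE[d] (S ∩ F) ≠ ∞) (R : ℝ) :
    Measurable fun y => μHE[d] (S ∩ closedBall y R) := by
  have := isFiniteMeasure_restrict hfin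
  simp only [euclideanHausdorffMeasure_inter_closedBall_eq_tsum hF hΓ hS]
  exact Measurable.tsum fun g =>
    (measurable_measure_closedBall _ R).comp (measurable_const_vadd g)

theorem lintegral_euclideanHausdorffMeasure_inter_closedBall [Countable Γ] (hF : MeasurableSet F)
    (hΓ : ∀ x, ∃! g : Γ, g +ᵥ x ∈ F) {S : Set E} (hS : ∀ (g : Γ) x, g +ᵥ x ∈ S ↔ x ∈ S) {d : ℕ}
    (hfin : μHE[d] (S ∩ F) ≠ ∞) (R : ℝ) :
    ∫⁻ y in F, μHE[d] (S ∩ closedBall y R) = μHE[d] (S ∩ F) * volume (closedBall (0 : E) R) := by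
  have := isFiniteMeasure_restrict hfin
  have hfd : IsAddFundamentalDomain Γ F (volume : Measure E) :=
    IsAddFundamentalDomain.mk' hF.nullMeasurableSet hΓ
  have hm : MeasurableSet {q : E × E | dist q.2 q.1 ≤ R} :=
    (isClosed_le (continuous_snd.dist continuous_fst) continuous_const).measurableSet
  simp only [euclideanHausdorffMeasure_inter_closedBall_eq_tsum hF hΓ hS]
  set ν := (μHE[d]).restrict (S ∩ F)
  rw [lintegral_tsum (f := fun (g : Γ) y => ν (closedBall (g +ᵥ y) R)) fun g => ((measurable_measure_closedBall ν R).comp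
    (measurable_const_vadd g)).aemeasurable, ← hfd.lintegral_eq_tsum'' fun y => ν (closedBall y R)]
  have e1 : ∀ y, ν (closedBall y R) = ν (Prod.mk y ⁻¹' {q : E × E | dist q.2 q.1 ≤ R}) :=
    fun y => rfl
  simp only [e1]
  rw [← Measure.prod_apply hm, Measure.prod_apply_symm hm]
  have e2 : ∀ w : E, volume ((fun x => (x, w)) ⁻¹' {q : E × E | dist q.2 q.1 ≤ R}) =
      volume (closedBall (0 : E) R) := fun w => by
    rw [← Measure.addHaar_closedBall_center volume w R]
    congr 1
    ext x
    simp [dist_comm]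
  simp only [e2, lintegral_const]
  rw [mul_comm]
  simp [ν]

theorem volume_setOf_lt_ofReal_le_add_le (a c : ℝ≥0∞) :
    volume {t : ℝ | 0 < t ∧ a < ENNReal.ofReal t ∧ ENNReal.ofReal t ≤ a + c} ≤ c := by
  rcases eq_or_ne c ∞ with rfl | hc
  · exact le_top
  rcases eq_or_ne a ∞ with rfl | ha
  · simp
  have hsub : {t : ℝ | 0 < t ∧ a < ENNReal.ofReal t ∧ ENNReal.ofReal t ≤ a + c} ⊆
      Ioc a.toReal (a.toReal + c.toReal) := by
    rintro t ⟨h0, h1, h2⟩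
    rw [← ENNReal.toReal_add ha hc]
    exact ⟨(ENNReal.lt_ofReal_iff_toReal_lt ha).1 h1,
      (ENNReal.ofReal_le_iff_le_toReal (ENNReal.add_ne_top.2 ⟨ha, hc⟩)).1 h2⟩
  exact (measure_mono hsub).trans (by simp [hc])

/-- Superlevel sets of the local volume function have a Minkowski content which is controlled on
average by the area of the boundary. -/
theorem exists_superlevel_minkowski_le [Countable Γ] (hF : MeasurableSet F)
    (hΓ : ∀ x, ∃! g : Γ, g +ᵥ x ∈ F) {U : Set E} (hU : ∀ (g : Γ) x, g +ᵥ x ∈ U ↔ x ∈ U)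
    (hfin : μHE[finrank ℝ E - 1] (frontier U ∩ F) ≠ ∞) {r : ℝ} (hr : 0 < r)
    {ε : ℕ → ℝ} (hε0 : ∀ n, 0 < ε n) (hε : Tendsto ε atTop (𝓝 0)) :
    ∃ t : ℝ, 0 < t ∧ ENNReal.ofReal t ≤ volume (closedBall (0 : E) r) ∧
      liminf (fun n => volume (F ∩
        {y | (∃ y', ENNReal.ofReal t ≤ volume (U ∩ closedBall y' r) ∧ dist y' y ≤ ε n) ∧
          volume (U ∩ closedBall y r) < ENNReal.ofReal t}) / ENNReal.ofReal (ε n)) atTop ≤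
        μHE[finrank ℝ E - 1] (frontier U ∩ F) := by
  set S := frontier U
  set d := finrank ℝ E - 1
  have hS : ∀ (g : Γ) x, g +ᵥ x ∈ S ↔ x ∈ S := by
    intro g x
    have h1 : (fun x => g +ᵥ x) ⁻¹' U = U := by ext x; exact hU g x
    have h2 : (fun x => g +ᵥ x) ⁻¹' S = S := by
      have := (Homeomorph.vadd g (α := E)).preimage_frontier U
      rw [show (Homeomorph.vadd g : E ≃ₜ E) ⁻¹' U = U from h1] at this
      exact this
    exact Set.ext_iff.1 h2 x
  set f : E → ℝ≥0∞ := fun y => volume (U ∩ closedBall y r)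
  have hf : Measurable f := by
    have : f = fun y => (volume.restrict U) (closedBall y r) := by
      ext y
      rw [Measure.restrict_apply isClosed_closedBall.measurableSet, inter_comm]
    rw [this]
    exact measurable_measure_closedBall _ r
  set m : ℝ → E → ℝ≥0∞ := fun R y => μHE[d] (S ∩ closedBall y R)
  have hm : ∀ R, Measurable (m R) := measurable_euclideanHausdorffMeasure_inter_closedBall hF hΓ hS hfin
  set T := (volume (closedBall (0 : E) r)).toReal
  have hTtop : volume (closedBall (0 : E) r) ≠ ∞ := measure_closedBall_lt_top.ne
  have hT : 0 < T := ENNReal.toReal_pos (measure_closedBall_pos _ _ hr).ne' hTtop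
  set Q : ℕ → Set (ℝ × E) := fun n => {q | 0 < q.1 ∧ f q.2 < ENNReal.ofReal q.1 ∧
    ENNReal.ofReal q.1 ≤ f q.2 + ENNReal.ofReal (ε n) * m (r + ε n) q.2} with hQ
  have hQm : ∀ n, MeasurableSet (Q n) := fun n => by
    have h1 := hm (r + ε n)
    exact (measurableSet_lt measurable_const measurable_fst).inter
      ((measurableSet_lt (hf.comp measurable_snd) measurable_fst.ennreal_ofReal).inter
        (measurableSet_le measurable_fst.ennreal_ofReal
          ((hf.comp measurable_snd).add ((h1.comp measurable_snd).const_mul _))))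
  set G : ℕ → ℝ → ℝ≥0∞ := fun n t =>
    (volume.restrict F) (Prod.mk t ⁻¹' Q n) / ENNReal.ofReal (ε n)
  have hGm : ∀ n, Measurable (G n) := fun n =>
    (measurable_measure_prodMk_left (hQm n)).div_const _
  have hε' : ∀ n, ENNReal.ofReal (ε n) ≠ 0 := fun n => (ENNReal.ofReal_pos.2 (hε0 n)).ne'
  have hGint : ∀ n, ∫⁻ t in Ioc 0 T, G n t ≤
      μHE[d] (S ∩ F) * volume (closedBall (0 : E) (r + ε n)) := by
    intro n
    simp only [G, div_eq_mul_inv]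
    rw [lintegral_mul_const _ (measurable_measure_prodMk_left (hQm n)),
      ← lintegral_euclideanHausdorffMeasure_inter_closedBall hF hΓ hS hfin, ← div_eq_mul_inv]
    refine ENNReal.div_le_of_le_mul' ?_
    refine (lintegral_mono' Measure.restrict_le_self le_rfl).trans ?_
    rw [← Measure.prod_apply (hQm n), Measure.prod_apply_symm (hQm n),
      ← lintegral_const_mul _ (hm _)]
    exact lintegral_mono fun y => volume_setOf_lt_ofReal_le_add_le (f y) _
  have hlim : Tendsto (fun n => μHE[d] (S ∩ F) * volume (closedBall (0 : E) (r + ε n))) atTop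
      (𝓝 (μHE[d] (S ∩ F) * volume (closedBall (0 : E) r))) := by
    refine ENNReal.Tendsto.const_mul ?_ (Or.inr hfin)
    have h1 : ∀ n, volume (closedBall (0 : E) (r + ε n)) =
        ENNReal.ofReal ((r + ε n) ^ finrank ℝ E) * volume (ball (0 : E) 1) := fun n =>
      Measure.addHaar_closedBall _ _ (by linarith [hε0 n])
    simp only [h1]
    rw [Measure.addHaar_closedBall _ _ hr.le]
    refine ENNReal.Tendsto.mul_const ?_ (Or.inr measure_ball_lt_top.ne)
    have h2 : Tendsto (fun n => (r + ε n) ^ finrank ℝ E) atTop (𝓝 ((r + 0) ^ finrank ℝ E)) :=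
      (tendsto_const_nhds.add hε).pow _
    rw [add_zero] at h2
    exact ENNReal.tendsto_ofReal h2
  have h_int : ∫⁻ t in Ioc 0 T, liminf (fun n => G n t) atTop ≤
      μHE[d] (S ∩ F) * ENNReal.ofReal T := by
    rw [ENNReal.ofReal_toReal hTtop, ← hlim.liminf_eq]
    exact (lintegral_liminf_le hGm).trans (liminf_le_liminf (Eventually.of_forall hGint))
  have hvolI : volume (Ioc 0 T) = ENNReal.ofReal T := by simp
  have hT' : ENNReal.ofReal T ≠ 0 := (ENNReal.ofReal_pos.2 hT).ne'
  obtain ⟨t, ht, hle⟩ := exists_le_setLAverage (μ := volume) (s := Ioc 0 T)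
    (f := fun t => liminf (fun n => G n t) atTop) (by rwa [hvolI]) (by rw [hvolI]; exact ofReal_ne_top)
    (Measurable.liminf hGm).aemeasurable
  refine ⟨t, ht.1, (ENNReal.ofReal_le_iff_le_toReal hTtop).2 ht.2, ?_⟩
  refine le_trans (liminf_le_liminf (Eventually.of_forall fun n => ?_)) (hle.trans ?_)
  · refine ENNReal.div_le_div_right ?_ _
    rw [Measure.restrict_apply ((hQm n).preimage measurable_prodMk_left), inter_comm]
    refine measure_mono fun y ⟨⟨⟨y', h1, h2⟩, h3⟩, h4⟩ => ⟨⟨ht.1, h3, ?_⟩, h4⟩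
    have h5 := volume_inter_closedBall_add_le U y (y' - y) (r := r)
    rw [add_sub_cancel] at h5
    rw [dist_eq_norm] at h2
    refine h1.trans (h5.trans (add_le_add le_rfl (mul_le_mul' ?_ (measure_mono ?_))))
    · rw [← ofReal_norm]
      exact ENNReal.ofReal_le_ofReal h2
    · exact inter_subset_inter_right _ (closedBall_subset_closedBall (by linarith))
  · rw [setLAverage_eq, hvolI]
    exact ENNReal.div_le_of_le_mul h_int

end

section

open Set Module Filter Topology Metric

/-- The Euclidean universal cover of `T² × ℝ²`. -/
abbrev Cover : Type := WithLp 2 (ℝ × WithLp 2 (ℝ × EucSp 2))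

theorem finrank_cover : finrank ℝ Cover = 4 := by
  rw [(WithLp.linearEquiv 2 ℝ _).finrank_eq, finrank_prod, (WithLp.linearEquiv 2 ℝ _).finrank_eq,
    finrank_prod, finrank_euclideanSpace_fin, finrank_self]

/-- The point of the cover with given plane and torus coordinates. -/
def coverPt (q : (ℝ × ℝ) × (ℝ × ℝ)) : Cover :=
  WithLp.toLp 2 (q.2.1, WithLp.toLp 2 (q.2.2, !₂[q.1.1, q.1.2]))

theorem dist_coverPt_sq (p q : (ℝ × ℝ) × (ℝ × ℝ)) : dist (coverPt p) (coverPt q) ^ 2 =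
    (p.1.1 - q.1.1) ^ 2 + (p.1.2 - q.1.2) ^ 2 +
      ((p.2.1 - q.2.1) ^ 2 + (p.2.2 - q.2.2) ^ 2) := by
  rw [WithLp.prod_dist_sq, WithLp.prod_dist_sq]
  change dist p.2.1 q.2.1 ^ 2 + (dist p.2.2 q.2.2 ^ 2 +
    dist !₂[p.1.1, p.1.2] !₂[q.1.1, q.1.2] ^ 2) = _
  rw [EuclideanSpace.dist_eq, Real.sq_sqrt (by positivity)]
  simp only [Fin.sum_univ_two, Real.dist_eq, sq_abs]
  simp
  ring

theorem continuous_coverPt : Continuous coverPt := by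
  unfold coverPt
  refine (WithLp.prod_continuous_toLp 2 _ _).comp (Continuous.prodMk (by fun_prop)
    ((WithLp.prod_continuous_toLp 2 _ _).comp (Continuous.prodMk (by fun_prop)
      ((PiLp.continuous_toLp 2 _).comp (continuous_pi fun i => ?_)))))
  fin_cases i <;> simp <;> fun_prop

theorem measurePreserving_coverPt : MeasurePreserving coverPt := by
  have h1 : MeasurePreserving (fun q : ℝ × ℝ => (!₂[q.1, q.2] : EucSp 2)) :=
    (PiLp.volume_preserving_toLp (Fin 2)).comp (volume_preserving_finTwoArrow ℝ).symm
  have h2 : MeasurePreserving (fun q : ℝ × (ℝ × ℝ) =>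
      (WithLp.toLp 2 (q.1, !₂[q.2.1, q.2.2]) : WithLp 2 (ℝ × EucSp 2))) :=
    (WithLp.volume_preserving_toLp ℝ (EucSp 2)).comp ((MeasurePreserving.id volume).prod h1)
  have h3 : MeasurePreserving (fun q : ℝ × (ℝ × (ℝ × ℝ)) =>
      (WithLp.toLp 2 (q.1, WithLp.toLp 2 (q.2.1, !₂[q.2.2.1, q.2.2.2])) : Cover)) :=
    (WithLp.volume_preserving_toLp ℝ (WithLp 2 (ℝ × EucSp 2))).comp
      ((MeasurePreserving.id volume).prod h2)
  have h4 : MeasurePreserving (MeasurableEquiv.prodAssoc : (ℝ × ℝ) × (ℝ × ℝ) ≃ᵐ _) :=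
    volume_preserving_prodAssoc
  have h5 : MeasurePreserving (Prod.swap : (ℝ × ℝ) × (ℝ × ℝ) → (ℝ × ℝ) × (ℝ × ℝ)) :=
    Measure.measurePreserving_swap
  exact h3.comp (h4.comp h5)

/-- The coordinates of a point of the cover. -/
def coverCoord (y : Cover) : (ℝ × ℝ) × (ℝ × ℝ) :=
  ((y.snd.snd 0, y.snd.snd 1), (y.fst, y.snd.fst))

theorem continuous_coverCoord : Continuous coverCoord := by
  unfold coverCoord
  fun_prop

/-- The deck transformations of the cover of the torus of periods `L`. -/
def deckGroup (L : ℝ) : AddSubgroup Cover :=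
  ((zmultiplesHom Cover (coverPt (0, (L, 0)))).coprod
    (zmultiplesHom Cover (coverPt (0, (0, L))))).range

instance (L : ℝ) : Countable (deckGroup L) :=
  (countable_range ((zmultiplesHom Cover (coverPt (0, (L, 0)))).coprod
    (zmultiplesHom Cover (coverPt (0, (0, L)))))).to_subtype

theorem coverPt_add (p q : (ℝ × ℝ) × (ℝ × ℝ)) : coverPt (p + q) = coverPt p + coverPt q := by
  have h : (!₂[p.1.1 + q.1.1, p.1.2 + q.1.2] : EucSp 2) = !₂[p.1.1, p.1.2] + !₂[q.1.1, q.1.2] := by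
    ext i; fin_cases i <;> rfl
  change WithLp.toLp 2 (p.2.1 + q.2.1, WithLp.toLp 2 (p.2.2 + q.2.2,
    !₂[p.1.1 + q.1.1, p.1.2 + q.1.2])) = _
  rw [h]
  rfl

theorem coverPt_zsmul (n : ℤ) (q : (ℝ × ℝ) × (ℝ × ℝ)) : coverPt (n • q) = n • coverPt q :=
  map_zsmul (AddMonoidHom.mk' coverPt coverPt_add) n q

theorem mem_deckGroup {L : ℝ} {g : Cover} :
    g ∈ deckGroup L ↔ ∃ m n : ℤ, g = coverPt (0, (m * L, n * L)) := by
  have h : ∀ m n : ℤ, m • coverPt (0, (L, 0)) + n • coverPt (0, (0, L)) =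
      coverPt (0, (m * L, n * L)) := fun m n => by
    rw [← coverPt_zsmul, ← coverPt_zsmul, ← coverPt_add]
    simp
  constructor
  · rintro ⟨⟨m, n⟩, rfl⟩
    exact ⟨m, n, h m n⟩
  · rintro ⟨m, n, rfl⟩
    exact ⟨(m, n), h m n⟩

/-- The part of the cover above a period cell. -/
def coverCell (L a b : ℝ) : Set Cover := {y | (coverCoord y).2 ∈ cell L a b}

theorem measurableSet_coverCell (L a b : ℝ) : MeasurableSet (coverCell L a b) :=
  (measurable_snd.comp continuous_coverCoord.measurable) (measurableSet_cell L a b)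

theorem existsUnique_deckGroup_vadd_mem {L : ℝ} (hL : 0 < L) (a b : ℝ) (x : Cover) :
    ∃! g : deckGroup L, g +ᵥ x ∈ coverCell L a b := by
  obtain ⟨m, hm, hm'⟩ := existsUnique_add_zsmul_mem_Ico hL x.fst a
  obtain ⟨n, hn, hn'⟩ := existsUnique_add_zsmul_mem_Ico hL x.snd.fst b
  have key : ∀ i j : ℤ, coverPt (0, (i * L, j * L)) + x ∈ coverCell L a b ↔
      x.fst + i • L ∈ Ico a (a + L) ∧ x.snd.fst + j • L ∈ Ico b (b + L) := by
    intro i j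
    rw [zsmul_eq_mul, zsmul_eq_mul, add_comm x.fst, add_comm x.snd.fst]
    rfl
  refine ⟨⟨_, mem_deckGroup.2 ⟨m, n, rfl⟩⟩, (key m n).2 ⟨hm, hn⟩, ?_⟩
  rintro ⟨g, hg⟩ hgx
  obtain ⟨i, j, rfl⟩ := mem_deckGroup.1 hg
  obtain ⟨h1, h2⟩ := (key i j).1 hgx
  rw [Subtype.mk.injEq, hm' i h1, hn' j h2]

theorem measure_inter_coverCell {L : ℝ} (hL : 0 < L) {A : Set Cover} (hA : MeasurableSet A)
    (h : ∀ (g : deckGroup L) y, g +ᵥ y ∈ A ↔ y ∈ A) (a b a' b' : ℝ) :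
    volume (A ∩ coverCell L a b) = volume (A ∩ coverCell L a' b') :=
  (IsAddFundamentalDomain.mk' (measurableSet_coverCell L a b).nullMeasurableSet
    (existsUnique_deckGroup_vadd_mem hL a b)).measure_set_eq
    (IsAddFundamentalDomain.mk' (measurableSet_coverCell L a' b').nullMeasurableSet
    (existsUnique_deckGroup_vadd_mem hL a' b')) hA fun g => by ext y; exact h g y

end

section

open Set Module Filter Topology Metric

theorem isClosed_setOf_le_measure_inter_closedBall {E : Type*} [NormedAddCommGroup E]
    [NormedSpace ℝ E] [ProperSpace E] [MeasurableSpace E] [BorelSpace E] (μ : Measure E)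
    [IsLocallyFiniteMeasure μ] (U : Set E) (c : ℝ≥0∞) {r : ℝ} (hr : 0 ≤ r) :
    IsClosed {y | c ≤ μ (U ∩ closedBall y r)} := by
  have hres : ∀ y s, μ (U ∩ closedBall y s) = μ.restrict U (closedBall y s) := fun y s => by
    rw [Measure.restrict_apply measurableSet_closedBall, inter_comm]
  refine isClosed_of_closure_subset fun y hy => ?_
  have hlim : Tendsto (fun δ => μ.restrict U (cthickening δ (closedBall y r))) (𝓝[>] 0)
      (𝓝 (μ.restrict U (closedBall y r))) := by
    refine (tendsto_measure_cthickening_of_isClosed ⟨1, one_pos, ?_⟩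
      isClosed_closedBall).mono_left nhdsWithin_le_nhds
    rw [cthickening_closedBall zero_le_one hr]
    exact ((Measure.restrict_le_self _).trans_lt measure_closedBall_lt_top).ne
  change c ≤ _
  rw [hres]
  refine ge_of_tendsto hlim ?_
  filter_upwards [self_mem_nhdsWithin] with δ (hδ : 0 < δ)
  obtain ⟨y', hy', hd⟩ := Metric.mem_closure_iff.1 hy δ hδ
  have hy' : c ≤ μ (U ∩ closedBall y' r) := hy'
  rw [hres] at hy'
  rw [cthickening_closedBall hδ.le hr]
  refine hy'.trans (measure_mono (closedBall_subset_closedBall' ?_))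
  rw [dist_comm] at hd
  linarith

theorem measure_inter_closedBall_add {E : Type*} [NormedAddCommGroup E] [MeasurableSpace E]
    [BorelSpace E] (μ : Measure E) [μ.IsAddRightInvariant] {U : Set E} {w : E}
    (hw : ∀ y, y + w ∈ U ↔ y ∈ U) (y : E) (r : ℝ) :
    μ (U ∩ closedBall (y + w) r) = μ (U ∩ closedBall y r) := by
  rw [← measure_preimage_add_right μ w (U ∩ closedBall (y + w) r)]
  congr 1
  ext z
  simp [hw]

theorem exists_volume_setOf_closedBall_subset {U F : Set Cover}
    (h0 : volume (frontier U ∩ F) = 0) {c : ℝ≥0∞} (hc : c < volume (U ∩ F)) {δ : ℝ} (hδ : 0 < δ) :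
    ∃ r, 0 < r ∧ r < δ ∧ c < volume {y | y ∈ F ∧ closedBall y r ⊆ U} := by
  let A : ℕ → Set Cover := fun k => {y | y ∈ F ∧ closedBall y (1 / ((k : ℝ) + 1)) ⊆ U}
  have hA : Monotone A := by
    intro i j hij y hy
    exact ⟨hy.1, (closedBall_subset_closedBall (one_div_le_one_div_of_le (by positivity)
      (by gcongr))).trans hy.2⟩
  have hsub : U ∩ F ⊆ (⋃ k, A k) ∪ (frontier U ∩ F) := by
    rintro y ⟨hy, hyF⟩
    by_cases hi : y ∈ interior U
    · left
      obtain ⟨ρ, hρ, hb⟩ := Metric.isOpen_iff.1 isOpen_interior y hi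
      obtain ⟨k, hk⟩ := exists_nat_one_div_lt hρ
      exact mem_iUnion.2 ⟨k, hyF, (closedBall_subset_ball hk).trans (hb.trans interior_subset)⟩
    · exact Or.inr ⟨⟨subset_closure hy, hi⟩, hyF⟩
  have hle : c < volume (⋃ k, A k) := by
    refine hc.trans_le ((measure_mono hsub).trans ((measure_union_le _ _).trans ?_))
    rw [h0, add_zero]
  have h1 := (tendsto_measure_iUnion_atTop (μ := volume) hA).eventually (lt_mem_nhds hle)
  have h2 := (tendsto_one_div_add_atTop_nhds_zero_nat (𝕜 := ℝ)).eventually (gt_mem_nhds hδ)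
  obtain ⟨k, hk1, hk2⟩ := (h1.and h2).exists
  exact ⟨_, by positivity, hk2, hk1⟩

variable {L : ℝ} {U : Set Cover}

theorem volume_inter_closedBall_le (hL : 0 < L) (hU : MeasurableSet U)
    (hinv : ∀ (g : deckGroup L) y, g +ᵥ y ∈ U ↔ y ∈ U) {r : ℝ} (hr : r < L / 2) {R : ℝ} {y : Cover}
    (hy : R + r ≤ ‖y.snd.snd‖) :
    volume (U ∩ closedBall y r) ≤ volume (U ∩ {z : Cover | R ≤ ‖z.snd.snd‖} ∩ coverCell L 0 0) := by
  have hA : MeasurableSet (U ∩ {z : Cover | R ≤ ‖z.snd.snd‖}) :=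
    hU.inter (measurableSet_le measurable_const (Continuous.measurable (by fun_prop)))
  rw [measure_inter_coverCell hL hA ?_ 0 0 (y.fst - L / 2) (y.snd.fst - L / 2)]
  · refine measure_mono ?_
    rintro z ⟨hzU, hz⟩
    rw [mem_closedBall, dist_eq_norm] at hz
    have h1 : |z.fst - y.fst| ≤ ‖z - y‖ := WithLp.norm_fst_le _ (z - y)
    have h2 : ‖z.snd - y.snd‖ ≤ ‖z - y‖ := WithLp.norm_snd_le _ (z - y)
    have h3 : |z.snd.fst - y.snd.fst| ≤ ‖z.snd - y.snd‖ := WithLp.norm_fst_le _ (z.snd - y.snd)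
    have h4 : ‖z.snd.snd - y.snd.snd‖ ≤ ‖z.snd - y.snd‖ :=
      WithLp.norm_snd_le _ (z.snd - y.snd)
    have h5 := norm_sub_norm_le y.snd.snd z.snd.snd
    rw [norm_sub_rev] at h5
    have h1 := abs_le.1 h1
    have h3 := abs_le.1 h3
    refine ⟨⟨hzU, ?_⟩, ⟨⟨?_, ?_⟩, ⟨?_, ?_⟩⟩⟩
    · change R ≤ ‖z.snd.snd‖
      linarith
    · change y.fst - L / 2 ≤ z.fst
      linarith
    · change z.fst < y.fst - L / 2 + L
      linarith
    · change y.snd.fst - L / 2 ≤ z.snd.fst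
      linarith
    · change z.snd.fst < y.snd.fst - L / 2 + L
      linarith
  · intro g z
    refine and_congr (hinv g z) ?_
    obtain ⟨g, hg⟩ := g
    obtain ⟨m, n, rfl⟩ := mem_deckGroup.1 hg
    change R ≤ ‖(!₂[0, 0] : EucSp 2) + z.snd.snd‖ ↔ R ≤ ‖z.snd.snd‖
    have h0 : (!₂[0, 0] : EucSp 2) = 0 := by ext i; fin_cases i <;> rfl
    rw [h0, zero_add]

theorem exists_forall_norm_lt_of_le_volume_inter_closedBall (hL : 0 < L) (hU : MeasurableSet U)
    (hinv : ∀ (g : deckGroup L) y, g +ᵥ y ∈ U ↔ y ∈ U) (hfin : volume (U ∩ coverCell L 0 0) ≠ ∞)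
    {r : ℝ} (hr0 : 0 < r) (hr : r < L / 2) {c : ℝ≥0∞} (hc : 0 < c) :
    ∃ R, 0 ≤ R ∧ ∀ y, c ≤ volume (U ∩ closedBall y r) → ‖y.snd.snd‖ ≤ R := by
  let A : ℕ → Set Cover := fun n => U ∩ {z : Cover | (n : ℝ) ≤ ‖z.snd.snd‖} ∩ coverCell L 0 0
  have hA : ∀ n, MeasurableSet (A n) := fun n =>
    (hU.inter (measurableSet_le measurable_const (Continuous.measurable (by fun_prop)))).inter
      (measurableSet_coverCell L 0 0)
  have hanti : Antitone A := by
    intro i j hij z hz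
    exact ⟨⟨hz.1.1, (Nat.cast_le.2 hij : (i : ℝ) ≤ j).trans hz.1.2⟩, hz.2⟩
  have hlim := tendsto_measure_iInter_atTop (μ := volume) (fun n => (hA n).nullMeasurableSet) hanti
    ⟨0, ne_top_of_le_ne_top hfin (measure_mono (inter_subset_inter_left _ inter_subset_left))⟩
  have hempty : ⋂ n, A n = ∅ := by
    rw [eq_empty_iff_forall_notMem]
    intro z hz
    obtain ⟨n, hn⟩ := exists_nat_gt ‖z.snd.snd‖
    exact absurd (mem_iInter.1 hz n).1.2 (not_le.2 hn)
  rw [hempty, measure_empty] at hlim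
  obtain ⟨n, hn⟩ := (hlim.eventually (gt_mem_nhds hc)).exists
  refine ⟨n + r, by positivity, fun y hy => ?_⟩
  by_contra! h
  exact absurd (hy.trans (volume_inter_closedBall_le hL hU hinv hr h.le)) (not_le.2 hn)

theorem exists_perBody (hL : 0 < L) (hU : IsClosed U)
    (hinv : ∀ (g : deckGroup L) y, g +ᵥ y ∈ U ↔ y ∈ U) (hfin : volume (U ∩ coverCell L 0 0) ≠ ∞)
    (hper : μHE[3] (frontier U ∩ coverCell L 0 0) ≠ ∞) {c : ℝ≥0∞}
    (hc : c < volume (U ∩ coverCell L 0 0)) {ε : ℕ → ℝ} (hε0 : ∀ n, 0 < ε n)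
    (hε : Tendsto ε atTop (𝓝 0)) :
    ∃ K, PerBody L K ∧ c ≤ bodyVol L K ∧
      liminf (fun n => bodyVol L (bodyNhd (ε n) K \ K) / ENNReal.ofReal (ε n)) atTop ≤
        μHE[3] (frontier U ∩ coverCell L 0 0) := by
  have h0 : volume (frontier U ∩ coverCell L 0 0) = 0 := by
    rw [← InnerProductSpace.euclideanHausdorffMeasure_eq_volume, finrank_cover]
    exact (Measure.euclideanHausdorffMeasure_zero_or_top (by norm_num) _).resolve_right hper
  obtain ⟨r, hr0, hr, hcr⟩ := exists_volume_setOf_closedBall_subset h0 hc (half_pos hL)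
  have h3 : finrank ℝ Cover - 1 = 3 := by rw [finrank_cover]
  obtain ⟨t, ht0, htr, hlim⟩ := exists_superlevel_minkowski_le (measurableSet_coverCell L 0 0)
    (existsUnique_deckGroup_vadd_mem hL 0 0) hinv (by rwa [h3]) hr0 hε0 hε
  rw [h3] at hlim
  have hT := isClosed_setOf_le_measure_inter_closedBall volume U (ENNReal.ofReal t) hr0.le
  have hper : ∀ w, w ∈ deckGroup L → ∀ y r,
      volume (U ∩ closedBall (y + w) r) = volume (U ∩ closedBall y r) := by
    intro w hw y r
    refine measure_inter_closedBall_add volume (fun z => ?_) y r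
    rw [add_comm]
    exact hinv ⟨w, hw⟩ z
  have hpre : ∀ {s : Set Cover}, MeasurableSet s →
      volume (coverPt ⁻¹' s) = volume s := fun hs =>
    measurePreserving_coverPt.measure_preimage hs.nullMeasurableSet
  refine ⟨coverPt ⁻¹' {y | ENNReal.ofReal t ≤ volume (U ∩ closedBall y r)},
    ⟨hT.preimage continuous_coverPt, ?_, ?_, ?_⟩, ?_, ?_⟩
  · intro x p
    have h : coverPt (x, p + (L, 0)) = coverPt (x, p) + coverPt (0, (L, 0)) := by
      rw [← coverPt_add]
      change _ = coverPt (x + 0, _)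
      rw [add_zero]
    rw [mem_preimage, mem_preimage, mem_ofPred_eq, mem_ofPred_eq, h,
      hper _ (mem_deckGroup.2 ⟨1, 0, by simp⟩)]
  · intro x p
    have h : coverPt (x, p + (0, L)) = coverPt (x, p) + coverPt (0, (0, L)) := by
      rw [← coverPt_add]
      change _ = coverPt (x + 0, _)
      rw [add_zero]
    rw [mem_preimage, mem_preimage, mem_ofPred_eq, mem_ofPred_eq, h,
      hper _ (mem_deckGroup.2 ⟨0, 1, by simp⟩)]
  · obtain ⟨R, hR0, hR⟩ := exists_forall_norm_lt_of_le_volume_inter_closedBall hL hU.measurableSet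
      hinv hfin hr0 hr (ENNReal.ofReal_pos.2 ht0)
    refine ⟨R, hR0, fun q hq => ?_⟩
    have h := pow_le_pow_left₀ (norm_nonneg _) (hR _ hq) 2
    change ‖(!₂[q.1.1, q.1.2] : EucSp 2)‖ ^ 2 ≤ R ^ 2 at h
    rw [EuclideanSpace.norm_sq_eq] at h
    simpa [disc, Fin.sum_univ_two] using h
  · refine hcr.le.trans ?_
    have : bodyVol L (coverPt ⁻¹' {y | ENNReal.ofReal t ≤ volume (U ∩ closedBall y r)}) =
        volume ({y | ENNReal.ofReal t ≤ volume (U ∩ closedBall y r)} ∩ coverCell L 0 0) :=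
      hpre (hT.measurableSet.inter (measurableSet_coverCell L 0 0))
    rw [this]
    refine measure_mono ?_
    rintro y ⟨hyF, hyU⟩
    refine ⟨?_, hyF⟩
    rw [mem_ofPred_eq, inter_eq_self_of_subset_right hyU, Measure.addHaar_closedBall_center]
    exact htr
  · refine le_trans (liminf_le_liminf (Eventually.of_forall fun n => ?_)) hlim
    refine ENNReal.div_le_div_right ?_ _
    refine le_trans (measure_mono ?_) (measurePreserving_coverPt.measure_preimage_le _)
    rintro q ⟨⟨⟨q', hq', hd⟩, hqK⟩, hqF⟩
    refine ⟨hqF, ⟨coverPt q', hq', ?_⟩, not_le.1 hqK⟩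
    rw [← sq_le_sq₀ dist_nonneg (hε0 n).le, dist_comm, dist_coverPt_sq]
    exact hd

end

section

open Set Module Filter Topology Metric

/-- The product of the flat torus of periods `L` with the plane. -/
abbrev TorusPlane (L : ℝ) : Type := WithLp 2 (AddCircle L × WithLp 2 (AddCircle L × EucSp 2))

/-- The covering map onto the product of the torus with the plane. -/
def coverProj (L : ℝ) (y : Cover) : TorusPlane L :=
  WithLp.toLp 2 ((y.fst : AddCircle L), WithLp.toLp 2 ((y.snd.fst : AddCircle L), y.snd.snd))

variable {L : ℝ}

theorem dist_coe_addCircle_le (a b : ℝ) : dist (a : AddCircle L) b ≤ dist a b := by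
  rw [dist_eq_norm, dist_eq_norm, ← AddCircle.coe_sub]
  exact QuotientAddGroup.norm_mk_le_norm

theorem dist_coe_addCircle_eq (hL : 0 < L) {a b : ℝ} (h : dist a b ≤ L / 2) :
    dist (a : AddCircle L) b = dist a b := by
  rw [dist_eq_norm, dist_eq_norm, ← AddCircle.coe_sub, Real.norm_eq_abs,
    AddCircle.norm_coe_eq_abs_iff L hL.ne', abs_of_pos hL]
  exact h

theorem dist_coverProj_sq (y z : Cover) : dist (coverProj L y) (coverProj L z) ^ 2 =
    dist (y.fst : AddCircle L) z.fst ^ 2 + (dist (y.snd.fst : AddCircle L) z.snd.fst ^ 2 +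
      dist y.snd.snd z.snd.snd ^ 2) := by
  rw [WithLp.prod_dist_sq, WithLp.prod_dist_sq]
  rfl

theorem dist_cover_sq (y z : Cover) : dist y z ^ 2 =
    dist y.fst z.fst ^ 2 + (dist y.snd.fst z.snd.fst ^ 2 + dist y.snd.snd z.snd.snd ^ 2) := by
  rw [WithLp.prod_dist_sq, WithLp.prod_dist_sq]

theorem dist_coverProj_le (y z : Cover) : dist (coverProj L y) (coverProj L z) ≤ dist y z := by
  rw [← sq_le_sq₀ dist_nonneg dist_nonneg, dist_coverProj_sq, dist_cover_sq]
  gcongr <;> exact dist_coe_addCircle_le _ _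

theorem dist_coverProj_eq (hL : 0 < L) {y z : Cover} (h : dist y z ≤ L / 2) :
    dist (coverProj L y) (coverProj L z) ^ 2 = dist y z ^ 2 := by
  have h1 : dist y.fst z.fst ≤ L / 2 := (WithLp.dist_fst_le y z).trans h
  have h2 : dist y.snd.fst z.snd.fst ≤ L / 2 :=
    ((WithLp.dist_fst_le y.snd z.snd).trans (WithLp.dist_snd_le y z)).trans h
  rw [dist_coverProj_sq, dist_cover_sq, dist_coe_addCircle_eq hL h1, dist_coe_addCircle_eq hL h2]

theorem lipschitzWith_coverProj : LipschitzWith 1 (coverProj L) :=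
  LipschitzWith.of_dist_le_mul fun y z => by simpa using dist_coverProj_le y z

theorem continuous_coverProj : Continuous (coverProj L) :=
  lipschitzWith_coverProj.continuous

theorem isOpenMap_coverProj : IsOpenMap (coverProj L) := by
  have hc : IsOpenMap ((↑) : ℝ → AddCircle L) := QuotientAddGroup.isOpenMap_coe
  have h : coverProj L = (WithLp.homeomorphProd 2 (AddCircle L) _).symm ∘
      (Prod.map (↑) ((WithLp.homeomorphProd 2 (AddCircle L) (EucSp 2)).symm ∘
        Prod.map ((↑) : ℝ → AddCircle L) id ∘ WithLp.homeomorphProd 2 ℝ (EucSp 2))) ∘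
        WithLp.homeomorphProd 2 ℝ _ := rfl
  rw [h]
  exact (Homeomorph.isOpenMap _).comp ((hc.prodMap ((Homeomorph.isOpenMap _).comp
    ((hc.prodMap IsOpenMap.id).comp (Homeomorph.isOpenMap _)))).comp (Homeomorph.isOpenMap _))

theorem coverProj_vadd (g : deckGroup L) (y : Cover) : coverProj L (g +ᵥ y) = coverProj L y := by
  obtain ⟨g, hg⟩ := g
  obtain ⟨m, n, rfl⟩ := mem_deckGroup.1 hg
  have h0 : (!₂[0, 0] : EucSp 2) = 0 := by ext i; fin_cases i <;> rfl
  have hz : ∀ k : ℤ, ((k * L : ℝ) : AddCircle L) = 0 := fun k => by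
    rw [AddCircle.coe_eq_zero_iff]
    exact ⟨k, by simp⟩
  change WithLp.toLp 2 (((m * L + y.fst : ℝ) : AddCircle L), WithLp.toLp 2
    (((n * L + y.snd.fst : ℝ) : AddCircle L), !₂[0, 0] + y.snd.snd)) = _
  rw [AddCircle.coe_add, AddCircle.coe_add, hz, hz, zero_add, zero_add, h0, zero_add]
  rfl

theorem injOn_coverProj (hL : 0 < L) : InjOn (coverProj L) (coverCell L 0 0) := by
  have : Fact (0 < L) := ⟨hL⟩
  intro y hy z hz h
  have h1 : (y.fst : AddCircle L) = z.fst := congrArg (fun w => w.fst) h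
  have h2 : (y.snd.fst : AddCircle L) = z.snd.fst := congrArg (fun w => w.snd.fst) h
  have h3 : y.snd.snd = z.snd.snd := congrArg (fun w => w.snd.snd) h
  replace h1 : y.fst = z.fst := (AddCircle.coe_eq_coe_iff_of_mem_Ico (a := 0) hy.1 hz.1).1 h1
  replace h2 : y.snd.fst = z.snd.fst :=
    (AddCircle.coe_eq_coe_iff_of_mem_Ico (a := 0) hy.2 hz.2).1 h2
  rw [← dist_eq_zero, ← sq_eq_zero_iff, dist_cover_sq, h1, h2, h3]
  simp

theorem surjective_coverProj : Function.Surjective (coverProj L) := by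
  intro w
  obtain ⟨a, ha⟩ := QuotientAddGroup.mk_surjective w.fst
  obtain ⟨b, hb⟩ := QuotientAddGroup.mk_surjective w.snd.fst
  refine ⟨WithLp.toLp 2 (a, WithLp.toLp 2 (b, w.snd.snd)), ?_⟩
  change WithLp.toLp 2 ((a : AddCircle L), WithLp.toLp 2 ((b : AddCircle L), w.snd.snd)) = w
  rw [ha, hb]
  rfl

theorem image_preimage_inter_coverCell (hL : 0 < L) (S : Set (TorusPlane L)) :
    coverProj L '' (coverProj L ⁻¹' S ∩ coverCell L 0 0) = S := by
  refine Subset.antisymm (by rintro _ ⟨y, hy, rfl⟩; exact hy.1) fun w hw => ?_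
  obtain ⟨y, rfl⟩ := surjective_coverProj w
  obtain ⟨g, hg, -⟩ := existsUnique_deckGroup_vadd_mem hL 0 0 y
  have h := coverProj_vadd g y
  exact ⟨g +ᵥ y, ⟨by rwa [mem_preimage, h], hg⟩, h⟩

theorem euclideanHausdorffMeasure_preimage_coverProj (hL : 0 < L) {S : Set (TorusPlane L)}
    (hS : MeasurableSet S) (d : ℕ) :
    μHE[d] (coverProj L ⁻¹' S ∩ coverCell L 0 0) = μHE[d] S := by
  have him := image_preimage_inter_coverCell hL S
  apply le_antisymm
  · conv_rhs => rw [← him]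
    refine le_measure_image_of_locally _ _ ((continuous_coverProj.measurable hS).inter
      (measurableSet_coverCell L 0 0)) continuous_coverProj.continuousOn
      ((injOn_coverProj hL).mono inter_subset_right) fun y _ =>
      ⟨ball y (L / 4), ball_mem_nhds y (by positivity), fun E hE _ _ => ?_⟩
    have := euclideanHausdorffMeasure_image_le_of_dist_sq_le (K := 1) zero_le_one (f := id)
      (g := coverProj L) (s := E) (fun i hi j hj => ?_) d
    · simpa using this
    · have := dist_triangle_right i j y
      have h1 := mem_ball.1 (hE hi)
      have h2 := mem_ball.1 (hE hj)
      rw [dist_coverProj_eq hL (by linarith)]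
      simp
  · conv_lhs => rw [← him]
    have := ((lipschitzWith_coverProj (L := L)).lipschitzOnWith
      (s := coverProj L ⁻¹' S ∩ coverCell L 0 0)).euclideanHausdorffMeasure_image_le d
    simpa using this

theorem hausFactor_mul_isoProfile_sphere_le_haus (hL : 0 < L) (hLpi : L ^ 2 = 4 * π)
    {U : Set (TorusPlane L)} (hU : IsClosed U) {v : ℝ≥0∞} (hv0 : v ≠ 0) (hv : v ≠ ∞)
    (hvol : haus (TorusPlane L) 4 U = v) :
    isoProfile (WithLp 2 (Sph2 × EucSp 2)) 4 v ≤ haus (TorusPlane L) 3 (frontier U) := by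
  rcases eq_or_ne (haus (TorusPlane L) 3 (frontier U)) ∞ with htop | htop
  · rw [htop]; exact le_top
  have hfr : frontier (coverProj L ⁻¹' U) = coverProj L ⁻¹' frontier U :=
    (isOpenMap_coverProj.preimage_frontier_eq_frontier_preimage continuous_coverProj U).symm
  have hV : volume (coverProj L ⁻¹' U ∩ coverCell L 0 0) = hausFactor 4 * v := by
    rw [← InnerProductSpace.euclideanHausdorffMeasure_eq_volume, finrank_cover,
      euclideanHausdorffMeasure_preimage_coverProj hL hU.measurableSet,
      euclideanHausdorffMeasure_eq_mul, hvol]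
  have hP : μHE[3] (frontier (coverProj L ⁻¹' U) ∩ coverCell L 0 0) =
      hausFactor 3 * haus (TorusPlane L) 3 (frontier U) := by
    rw [hfr, euclideanHausdorffMeasure_preimage_coverProj hL isClosed_frontier.measurableSet,
      euclideanHausdorffMeasure_eq_mul]
  have hf0 : ∀ d, (hausFactor d : ℝ≥0∞) ≠ 0 := fun d =>
    ENNReal.coe_ne_zero.2 (hausFactor_ne_zero d)
  rw [← ENNReal.mul_le_mul_iff_right (hf0 3) ENNReal.coe_ne_top, ← hP]
  refine le_of_forall_ofReal_pow_mul_le 3 fun c hc0 hc1 => ?_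
  have hc : ENNReal.ofReal (c ^ 2) * (hausFactor 4 * v) <
      volume (coverProj L ⁻¹' U ∩ coverCell L 0 0) := by
    rw [hV]
    conv_rhs => rw [← one_mul ((hausFactor 4 : ℝ≥0∞) * v)]
    refine ENNReal.mul_lt_mul_left (mul_ne_zero (hf0 4) hv0)
      (ENNReal.mul_ne_top ENNReal.coe_ne_top hv) ?_
    rw [ENNReal.ofReal_lt_one]
    exact pow_lt_one₀ hc0.le hc1 two_ne_zero
  obtain ⟨K, hK, hcK, hlim⟩ := exists_perBody hL (hU.preimage continuous_coverProj)
    (fun g y => by rw [mem_preimage, coverProj_vadd, mem_preimage])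
    (by rw [hV]; exact ENNReal.mul_ne_top ENNReal.coe_ne_top hv)
    (by rw [hP]; exact ENNReal.mul_ne_top ENNReal.coe_ne_top htop) hc
    (ε := fun n : ℕ => 1 / ((n : ℝ) + 1)) (fun n => by positivity)
    tendsto_one_div_add_atTop_nhds_zero_nat
  have hinv : ∀ k : ℕ, ENNReal.ofReal (c ^ k) * ENNReal.ofReal (c⁻¹ ^ k) = 1 := fun k => by
    rw [← ENNReal.ofReal_mul (by positivity), ← mul_pow, mul_inv_cancel₀ hc0.ne', one_pow,
      ENNReal.ofReal_one]
  have hmain := hK.hausFactor_mul_isoProfile_sphere_le hL hLpi hv0 (μ := c⁻¹)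
    (one_le_inv₀ hc0 |>.2 hc1.le) ?_
    (tendsto_nhdsWithin_iff.2 ⟨tendsto_one_div_add_atTop_nhds_zero_nat,
      Eventually.of_forall fun n => mem_Ioi.2 (by positivity)⟩)
  · refine (mul_le_mul_right (hmain.trans (mul_le_mul_right hlim _)) _).trans ?_
    rw [← mul_assoc, hinv, one_mul]
  · calc (hausFactor 4 : ℝ≥0∞) * v
        = ENNReal.ofReal (c⁻¹ ^ 2) * (ENNReal.ofReal (c ^ 2) * (hausFactor 4 * v)) := by
          rw [← mul_assoc, mul_comm (ENNReal.ofReal (c⁻¹ ^ 2)), hinv, one_mul]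
      _ ≤ _ := by gcongr

end

/-- Let `T² = S¹_{1/√π} × S¹_{1/√π}` be the flat square torus of area `4π`, and `S²` the
unit round sphere.  Then for every `v > 0`, `I_{S²×ℝ²}(v) ≤ I_{T²×ℝ²}(v)`. -/
theorem sphere_profile_le_torus_profile_R2 (v : ℝ) (hv : 0 < v) :
    isoProfile (WithLp 2 (Sph2 × EucSp 2)) 4 (ENNReal.ofReal v)
      ≤ isoProfile (T2R (Real.sqrt Real.pi)⁻¹ (Real.sqrt Real.pi)⁻¹ 2) 4
          (ENNReal.ofReal v) := by
  have hpi := Real.sqrt_pos.2 Real.pi_pos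
  refine le_iInf₂ fun U hU => ?_
  obtain ⟨⟨V, -, rfl⟩, hvol⟩ := hU
  refine hausFactor_mul_isoProfile_sphere_le_haus (L := 2 * Real.pi * (Real.sqrt Real.pi)⁻¹)
    (by positivity) ?_ isClosed_closure (ENNReal.ofReal_pos.2 hv).ne' ENNReal.ofReal_ne_top hvol
  rw [mul_pow, inv_pow, Real.sq_sqrt Real.pi_pos.le]
  field_simp
  norm_num

end
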